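/- Let γ be a smooth map from ℝ³ to the positive-definite symmetric 3×3 real matrices such that for every multi-index β one has ∂^β(γ_{μν}(x) − δ_{μν}) = o(|x|^{−1/2−|β|}) as |x| → ∞ (for all components μ,ν), and let f : ℝ³ → ℝ be smooth with f ≥ 0 and ∂^β f(x) = o(|x|^{−3−|β|}) as |x| → ∞ for every multi-index β. Then there exists a unique smooth function α : ℝ³ → ℝ satisfying the equation (det γ)^{−1/2} ∂_μ( (det γ)^{1/2} (γ^{−1})^{μν} ∂_ν α ) = f α on ℝ³ together with α(x) → 1 as |x| → ∞. Moreover this solution satisfies ∂^β(α − 1)(x) = o(|x|^{−1/2−|β|}) as |x| → ∞ for every multi-index β, and there exists ε > 0 such that α(x) ≥ ε for all x ∈ ℝ³. -/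

import Mathlib

open Real Filter Asymptotics

noncomputable section

/-- Partial derivative of a scalar function on ℝ³ in the μ-th coordinate direction. -/
def pd3 (μ : Fin 3) (g : EuclideanSpace ℝ (Fin 3) → ℝ) (x : EuclideanSpace ℝ (Fin 3)) : ℝ :=
  fderiv ℝ g x (EuclideanSpace.single μ 1)

/-- The Laplace–Beltrami operator of the metric γ, in the global coordinates of ℝ³ :
`Δ_γ α = (det γ)^{-1/2} ∂_μ ( (det γ)^{1/2} (γ⁻¹)^{μν} ∂_ν α )`. -/
def laplaceBeltrami (γ : EuclideanSpace ℝ (Fin 3) → Matrix (Fin 3) (Fin 3) ℝ)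
    (α : EuclideanSpace ℝ (Fin 3) → ℝ) (x : EuclideanSpace ℝ (Fin 3)) : ℝ :=
  (Real.sqrt (γ x).det)⁻¹ *
    ∑ μ, pd3 μ (fun y => Real.sqrt (γ y).det * ∑ ν, (γ y)⁻¹ μ ν * pd3 ν α y) x

section

open scoped ContDiff

/-- Three-dimensional Euclidean space. -/
abbrev E3 := EuclideanSpace ℝ (Fin 3)

/-! ### Calculus of the partial derivatives `pd3` -/

lemma ContDiff.pd {m n : WithTop ℕ∞} {g : E3 → ℝ} (hg : ContDiff ℝ n g) (hmn : m + 1 ≤ n)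
    (i : Fin 3) : ContDiff ℝ m (pd3 i g) :=
  (hg.fderiv_right hmn).clm_apply contDiff_const

lemma contDiff_pd3 {g : E3 → ℝ} (hg : ContDiff ℝ ∞ g) (i : Fin 3) : ContDiff ℝ ∞ (pd3 i g) :=
  hg.pd (by simp) i

lemma smooth_differentiable {g : E3 → ℝ} (hg : ContDiff ℝ ∞ g) : Differentiable ℝ g :=
  hg.differentiable (by simp)

lemma pd3_mul {f g : E3 → ℝ} {x : E3} (hf : DifferentiableAt ℝ f x) (hg : DifferentiableAt ℝ g x)
    (i : Fin 3) :
    pd3 i (fun y => f y * g y) x = pd3 i f x * g x + f x * pd3 i g x := by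
  simp only [pd3]
  rw [fderiv_fun_mul hf hg]
  simp
  ring

lemma pd3_add {f g : E3 → ℝ} {x : E3} (hf : DifferentiableAt ℝ f x) (hg : DifferentiableAt ℝ g x)
    (i : Fin 3) : pd3 i (fun y => f y + g y) x = pd3 i f x + pd3 i g x := by
  simp only [pd3]
  rw [fderiv_fun_add hf hg]
  simp

lemma pd3_sub {f g : E3 → ℝ} {x : E3} (hf : DifferentiableAt ℝ f x) (hg : DifferentiableAt ℝ g x)
    (i : Fin 3) : pd3 i (fun y => f y - g y) x = pd3 i f x - pd3 i g x := by
  simp only [pd3]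
  rw [fderiv_fun_sub hf hg]
  simp

lemma pd3_const_mul {g : E3 → ℝ} {x : E3} (c : ℝ) (hg : DifferentiableAt ℝ g x)
    (i : Fin 3) : pd3 i (fun y => c * g y) x = c * pd3 i g x := by
  simp only [pd3]
  rw [fderiv_const_mul hg]
  simp

lemma pd3_sum {ι : Type*} (s : Finset ι) {f : ι → E3 → ℝ} {x : E3}
    (hf : ∀ j ∈ s, DifferentiableAt ℝ (f j) x) (i : Fin 3) :
    pd3 i (fun y => ∑ j ∈ s, f j y) x = ∑ j ∈ s, pd3 i (f j) x := by
  simp only [pd3]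
  rw [fderiv_fun_sum hf]
  simp

lemma pd3_const (c : ℝ) (i : Fin 3) : pd3 i (fun _ => c) = fun _ => 0 := by
  funext x
  simp [pd3]

lemma pd3_add_const (g : E3 → ℝ) (c : ℝ) (i : Fin 3) : pd3 i (fun y => g y + c) = pd3 i g := by
  funext x
  simp [pd3, fderiv_add_const]

lemma pd3_inv {g : E3 → ℝ} {x : E3} (hg : DifferentiableAt ℝ g x) (hx : g x ≠ 0) (i : Fin 3) :
    pd3 i (fun y => (g y)⁻¹) x = (-1 * pd3 i g x) * ((g x)⁻¹ * (g x)⁻¹) := by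
  have h : HasFDerivAt (fun y => (g y)⁻¹) (-(g x ^ 2)⁻¹ • fderiv ℝ g x) x :=
    (hasDerivAt_inv hx).comp_hasFDerivAt x hg.hasFDerivAt
  simp only [pd3, h.fderiv]
  simp
  ring

lemma pd3_comm {g : E3 → ℝ} (hg : ContDiff ℝ 2 g) (i j : Fin 3) :
    pd3 i (pd3 j g) = pd3 j (pd3 i g) := by
  have key : ∀ (i j : Fin 3) (x : E3), pd3 i (pd3 j g) x =
      fderiv ℝ (fderiv ℝ g) x (EuclideanSpace.single i 1) (EuclideanSpace.single j 1) := by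
    intro i j x
    have hd : DifferentiableAt ℝ (fderiv ℝ g) x :=
      (hg.fderiv_right (m := 1) (by norm_num)).differentiable (by simp) x
    change fderiv ℝ (fun y => fderiv ℝ g y (EuclideanSpace.single j 1)) x _ = _
    rw [fderiv_clm_apply hd (by fun_prop)]
    simp
  funext x
  rw [key, key]
  exact (hg.contDiffAt.isSymmSndFDerivAt (by simp)) _ _

/-! ### The Japanese bracket and graded classes of functions -/

/-- The Japanese bracket `√(1 + ‖x‖²)`. -/
def jb (x : E3) : ℝ := √(1 + ‖x‖ ^ 2)

lemma jb_sq (x : E3) : jb x ^ 2 = 1 + ‖x‖ ^ 2 := Real.sq_sqrt (by positivity)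

lemma jb_pos (x : E3) : 0 < jb x := Real.sqrt_pos.2 (by positivity)

lemma one_le_jb (x : E3) : 1 ≤ jb x := by
  have := jb_sq x
  nlinarith [jb_pos x, sq_nonneg ‖x‖]

lemma norm_le_jb (x : E3) : ‖x‖ ≤ jb x := by
  have := jb_sq x
  nlinarith [jb_pos x, norm_nonneg x]

lemma jb_le_of_one_le {x : E3} (hx : 1 ≤ ‖x‖) : jb x ≤ 2 * ‖x‖ := by
  have := jb_sq x
  nlinarith [jb_pos x, norm_nonneg x]

lemma contDiff_jb : ContDiff ℝ ∞ jb := by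
  unfold jb
  exact ContDiff.sqrt (contDiff_const.add (contDiff_norm_sq ℝ)) (fun x => by positivity)

lemma continuous_jb : Continuous jb := contDiff_jb.continuous

lemma continuous_jb_zpow (s : ℤ) : Continuous fun x => jb x ^ s :=
  continuous_jb.zpow₀ s (fun x => Or.inl (jb_pos x).ne')

lemma contDiff_jb_zpow (s : ℤ) : ContDiff ℝ ∞ fun x => jb x ^ s := by
  cases s with
  | ofNat n => simpa using contDiff_jb.pow n
  | negSucc n =>
    simp only [zpow_negSucc]
    exact (contDiff_jb.pow _).inv (fun x => (pow_pos (jb_pos x) _).ne')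

/-- `Tower P n s g`: each partial derivative `∂^β g` with `|β| ≤ n` lies in the class
`P (s + |β|)`. -/
def Tower (P : ℤ → (E3 → ℝ) → Prop) : ℕ → ℤ → (E3 → ℝ) → Prop
  | 0, s, g => P s g
  | n + 1, s, g => P s g ∧ ∀ i, Tower P n (s + 1) (pd3 i g)

lemma Tower.base {P : ℤ → (E3 → ℝ) → Prop} {n : ℕ} {s : ℤ} {g : E3 → ℝ} (h : Tower P n s g) :
    P s g := by
  cases n with
  | zero => exact h
  | succ n => exact h.1

lemma Tower.pred {P : ℤ → (E3 → ℝ) → Prop} {n : ℕ} {s : ℤ} {g : E3 → ℝ} (h : Tower P (n + 1) s g) :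
    Tower P n s g := by
  induction n generalizing s g with
  | zero => exact h.1
  | succ n ih => exact ⟨h.1, fun i => ih (h.2 i)⟩

lemma Tower.mono {P : ℤ → (E3 → ℝ) → Prop} {m n : ℕ} (hmn : m ≤ n) {s : ℤ} {g : E3 → ℝ}
    (h : Tower P n s g) : Tower P m s g := by
  induction n, hmn using Nat.le_induction with
  | base => exact h
  | succ n _ ih => exact ih h.pred

lemma Tower.weaken {P Q : ℤ → (E3 → ℝ) → Prop} {k : ℤ}
    (hPQ : ∀ s g, ContDiff ℝ ∞ g → P s g → Q (s - k) g)
    {n : ℕ} {s : ℤ} {g : E3 → ℝ} (hg : ContDiff ℝ ∞ g) (h : Tower P n s g) :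
    Tower Q n (s - k) g := by
  induction n generalizing s g with
  | zero => exact hPQ _ _ hg h
  | succ n ih =>
    refine ⟨hPQ _ _ hg h.1, fun i => ?_⟩
    have := ih (contDiff_pd3 hg i) (h.2 i)
    rwa [show s - k + 1 = s + 1 - k by ring]

lemma Tower.add {P : ℤ → (E3 → ℝ) → Prop}
    (hP : ∀ s f g, ContDiff ℝ ∞ f → ContDiff ℝ ∞ g → P s f → P s g → P s (fun x => f x + g x))
    {n : ℕ} {s : ℤ} {f g : E3 → ℝ} (hf : ContDiff ℝ ∞ f) (hg : ContDiff ℝ ∞ g)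
    (h₁ : Tower P n s f) (h₂ : Tower P n s g) : Tower P n s (fun x => f x + g x) := by
  induction n generalizing s f g with
  | zero => exact hP _ _ _ hf hg h₁ h₂
  | succ n ih =>
    refine ⟨hP _ _ _ hf hg h₁.1 h₂.1, fun i => ?_⟩
    have e : pd3 i (fun x => f x + g x) = fun x => pd3 i f x + pd3 i g x := by
      funext x
      exact pd3_add (smooth_differentiable hf x) (smooth_differentiable hg x) i
    rw [e]
    exact ih (contDiff_pd3 hf i) (contDiff_pd3 hg i) (h₁.2 i) (h₂.2 i)

lemma Tower.mul {P Q R : ℤ → (E3 → ℝ) → Prop}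
    (hadd : ∀ s f g, ContDiff ℝ ∞ f → ContDiff ℝ ∞ g → R s f → R s g → R s (fun x => f x + g x))
    (hmul : ∀ s t f g, ContDiff ℝ ∞ f → ContDiff ℝ ∞ g → P s f → Q t g →
      R (s + t) (fun x => f x * g x))
    {n : ℕ} {s t : ℤ} {f g : E3 → ℝ} (hf : ContDiff ℝ ∞ f) (hg : ContDiff ℝ ∞ g)
    (h₁ : Tower P n s f) (h₂ : Tower Q n t g) : Tower R n (s + t) (fun x => f x * g x) := by
  induction n generalizing s t f g with
  | zero => exact hmul _ _ _ _ hf hg h₁ h₂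
  | succ n ih =>
    refine ⟨hmul _ _ _ _ hf hg h₁.1 h₂.1, fun i => ?_⟩
    have e : pd3 i (fun x => f x * g x) = fun x => pd3 i f x * g x + f x * pd3 i g x := by
      funext x
      exact pd3_mul (smooth_differentiable hf x) (smooth_differentiable hg x) i
    rw [e]
    have a := ih (contDiff_pd3 hf i) hg (h₁.2 i) h₂.pred
    have b := ih hf (contDiff_pd3 hg i) h₁.pred (h₂.2 i)
    rw [show s + 1 + t = s + t + 1 by ring] at a
    rw [show s + (t + 1) = s + t + 1 by ring] at b
    exact Tower.add hadd ((contDiff_pd3 hf i).mul hg) (hf.mul (contDiff_pd3 hg i)) a b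

/-- Pointwise decay of order `s`. -/
def DecayBd (s : ℤ) (g : E3 → ℝ) : Prop := ∃ C, ∀ x, |g x| * jb x ^ s ≤ C

/-- Smooth functions all of whose derivatives satisfy `|∂^β g| ≤ C ⟨x⟩^(-s-|β|)`. -/
structure Symb (s : ℤ) (g : E3 → ℝ) : Prop where
  smooth : ContDiff ℝ ∞ g
  tower : ∀ n, Tower DecayBd n s g

lemma DecayBd.add (s : ℤ) (f g : E3 → ℝ) (hf : DecayBd s f) (hg : DecayBd s g) :
    DecayBd s (fun x => f x + g x) := by
  obtain ⟨C, hC⟩ := hf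
  obtain ⟨D, hD⟩ := hg
  refine ⟨C + D, fun x => ?_⟩
  have := mul_le_mul_of_nonneg_right (abs_add_le (f x) (g x)) (zpow_pos (jb_pos x) s).le
  linarith [hC x, hD x]

lemma DecayBd.mul (s t : ℤ) (f g : E3 → ℝ) (hf : DecayBd s f) (hg : DecayBd t g) :
    DecayBd (s + t) (fun x => f x * g x) := by
  obtain ⟨C, hC⟩ := hf
  obtain ⟨D, hD⟩ := hg
  refine ⟨C * D, fun x => ?_⟩
  rw [abs_mul, zpow_add₀ (jb_pos x).ne']
  have h1 := zpow_pos (jb_pos x) s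
  have h2 := zpow_pos (jb_pos x) t
  calc _ = (|f x| * jb x ^ s) * (|g x| * jb x ^ t) := by ring
    _ ≤ C * D := mul_le_mul (hC x) (hD x) (by positivity) (le_trans (by positivity) (hC x))

lemma DecayBd.weaken {s t : ℤ} (hst : t ≤ s) {g : E3 → ℝ} (hg : DecayBd s g) : DecayBd t g := by
  obtain ⟨C, hC⟩ := hg
  exact ⟨C, fun x => le_trans (mul_le_mul_of_nonneg_left
    (zpow_le_zpow_right₀ (one_le_jb x) hst) (abs_nonneg _)) (hC x)⟩

lemma Symb.add {s : ℤ} {f g : E3 → ℝ} (hf : Symb s f) (hg : Symb s g) : Symb s (fun x => f x + g x) :=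
  ⟨hf.smooth.add hg.smooth, fun n => Tower.add (fun s f g _ _ => DecayBd.add s f g)
    hf.smooth hg.smooth (hf.tower n) (hg.tower n)⟩

lemma Symb.mul {s t : ℤ} {f g : E3 → ℝ} (hf : Symb s f) (hg : Symb t g) :
    Symb (s + t) (fun x => f x * g x) :=
  ⟨hf.smooth.mul hg.smooth, fun n => Tower.mul (fun s f g _ _ => DecayBd.add s f g)
    (fun s t f g _ _ => DecayBd.mul s t f g) hf.smooth hg.smooth (hf.tower n) (hg.tower n)⟩

lemma Symb.pd {s : ℤ} {g : E3 → ℝ} (hg : Symb s g) (i : Fin 3) : Symb (s + 1) (pd3 i g) :=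
  ⟨contDiff_pd3 hg.smooth i, fun n => (hg.tower (n + 1)).2 i⟩

lemma Symb.weaken {s t : ℤ} (hst : t ≤ s) {g : E3 → ℝ} (hg : Symb s g) : Symb t g := by
  refine ⟨hg.smooth, fun n => ?_⟩
  have := Tower.weaken (Q := DecayBd) (k := s - t)
    (fun r g _ h => DecayBd.weaken (show r - (s - t) ≤ r by linarith) h) hg.smooth (hg.tower n)
  rwa [show s - (s - t) = t by ring] at this

lemma Symb.bound {s : ℤ} {g : E3 → ℝ} (hg : Symb s g) :
    ∃ C, 0 ≤ C ∧ ∀ x, |g x| * jb x ^ s ≤ C := by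
  obtain ⟨C, hC⟩ := (hg.tower 0).base
  have := jb_pos 0
  exact ⟨C, le_trans (by positivity) (hC 0), hC⟩

lemma DecayBd.zero (s : ℤ) : DecayBd s (fun _ => 0) := ⟨0, fun x => by simp⟩

lemma Symb.zero (s : ℤ) : Symb s (fun _ => 0) := by
  refine ⟨contDiff_const, fun n => ?_⟩
  induction n generalizing s with
  | zero => exact DecayBd.zero s
  | succ n ih => exact ⟨DecayBd.zero s, fun i => by rw [pd3_const]; exact ih _⟩

lemma Symb.const (c : ℝ) : Symb 0 (fun _ => c) := by
  refine ⟨contDiff_const, fun n => ?_⟩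
  cases n with
  | zero => exact ⟨|c|, fun x => by simp⟩
  | succ n => exact ⟨⟨|c|, fun x => by simp⟩, fun i => by rw [pd3_const]; exact (Symb.zero _).tower n⟩

lemma Symb.const_mul {s : ℤ} {g : E3 → ℝ} (hg : Symb s g) (c : ℝ) : Symb s (fun x => c * g x) := by
  simpa using (Symb.const c).mul hg

lemma Symb.sum {ι : Type*} {s : ℤ} (S : Finset ι) {g : ι → E3 → ℝ} (hg : ∀ j ∈ S, Symb s (g j)) :
    Symb s (fun x => ∑ j ∈ S, g j x) := by
  classical
  induction S using Finset.induction_on with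
  | empty => simpa using Symb.zero s
  | insert a S ha ih =>
    simp only [Finset.sum_insert ha]
    exact (hg a (by simp)).add (ih fun j hj => hg j (by simp [hj]))

lemma Symb.of_pd {s : ℤ} {g : E3 → ℝ} (hs : ContDiff ℝ ∞ g) (hb : DecayBd s g)
    (h : ∀ n, (Tower DecayBd n s g) → ∀ i, Tower DecayBd n (s + 1) (pd3 i g)) : Symb s g := by
  refine ⟨hs, fun n => ?_⟩
  induction n with
  | zero => exact hb
  | succ n ih => exact ⟨hb, h n ih⟩

lemma Tower.mulBd {n : ℕ} {s t : ℤ} {f g : E3 → ℝ} (hf : ContDiff ℝ ∞ f) (hg : ContDiff ℝ ∞ g)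
    (h₁ : Tower DecayBd n s f) (h₂ : Tower DecayBd n t g) :
    Tower DecayBd n (s + t) (fun x => f x * g x) :=
  Tower.mul (fun s f g _ _ => DecayBd.add s f g) (fun s t f g _ _ => DecayBd.mul s t f g) hf hg h₁ h₂

lemma Symb.inv {s : ℤ} {g : E3 → ℝ} (hg : Symb s g) {c : ℝ} (hc : 0 < c)
    (hgc : ∀ x, c ≤ g x * jb x ^ s) : Symb (-s) (fun x => (g x)⁻¹) := by
  have hpos : ∀ x, 0 < g x := fun x =>
    pos_of_mul_pos_left (lt_of_lt_of_le hc (hgc x)) (zpow_pos (jb_pos x) s).le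
  have hsm : ContDiff ℝ ∞ fun x => (g x)⁻¹ := hg.smooth.inv (fun x => (hpos x).ne')
  refine Symb.of_pd hsm ⟨c⁻¹, fun x => ?_⟩ fun n ih i => ?_
  · rw [abs_of_pos (inv_pos.2 (hpos x)), zpow_neg, ← mul_inv]
    exact inv_anti₀ hc (hgc x)
  · have e : pd3 i (fun x => (g x)⁻¹) = fun x => (-1 * pd3 i g x) * ((g x)⁻¹ * (g x)⁻¹) := by
      funext x
      exact pd3_inv (smooth_differentiable hg.smooth x) (hpos x).ne' i
    rw [e]
    have := Tower.mulBd ((contDiff_pd3 hg.smooth i).const_smul (-1 : ℝ)) (hsm.mul hsm)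
      (((hg.pd i).const_mul (-1)).tower n) (Tower.mulBd hsm hsm ih ih)
    rwa [show s + 1 + (-s + -s) = -s + 1 by ring] at this

lemma Symb.sqrt {g : E3 → ℝ} (hg : Symb 0 g) {c : ℝ} (hc : 0 < c)
    (hgc : ∀ x, c ≤ g x) : Symb 0 (fun x => √(g x)) := by
  have hpos : ∀ x, 0 < g x := fun x => lt_of_lt_of_le hc (hgc x)
  have hsm : ContDiff ℝ ∞ fun x => √(g x) := hg.smooth.sqrt (fun x => (hpos x).ne')
  have hinv := hg.inv hc (by simpa using hgc)
  refine Symb.of_pd hsm ?_ fun n ih i => ?_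
  · obtain ⟨C, hC⟩ := (hg.tower 0).base
    refine ⟨√C, fun x => ?_⟩
    simp only [zpow_zero, mul_one] at hC ⊢
    rw [abs_of_nonneg (Real.sqrt_nonneg _)]
    exact Real.sqrt_le_sqrt ((le_abs_self _).trans (hC x))
  · have e : pd3 i (fun x => √(g x)) = fun x => (2⁻¹ * pd3 i g x) * (√(g x) * (g x)⁻¹) := by
      funext x
      have h1 : HasFDerivAt (fun x => √(g x)) ((1 / (2 * √(g x))) • fderiv ℝ g x) x :=
        (smooth_differentiable hg.smooth x).hasFDerivAt.sqrt (hpos x).ne'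
      simp only [pd3]
      rw [h1.fderiv]
      have h2 : √(g x) ≠ 0 := (Real.sqrt_pos.2 (hpos x)).ne'
      have h3 : g x = √(g x) * √(g x) := (Real.mul_self_sqrt (hpos x).le).symm
      rw [smul_apply, smul_eq_mul]
      rw [show (g x)⁻¹ = (√(g x) * √(g x))⁻¹ by rw [← h3]]
      field_simp
    rw [e]
    have := Tower.mulBd ((contDiff_pd3 hg.smooth i).const_smul (2⁻¹ : ℝ)) (hsm.mul hinv.smooth)
      (((hg.pd i).const_mul 2⁻¹).tower n) (Tower.mulBd hsm hinv.smooth ih (hinv.tower n))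
    simpa using this

lemma pd3_coord (i j : Fin 3) : pd3 i (fun x : E3 => x j) = fun _ => if i = j then 1 else 0 := by
  funext x
  have : HasFDerivAt (fun x : E3 => x j) (EuclideanSpace.proj j : E3 →L[ℝ] ℝ) x :=
    (EuclideanSpace.proj j : E3 →L[ℝ] ℝ).hasFDerivAt
  simp only [pd3, this.fderiv]
  simp [eq_comm]

lemma Symb.coord (j : Fin 3) : Symb (-1) (fun x : E3 => x j) := by
  have hsm : ContDiff ℝ ∞ (fun x : E3 => x j) := (EuclideanSpace.proj j : E3 →L[ℝ] ℝ).contDiff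
  refine Symb.of_pd hsm ⟨1, fun x => ?_⟩ fun n _ i => ?_
  · have h1 : |x j| ≤ jb x := (by simpa using PiLp.norm_apply_le x j : |x j| ≤ ‖x‖).trans (norm_le_jb x)
    rw [zpow_neg_one]
    exact mul_inv_le_one_of_le₀ h1 (jb_pos x).le
  · rw [pd3_coord]
    simpa using (Symb.const (if i = j then 1 else 0)).tower n

lemma pd3_jb (i : Fin 3) : pd3 i jb = fun x => x i * (jb x)⁻¹ := by
  funext x
  have h1 : HasFDerivAt (fun x : E3 => 1 + ‖x‖ ^ 2) (2 • (innerSL ℝ x)) x := by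
    simpa using ((hasStrictFDerivAt_norm_sq x).hasFDerivAt).const_add 1
  have h2 := h1.sqrt (by positivity)
  have h3 : pd3 i jb x = fderiv ℝ (fun x : E3 => √(1 + ‖x‖ ^ 2)) x (EuclideanSpace.single i 1) := rfl
  rw [h3, h2.fderiv]
  simp [jb, EuclideanSpace.inner_single_right]
  ring

lemma symb_jb : Symb (-1) jb := by
  have hb : DecayBd (-1) jb := ⟨1, fun x => by
    rw [abs_of_pos (jb_pos x), zpow_neg_one, mul_inv_cancel₀ (jb_pos x).ne']⟩
  have hinv : ∀ n, Tower DecayBd n (-1) jb → Tower DecayBd n 1 (fun x => (jb x)⁻¹) := by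
    intro n
    induction n with
    | zero =>
      intro _
      exact ⟨1, fun x => by
        rw [abs_of_pos (inv_pos.2 (jb_pos x)), zpow_one, inv_mul_cancel₀ (jb_pos x).ne']⟩
    | succ n ih =>
      intro h
      have hi := ih h.pred
      have hsm : ContDiff ℝ ∞ fun x => (jb x)⁻¹ := contDiff_jb.inv fun x => (jb_pos x).ne'
      refine ⟨⟨1, fun x => by
        rw [abs_of_pos (inv_pos.2 (jb_pos x)), zpow_one, inv_mul_cancel₀ (jb_pos x).ne']⟩, fun i => ?_⟩
      have e : pd3 i (fun x => (jb x)⁻¹) =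
          fun x => (-1 * pd3 i jb x) * ((jb x)⁻¹ * (jb x)⁻¹) := by
        funext x
        exact pd3_inv (smooth_differentiable contDiff_jb x) (jb_pos x).ne' i
      rw [e]
      have h1 : Tower DecayBd n (0 + 0) (fun x => -1 * pd3 i jb x) :=
        Tower.mulBd contDiff_const (contDiff_pd3 contDiff_jb i) ((Symb.const (-1)).tower n) (h.2 i)
      simpa using Tower.mulBd (contDiff_const.mul (contDiff_pd3 contDiff_jb i)) (hsm.mul hsm) h1
        (Tower.mulBd hsm hsm hi hi)
  refine Symb.of_pd contDiff_jb hb fun n ih i => ?_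
  rw [pd3_jb]
  have := Tower.mulBd (Symb.coord i).smooth (contDiff_jb.inv fun x => (jb_pos x).ne')
    ((Symb.coord i).tower n) (hinv n ih)
  simpa using this

lemma symb_jb_inv : Symb 1 (fun x => (jb x)⁻¹) := by
  simpa using symb_jb.inv one_pos fun x => by
    rw [zpow_neg_one, mul_inv_cancel₀ (jb_pos x).ne']

lemma symb_jb_pow (n : ℕ) : Symb (-n) (fun x => jb x ^ n) := by
  induction n with
  | zero => simpa using Symb.const 1
  | succ n ih =>
    have := ih.mul symb_jb
    simp only [pow_succ]
    convert this using 1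
    push_cast
    ring

lemma symb_jb_zpow (t : ℤ) : Symb (-t) (fun x => jb x ^ t) := by
  obtain ⟨n, rfl | rfl⟩ := t.eq_nat_or_neg
  · simpa using symb_jb_pow n
  · induction n with
    | zero => simpa using Symb.const 1
    | succ n ih =>
      have h := ih.mul symb_jb_inv
      convert h using 1
      · push_cast
        ring
      · funext x
        have := (jb_pos x).ne'
        push_cast
        rw [neg_add, zpow_add₀ this, zpow_neg_one]

/-! ### Partial derivatives and iterated Fréchet derivatives -/

lemma norm_iteratedFDeriv_pd3_le {g : E3 → ℝ} (hg : ContDiff ℝ ∞ g) (m : ℕ) (i : Fin 3) (x : E3) :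
    ‖iteratedFDeriv ℝ m (pd3 i g) x‖ ≤ ‖iteratedFDeriv ℝ (m + 1) g x‖ := by
  have hd : ContDiff ℝ ∞ (fderiv ℝ g) := hg.fderiv_right (by simp)
  have h := ContinuousLinearMap.norm_iteratedFDeriv_comp_left (x := x) (n := m)
    (ContinuousLinearMap.apply ℝ ℝ (EuclideanSpace.single i (1 : ℝ)) : (E3 →L[ℝ] ℝ) →L[ℝ] ℝ)
    hd.contDiffAt (by exact_mod_cast le_top)
  rw [norm_iteratedFDeriv_fderiv] at h
  have hL : ‖(ContinuousLinearMap.apply ℝ ℝ (EuclideanSpace.single i (1 : ℝ)) :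
      (E3 →L[ℝ] ℝ) →L[ℝ] ℝ)‖ ≤ 1 := by
    refine ContinuousLinearMap.opNorm_le_bound _ zero_le_one fun L => ?_
    have := L.le_opNorm (EuclideanSpace.single i (1 : ℝ))
    simpa using this
  exact h.trans (mul_le_of_le_one_left (norm_nonneg _) hL)

lemma fderiv_eq_sum_pd3 (g : E3 → ℝ) (x : E3) :
    fderiv ℝ g x = ∑ i, pd3 i g x • (EuclideanSpace.proj i : E3 →L[ℝ] ℝ) := by
  have key : ∀ v : E3, v = ∑ i, v i • EuclideanSpace.single i (1 : ℝ) := by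
    intro v
    ext j
    simp [Finset.sum_apply, Pi.single_apply]
  ext v
  conv_lhs => rw [key v]
  simp [pd3, mul_comm]

lemma norm_iteratedFDeriv_succ_le {g : E3 → ℝ} (hg : ContDiff ℝ ∞ g) (m : ℕ) (x : E3) :
    ‖iteratedFDeriv ℝ (m + 1) g x‖ ≤ ∑ i, ‖iteratedFDeriv ℝ m (pd3 i g) x‖ := by
  rw [← norm_iteratedFDeriv_fderiv]
  have e : fderiv ℝ g = fun x => ∑ i, pd3 i g x • (EuclideanSpace.proj i : E3 →L[ℝ] ℝ) :=
    funext (fderiv_eq_sum_pd3 g)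
  rw [e]
  have hs : ∀ i, ContDiff ℝ ∞ fun x => pd3 i g x • (EuclideanSpace.proj i : E3 →L[ℝ] ℝ) :=
    fun i => (contDiff_pd3 hg i).smul contDiff_const
  rw [iteratedFDeriv_sum (fun i _ => (hs i).of_le (by exact_mod_cast le_top)), Finset.sum_apply]
  refine (norm_sum_le _ _).trans (Finset.sum_le_sum fun i _ => ?_)
  have h := ContinuousLinearMap.norm_iteratedFDeriv_comp_left (x := x) (n := m)
    (ContinuousLinearMap.toSpanSingleton ℝ (EuclideanSpace.proj i : E3 →L[ℝ] ℝ))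
    (contDiff_pd3 hg i).contDiffAt (by exact_mod_cast le_top)
  have hL : ‖ContinuousLinearMap.toSpanSingleton ℝ (EuclideanSpace.proj i : E3 →L[ℝ] ℝ)‖ ≤ 1 := by
    rw [ContinuousLinearMap.norm_toSpanSingleton]
    refine ContinuousLinearMap.opNorm_le_bound _ zero_le_one fun v => ?_
    simpa using PiLp.norm_apply_le v i
  exact h.trans (mul_le_of_le_one_left (norm_nonneg _) hL)

lemma bounded_of_eventually {h : E3 → ℝ} (hc : Continuous h) {C : ℝ}
    (hC : ∀ᶠ x in cocompact E3, h x ≤ C) : ∃ D, ∀ x, h x ≤ D := by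
  obtain ⟨t, ht, hts⟩ := mem_cocompact.1 hC
  obtain ⟨D, hD⟩ := ht.exists_bound_of_continuousOn hc.continuousOn
  refine ⟨max C D, fun x => ?_⟩
  by_cases hx : x ∈ t
  · exact le_max_of_le_right ((le_abs_self _).trans (hD x hx))
  · exact le_max_of_le_left (hts hx)

lemma eventually_le_norm (R : ℝ) : ∀ᶠ x in cocompact E3, R ≤ ‖x‖ :=
  (tendsto_norm_cocompact_atTop).eventually (eventually_ge_atTop R)

lemma DecayBd.of_isBigO {g : E3 → ℝ} (hg : Continuous g) {s : ℕ} {t : ℝ} (hst : (s : ℝ) ≤ t)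
    (h : g =O[cocompact E3] fun x => ‖x‖ ^ (-t)) : DecayBd s g := by
  obtain ⟨C, hC⟩ := h.bound
  refine bounded_of_eventually (C := |C| * 2 ^ s) (hg.abs.mul (continuous_jb_zpow s)) ?_
  filter_upwards [hC, eventually_le_norm 1] with x hx h1
  have h0 : 0 < ‖x‖ := by linarith
  have e1 : jb x ^ (s : ℤ) ≤ 2 ^ s * ‖x‖ ^ s := by
    rw [zpow_natCast, ← mul_pow]
    exact pow_le_pow_left₀ (jb_pos x).le (jb_le_of_one_le h1) s
  have e2 : ‖x‖ ^ (-t) ≤ (‖x‖ ^ s)⁻¹ := by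
    rw [← Real.rpow_natCast, ← Real.rpow_neg h0.le]
    exact Real.rpow_le_rpow_of_exponent_le h1 (by linarith)
  have e3 : |g x| ≤ |C| * (‖x‖ ^ s)⁻¹ := by
    rw [Real.norm_eq_abs, Real.norm_of_nonneg (Real.rpow_nonneg h0.le _)] at hx
    exact hx.trans (mul_le_mul (le_abs_self C) e2 (by positivity) (abs_nonneg C))
  calc _ ≤ (|C| * (‖x‖ ^ s)⁻¹) * (2 ^ s * ‖x‖ ^ s) :=
        mul_le_mul e3 e1 (zpow_pos (jb_pos x) _).le (by positivity)
    _ = |C| * 2 ^ s := by field_simp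

lemma Tower.of_isBigO {g : E3 → ℝ} (hg : ContDiff ℝ ∞ g) {s : ℕ} {t : ℝ} (hst : (s : ℝ) ≤ t)
    (h : ∀ m : ℕ, (fun x => ‖iteratedFDeriv ℝ m g x‖) =O[cocompact E3] fun x => ‖x‖ ^ (-t - m))
    (n : ℕ) : Tower DecayBd n s g := by
  have hb : DecayBd s g := by
    refine DecayBd.of_isBigO hg.continuous hst ?_
    have := h 0
    simp only [norm_iteratedFDeriv_zero, Nat.cast_zero, sub_zero] at this
    exact this.of_norm_left
  induction n generalizing g s t with
  | zero => exact hb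
  | succ n ih =>
    refine ⟨hb, fun i => ?_⟩
    have h' : ∀ m : ℕ, (fun x => ‖iteratedFDeriv ℝ m (pd3 i g) x‖)
        =O[cocompact E3] fun x => ‖x‖ ^ (-(t + 1) - m) := by
      intro m
      have e := h (m + 1)
      rw [show -t - ((m + 1 : ℕ) : ℝ) = -(t + 1) - m by push_cast; ring] at e
      refine IsBigO.trans (.of_bound 1 (.of_forall fun x => ?_)) e
      simpa using norm_iteratedFDeriv_pd3_le hg m i x
    have hst' : ((s + 1 : ℕ) : ℝ) ≤ t + 1 := by push_cast; linarith
    refine ih (contDiff_pd3 hg i) (s := s + 1) hst' h' ?_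
    refine DecayBd.of_isBigO (contDiff_pd3 hg i).continuous hst' ?_
    have := h' 0
    simp only [norm_iteratedFDeriv_zero, Nat.cast_zero, sub_zero] at this
    exact this.of_norm_left

/-! ### Coefficients -/

lemma exists_pos_lower_bound {h : E3 → ℝ} (hc : Continuous h) (hpos : ∀ x, 0 < h x) {l : ℝ}
    (hl : 0 < l) (hlim : Tendsto h (cocompact E3) (nhds l)) : ∃ c > 0, ∀ x, c ≤ h x := by
  have hev : ∀ᶠ x in cocompact E3, (h x)⁻¹ ≤ (l / 2)⁻¹ := by
    filter_upwards [hlim.eventually (lt_mem_nhds (half_lt_self hl))] with x hx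
    exact inv_anti₀ (by positivity) hx.le
  obtain ⟨D, hD⟩ := bounded_of_eventually (hc.inv₀ fun x => (hpos x).ne') hev
  have hD0 : 0 < D := (inv_pos.2 (hpos 0)).trans_le (hD 0)
  exact ⟨D⁻¹, inv_pos.2 hD0, fun x => inv_le_of_inv_le₀ (hpos x) (hD x)⟩

/-- The structural assumptions on the divergence-form operator `∂_μ (a^{μν} ∂_ν ·) - q`. -/
structure Coeffs (a : Fin 3 → Fin 3 → E3 → ℝ) (q : E3 → ℝ) : Prop where
  symb_a : ∀ μ ν, Symb 0 (a μ ν)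
  symm : ∀ μ ν, a μ ν = a ν μ
  elliptic : ∃ c > 0, ∀ x (ξ : Fin 3 → ℝ), c * ∑ i, ξ i ^ 2 ≤ ∑ μ, ∑ ν, a μ ν x * ξ μ * ξ ν
  symb_q : Symb 3 q
  nonneg : ∀ x, 0 ≤ q x

open Matrix in
lemma posDef_elliptic {G : Matrix (Fin 3) (Fin 3) ℝ} (hG : G.PosDef) {M : ℝ}
    (hM : ∀ i j, |G i j| ≤ M) (ξ : Fin 3 → ℝ) :
    ∑ i, ξ i ^ 2 ≤ 3 * M * ∑ μ, ∑ ν, G⁻¹ μ ν * ξ μ * ξ ν := by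
  have hM0 : 0 < M := lt_of_lt_of_le (abs_pos.2 (hG.diag_pos (i := 0)).ne') (hM 0 0)
  have hsymm : Gᵀ = G := hG.1
  set ζ := G⁻¹ *ᵥ ξ with hζ
  have hGζ : G *ᵥ ζ = ξ := by
    rw [hζ, mulVec_mulVec, mul_nonsing_inv _ ((isUnit_iff_isUnit_det _).1 hG.isUnit), one_mulVec]
  have hξ : ∑ i, ξ i ^ 2 = ξ ⬝ᵥ ξ := by simp [dotProduct, sq]
  have hform : ∑ μ, ∑ ν, G⁻¹ μ ν * ξ μ * ξ ν = ζ ⬝ᵥ ξ := by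
    rw [dotProduct_comm, hζ]
    simp only [dotProduct, mulVec, Finset.mul_sum]
    exact Finset.sum_congr rfl fun i _ => Finset.sum_congr rfl fun j _ => by ring
  have hup : ξ ⬝ᵥ (G *ᵥ ξ) ≤ 3 * M * (ξ ⬝ᵥ ξ) := by
    have key : ∀ i j, ξ i * (G i j * ξ j) ≤ M * ((ξ i ^ 2 + ξ j ^ 2) / 2) := by
      intro i j
      have h1 : ξ i * (G i j * ξ j) ≤ |G i j| * |ξ i * ξ j| := by
        rw [← abs_mul]
        exact le_of_eq_of_le (by ring) (le_abs_self _)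
      have h2 : |ξ i * ξ j| ≤ (ξ i ^ 2 + ξ j ^ 2) / 2 := by
        rw [abs_mul]
        nlinarith [sq_abs (ξ i), sq_abs (ξ j), sq_nonneg (|ξ i| - |ξ j|)]
      exact h1.trans (mul_le_mul (hM i j) h2 (abs_nonneg _) hM0.le)
    rw [← hξ]
    simp only [dotProduct, mulVec, Fin.sum_univ_three]
    linarith [key 0 0, key 0 1, key 0 2, key 1 0, key 1 1, key 1 2, key 2 0, key 2 1, key 2 2]
  have hnn := hG.posSemidef.dotProduct_mulVec_nonneg (ξ - (3 * M) • ζ)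
  have hsw : ζ ⬝ᵥ (G *ᵥ ξ) = ξ ⬝ᵥ ξ := by
    rw [dotProduct_mulVec, ← mulVec_transpose, hsymm, hGζ]
  simp only [star_trivial, mulVec_sub, mulVec_smul, sub_dotProduct, dotProduct_sub, smul_dotProduct,
    dotProduct_smul, hGζ, smul_eq_mul, hsw] at hnn
  rw [hξ, hform]
  nlinarith

lemma coeffs_of_metric {γ : E3 → Matrix (Fin 3) (Fin 3) ℝ} {f : E3 → ℝ}
    (hγsmooth : ∀ μ ν, ContDiff ℝ ∞ fun x => γ x μ ν)
    (hγpos : ∀ x, (γ x).PosDef)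
    (hγdecay : ∀ μ ν, ∀ m : ℕ,
      (fun x => ‖iteratedFDeriv ℝ m (fun y => γ y μ ν - if μ = ν then 1 else 0) x‖)
        =o[cocompact E3] fun x => ‖x‖ ^ ((-1/2 : ℝ) - m))
    (hfsmooth : ContDiff ℝ ∞ f) (hfnonneg : ∀ x, 0 ≤ f x)
    (hfdecay : ∀ m : ℕ,
      (fun x => ‖iteratedFDeriv ℝ m f x‖) =o[cocompact E3] fun x => ‖x‖ ^ ((-3 : ℝ) - m)) :
    Coeffs (fun μ ν x => √(γ x).det * (γ x)⁻¹ μ ν) (fun x => √(γ x).det * f x) := by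
  have hf : Symb 3 f := ⟨hfsmooth, Tower.of_isBigO hfsmooth (s := 3) (t := 3) (by norm_num)
    fun m => (hfdecay m).isBigO⟩
  have hγ : ∀ μ ν, Symb 0 fun x => γ x μ ν := by
    intro μ ν
    have h1 : Symb 0 fun x => γ x μ ν - if μ = ν then 1 else 0 :=
      have hs : ContDiff ℝ ∞ fun x => γ x μ ν - if μ = ν then 1 else 0 :=
        (hγsmooth μ ν).sub contDiff_const
      ⟨hs, Tower.of_isBigO hs (s := 0) (t := 1 / 2) (by norm_num) fun m => by
        have := (hγdecay μ ν m).isBigO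
        simpa [neg_div] using this⟩
    simpa using h1.add (Symb.const (if μ = ν then 1 else 0))
  have hlim : ∀ μ ν, Tendsto (fun x => γ x μ ν) (cocompact E3)
      (nhds ((1 : Matrix (Fin 3) (Fin 3) ℝ) μ ν)) := by
    intro μ ν
    have h0 := hγdecay μ ν 0
    simp only [norm_iteratedFDeriv_zero, Nat.cast_zero, sub_zero] at h0
    have h1 : Tendsto (fun x : E3 => ‖x‖ ^ (-1 / 2 : ℝ)) (cocompact E3) (nhds 0) := by
      have := (tendsto_rpow_neg_atTop (y := 1 / 2) (by norm_num)).comp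
        (tendsto_norm_cocompact_atTop (E := E3))
      simpa [Function.comp_def, neg_div] using this
    have h2 := (h0.of_norm_left.trans_tendsto h1).add_const (if μ = ν then (1 : ℝ) else 0)
    simpa [Matrix.one_apply] using h2
  have hdetlim : Tendsto (fun x => (γ x).det) (cocompact E3) (nhds 1) := by
    have h1 : Tendsto γ (cocompact E3) (nhds 1) :=
      tendsto_pi_nhds.2 fun μ => tendsto_pi_nhds.2 fun ν => hlim μ ν
    have h2 := ((continuous_id.matrix_det (n := Fin 3) (R := ℝ)).tendsto 1).comp h1
    simpa [Function.comp_def] using h2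
  have hsub : ∀ {g h : E3 → ℝ}, Symb 0 g → Symb 0 h → Symb 0 fun x => g x - h x := by
    intro g h hg hh
    simpa [sub_eq_add_neg] using hg.add (hh.const_mul (-1))
  have hmul : ∀ {g h : E3 → ℝ}, Symb 0 g → Symb 0 h → Symb 0 fun x => g x * h x :=
    fun hg hh => by simpa using hg.mul hh
  have hdet : Symb 0 fun x => (γ x).det := by
    simp only [Matrix.det_fin_three]
    exact hsub (((hsub (hsub (hmul (hmul (hγ _ _) (hγ _ _)) (hγ _ _)) (hmul (hmul (hγ _ _) (hγ _ _))
      (hγ _ _))) (hmul (hmul (hγ _ _) (hγ _ _)) (hγ _ _))).add (hmul (hmul (hγ _ _) (hγ _ _))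
      (hγ _ _))).add (hmul (hmul (hγ _ _) (hγ _ _)) (hγ _ _)))
      (hmul (hmul (hγ _ _) (hγ _ _)) (hγ _ _))
  have hdetpos : ∀ x, 0 < (γ x).det := fun x => (hγpos x).det_pos
  obtain ⟨c, hc, hcd⟩ := exists_pos_lower_bound hdet.smooth.continuous hdetpos one_pos hdetlim
  have hsqrt := hdet.sqrt hc hcd
  have hdinv : Symb 0 fun x => ((γ x).det)⁻¹ := by simpa using hdet.inv hc (by simpa using hcd)
  have hadj : ∀ μ ν, Symb 0 fun x => (γ x).adjugate μ ν := by
    intro μ ν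
    have h : ∀ i j k l i' j' k' l', Symb 0 fun x => γ x i j * γ x k l - γ x i' j' * γ x k' l' :=
      fun i j k l i' j' k' l' => hsub (hmul (hγ _ _) (hγ _ _)) (hmul (hγ _ _) (hγ _ _))
    have h' : ∀ i j k l i' j' k' l',
        Symb 0 fun x => -(γ x i j * γ x k l) + γ x i' j' * γ x k' l' :=
      fun i j k l i' j' k' l' => by
        simpa [sub_eq_add_neg, add_comm] using h i' j' k' l' i j k l
    fin_cases μ <;> fin_cases ν <;> simp [Matrix.adjugate_fin_three] <;> first | apply h | apply h'
  have hinv : ∀ μ ν, Symb 0 fun x => (γ x)⁻¹ μ ν := by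
    intro μ ν
    have : (fun x => (γ x)⁻¹ μ ν) = fun x => ((γ x).det)⁻¹ * (γ x).adjugate μ ν := by
      funext x
      rw [Matrix.inv_def]
      simp
    rw [this]
    exact hmul hdinv (hadj μ ν)
  refine ⟨fun μ ν => hmul hsqrt (hinv μ ν), fun μ ν => ?_, ?_, ?_, fun x => ?_⟩
  · funext x
    have h1 : ((γ x)⁻¹).IsHermitian := (hγpos x).1.inv
    have := h1.apply μ ν
    simp only [star_trivial] at this
    rw [this]
  · choose B hB0 hB using fun μ ν => (hγ μ ν).bound
    set M := ∑ i, ∑ j, B i j with hMdef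
    have hM : ∀ x i j, |γ x i j| ≤ M := by
      intro x i j
      have h1 : |γ x i j| ≤ B i j := by simpa using hB i j x
      refine h1.trans ((Finset.single_le_sum (f := fun j => B i j) (fun j _ => hB0 i j)
        (Finset.mem_univ j)).trans ?_)
      exact Finset.single_le_sum (f := fun i => ∑ j, B i j)
        (fun i _ => Finset.sum_nonneg fun j _ => hB0 i j) (Finset.mem_univ i)
    have hM0 : 0 < M := lt_of_lt_of_le (abs_pos.2 ((hγpos 0).diag_pos (i := 0)).ne') (hM 0 0 0)
    refine ⟨√c / (3 * M), by positivity, fun x ξ => ?_⟩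
    have h1 := posDef_elliptic (hγpos x) (hM x) ξ
    have h2 : √c ≤ √(γ x).det := Real.sqrt_le_sqrt (hcd x)
    have h3 : ∑ μ, ∑ ν, √(γ x).det * (γ x)⁻¹ μ ν * ξ μ * ξ ν =
        √(γ x).det * ∑ μ, ∑ ν, (γ x)⁻¹ μ ν * ξ μ * ξ ν := by
      simp only [Finset.mul_sum, mul_assoc]
    rw [h3, div_mul_eq_mul_div, div_le_iff₀ (by positivity)]
    have h4 : 0 ≤ ∑ i, ξ i ^ 2 := by positivity
    calc _ ≤ √(γ x).det * ∑ i, ξ i ^ 2 := mul_le_mul_of_nonneg_right h2 h4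
      _ ≤ √(γ x).det * (3 * M * ∑ μ, ∑ ν, (γ x)⁻¹ μ ν * ξ μ * ξ ν) :=
        mul_le_mul_of_nonneg_left h1 (Real.sqrt_nonneg _)
      _ = _ := by ring
  · simpa using hsqrt.mul hf
  · exact mul_nonneg (Real.sqrt_nonneg _) (hfnonneg x)

/-! ### Symbols acting on Schwartz functions -/

open scoped SchwartzMap LineDeriv
open MeasureTheory

lemma jb_le_one_add_norm (x : E3) : jb x ≤ 1 + ‖x‖ := by
  have := jb_sq x
  nlinarith [jb_pos x, norm_nonneg x]

lemma Symb.hasTemperateGrowth {s : ℤ} {g : E3 → ℝ} (hg : Symb s g) : g.HasTemperateGrowth := by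
  refine ⟨hg.smooth, fun n => ?_⟩
  induction n generalizing s g with
  | zero =>
    obtain ⟨C, hC0, hC⟩ := hg.bound
    refine ⟨s.natAbs, C, fun x => ?_⟩
    rw [norm_iteratedFDeriv_zero, Real.norm_eq_abs]
    have h1 : |g x| = |g x| * jb x ^ s * jb x ^ (-s) := by
      rw [mul_assoc, ← zpow_add₀ (jb_pos x).ne']
      simp
    have h2 : jb x ^ (-s) ≤ (1 + ‖x‖) ^ s.natAbs := by
      calc jb x ^ (-s) ≤ jb x ^ (s.natAbs : ℤ) :=
            zpow_le_zpow_right₀ (one_le_jb x) (by omega)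
        _ = jb x ^ s.natAbs := zpow_natCast _ _
        _ ≤ _ := pow_le_pow_left₀ (jb_pos x).le (jb_le_one_add_norm x) _
    rw [h1]
    exact mul_le_mul (hC x) h2 (zpow_pos (jb_pos x) _).le hC0
  | succ n ih =>
    choose k C h using fun i => ih (hg.pd i)
    have hC : ∀ i, 0 ≤ C i := fun i => by
      have := h i 0
      simp only [norm_zero, add_zero, one_pow, mul_one] at this
      exact (norm_nonneg _).trans this
    refine ⟨∑ i, k i, ∑ i, C i, fun x => ?_⟩
    refine (norm_iteratedFDeriv_succ_le hg.smooth n x).trans ?_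
    rw [Finset.sum_mul]
    refine Finset.sum_le_sum fun i _ => (h i x).trans ?_
    refine mul_le_mul_of_nonneg_left (pow_le_pow_right₀ ?_ ?_) (hC i)
    · linarith [norm_nonneg x]
    · exact Finset.single_le_sum (fun j _ => Nat.zero_le (k j)) (Finset.mem_univ i)

/-- Real Schwartz functions on `E3`. -/
abbrev Sch := 𝓢(E3, ℝ)

/-- Partial derivative on Schwartz functions. -/
def sD (i : Fin 3) : Sch →L[ℝ] Sch :=
  LineDeriv.lineDerivOpCLM ℝ Sch (EuclideanSpace.single i (1 : ℝ))

/-- Multiplication by a function of temperate growth. -/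
def sM (b : E3 → ℝ) : Sch →L[ℝ] Sch := SchwartzMap.smulLeftCLM ℝ b

lemma sD_coe (i : Fin 3) (u : Sch) : ⇑(sD i u) = pd3 i u := rfl

lemma sM_coe {s : ℤ} {b : E3 → ℝ} (hb : Symb s b) (u : Sch) : ⇑(sM b u) = fun x => b x * u x :=
  SchwartzMap.smulLeftCLM_apply hb.hasTemperateGrowth u

lemma Sch.smooth (u : Sch) : ContDiff ℝ ∞ u := SchwartzMap.smooth u ⊤

lemma Sch.differentiableAt (u : Sch) (x : E3) : DifferentiableAt ℝ u x := u.differentiable x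

lemma sD_comm (i j : Fin 3) (u : Sch) : sD i (sD j u) = sD j (sD i u) := by
  apply DFunLike.coe_injective
  rw [sD_coe, sD_coe, sD_coe, sD_coe]
  exact pd3_comm (SchwartzMap.smooth u 2) i j

lemma sD_sM {s : ℤ} {b : E3 → ℝ} (hb : Symb s b) (i : Fin 3) (u : Sch) :
    sD i (sM b u) = sM (pd3 i b) u + sM b (sD i u) := by
  ext x
  rw [sD_coe, sM_coe hb, add_apply, sM_coe (hb.pd i), sM_coe hb, sD_coe]
  exact pd3_mul (smooth_differentiable hb.smooth x) (Sch.differentiableAt u x) i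

/-- The `L²` embedding of Schwartz functions. -/
def sJ : Sch →L[ℝ] Lp ℝ 2 (volume : Measure E3) := SchwartzMap.toLpCLM ℝ ℝ 2 volume

/-- `L²` norm of a Schwartz function. -/
def sN (u : Sch) : ℝ := ‖sJ u‖

/-- `L²` inner product of Schwartz functions. -/
def ip (u v : Sch) : ℝ := inner ℝ (sJ u) (sJ v)

lemma ip_eq (u v : Sch) : ip u v = ∫ x, u x * v x := by
  unfold ip
  rw [L2.inner_def]
  refine integral_congr_ae ?_
  filter_upwards [u.coeFn_toLp 2 volume, v.coeFn_toLp 2 volume] with x h1 h2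
  change inner ℝ ((u.toLp 2 volume : E3 → ℝ) x) ((v.toLp 2 volume : E3 → ℝ) x) = _
  rw [h1, h2]
  simp [mul_comm]

lemma ip_comm (u v : Sch) : ip u v = ip v u := real_inner_comm _ _
lemma ip_add_left (u v w : Sch) : ip (u + v) w = ip u w + ip v w := by simp [ip, inner_add_left]
lemma ip_add_right (u v w : Sch) : ip u (v + w) = ip u v + ip u w := by simp [ip, inner_add_right]
lemma ip_sub_left (u v w : Sch) : ip (u - v) w = ip u w - ip v w := by simp [ip, inner_sub_left]
lemma ip_sub_right (u v w : Sch) : ip u (v - w) = ip u v - ip u w := by simp [ip, inner_sub_right]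
lemma ip_smul_left (c : ℝ) (u v : Sch) : ip (c • u) v = c * ip u v := by
  simp [ip, real_inner_smul_left]
lemma ip_smul_right (c : ℝ) (u v : Sch) : ip u (c • v) = c * ip u v := by
  simp [ip, real_inner_smul_right]
lemma ip_sum_left {ι : Type*} (s : Finset ι) (u : ι → Sch) (v : Sch) :
    ip (∑ i ∈ s, u i) v = ∑ i ∈ s, ip (u i) v := by simp [ip, sum_inner]
lemma ip_sum_right {ι : Type*} (s : Finset ι) (u : Sch) (v : ι → Sch) :
    ip u (∑ i ∈ s, v i) = ∑ i ∈ s, ip u (v i) := by simp [ip, inner_sum]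
lemma ip_self (u : Sch) : ip u u = sN u ^ 2 := real_inner_self_eq_norm_sq _
lemma abs_ip_le (u v : Sch) : |ip u v| ≤ sN u * sN v := abs_real_inner_le_norm _ _
lemma sN_nonneg (u : Sch) : 0 ≤ sN u := norm_nonneg _
lemma sN_add_le (u v : Sch) : sN (u + v) ≤ sN u + sN v := by simpa [sN] using norm_add_le _ _
lemma sN_sub_le (u v : Sch) : sN (u - v) ≤ sN u + sN v := by simpa [sN] using norm_sub_le _ _
lemma sN_smul (c : ℝ) (u : Sch) : sN (c • u) = |c| * sN u := by simp [sN, norm_smul]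
lemma sN_sum_le {ι : Type*} (s : Finset ι) (u : ι → Sch) :
    sN (∑ i ∈ s, u i) ≤ ∑ i ∈ s, sN (u i) := by simpa [sN] using norm_sum_le _ _

lemma sN_sq (u : Sch) : sN u ^ 2 = ∫ x, u x ^ 2 := by
  rw [← ip_self, ip_eq]
  simp [sq]

lemma Sch.integrable_mul (u v : Sch) : Integrable fun x => u x * v x :=
  (u.memLp 2 volume).integrable_mul (v.memLp 2 volume)

lemma Sch.integrable_sq (u : Sch) : Integrable fun x => u x ^ 2 := by
  simpa [sq] using Sch.integrable_mul u u

lemma sN_le_of_le {u v : Sch} {C : ℝ} (hC : 0 ≤ C) (h : ∀ x, |u x| ≤ C * |v x|) :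
    sN u ≤ C * sN v := by
  refine le_of_sq_le_sq ?_ (mul_nonneg hC (sN_nonneg v))
  rw [mul_pow, sN_sq, sN_sq, ← integral_const_mul]
  refine integral_mono (Sch.integrable_sq u) ((Sch.integrable_sq v).const_mul _) fun x => ?_
  have := pow_le_pow_left₀ (abs_nonneg _) (h x) 2
  simpa [mul_pow] using this

lemma ip_sD (i : Fin 3) (u v : Sch) : ip u (sD i v) = -ip (sD i u) v := by
  rw [ip_eq, ip_eq]
  exact SchwartzMap.integral_mul_lineDerivOp_right_eq_neg_left u v _

lemma ip_sM {s : ℤ} {b : E3 → ℝ} (hb : Symb s b) (u v : Sch) : ip (sM b u) v = ip u (sM b v) := by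
  rw [ip_eq, ip_eq, sM_coe hb, sM_coe hb]
  congr 1
  funext x
  ring

lemma sN_sM_le {b : E3 → ℝ} (hb : Symb 0 b) : ∃ C, 0 ≤ C ∧ ∀ u, sN (sM b u) ≤ C * sN u := by
  obtain ⟨C, hC0, hC⟩ := hb.bound
  refine ⟨C, hC0, fun u => sN_le_of_le hC0 fun x => ?_⟩
  rw [sM_coe hb, abs_mul]
  exact mul_le_mul_of_nonneg_right (by simpa using hC x) (abs_nonneg _)

/-! ### The Hardy inequality -/

lemma pd3_jb_inv (i : Fin 3) (x : E3) : pd3 i (fun y => (jb y)⁻¹) x = -(x i * (jb x)⁻¹ ^ 3) := by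
  rw [pd3_inv (smooth_differentiable contDiff_jb x) (jb_pos x).ne', pd3_jb]
  ring

/-- The vector field `x / (1 + |x|²)`. -/
def hardyField (i : Fin 3) (x : E3) : ℝ := x i * ((jb x)⁻¹ * (jb x)⁻¹)

lemma symb_hardyField (i : Fin 3) : Symb 1 (hardyField i) := by
  have h := (Symb.coord i).mul (symb_jb_inv.mul symb_jb_inv)
  norm_num at h
  exact h

lemma abs_coord_le_jb (i : Fin 3) (x : E3) : |x i| ≤ jb x := by
  have : |x i| ≤ ‖x‖ := by simpa using PiLp.norm_apply_le x i
  exact this.trans (norm_le_jb x)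

lemma abs_hardyField_le (i : Fin 3) (x : E3) : |hardyField i x| ≤ (jb x)⁻¹ := by
  have h := jb_pos x
  have h2 : 0 < (jb x)⁻¹ * (jb x)⁻¹ := by positivity
  rw [hardyField, abs_mul, abs_of_pos h2, ← mul_assoc]
  refine mul_le_of_le_one_left (by positivity) ?_
  exact mul_inv_le_one_of_le₀ (abs_coord_le_jb i x) h.le

lemma div_hardyField (x : E3) : (jb x)⁻¹ ^ 2 ≤ ∑ i, pd3 i (hardyField i) x := by
  have hd := smooth_differentiable symb_jb_inv.smooth x
  have h : ∀ i, pd3 i (hardyField i) x = (jb x)⁻¹ ^ 2 - 2 * x i ^ 2 * (jb x)⁻¹ ^ 4 := by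
    intro i
    have e : hardyField i = fun x => x i * ((jb x)⁻¹ * (jb x)⁻¹) := rfl
    rw [e, pd3_mul (smooth_differentiable (Symb.coord i).smooth x) (hd.fun_mul hd), pd3_coord,
      pd3_mul hd hd, pd3_jb_inv]
    simp
    ring
  simp only [h]
  have h1 : ∑ i, x i ^ 2 = jb x ^ 2 - 1 := by
    rw [jb_sq, EuclideanSpace.norm_sq_eq]
    simp
  rw [Finset.sum_sub_distrib, ← Finset.sum_mul, ← Finset.mul_sum, h1]
  have h2 := jb_pos x
  simp only [Finset.sum_const, Finset.card_univ, Fintype.card_fin, nsmul_eq_mul]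
  have h3 : (jb x ^ 2 - 1) * (jb x)⁻¹ ^ 4 = (jb x)⁻¹ ^ 2 - (jb x)⁻¹ ^ 4 := by field_simp
  have h4 : 0 ≤ (jb x)⁻¹ ^ 4 := by positivity
  have h5 : 0 ≤ (jb x)⁻¹ ^ 2 := by positivity
  push_cast
  linarith

lemma hardy (u : Sch) : sN (sM (fun x => (jb x)⁻¹) u) ≤ 2 * ∑ i, sN (sD i u) := by
  set w := sM (fun x => (jb x)⁻¹) u with hw
  have hwc : ⇑w = fun x => (jb x)⁻¹ * u x := sM_coe symb_jb_inv u
  have h1 : ∀ i, ip (sM (pd3 i (hardyField i)) u) u = -(2 * ip (sM (hardyField i) u) (sD i u)) := by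
    intro i
    have e1 := ip_sD i u (sM (hardyField i) u)
    rw [sD_sM (symb_hardyField i), ip_add_right] at e1
    have e2 : ip (sM (hardyField i) u) (sD i u) = ip u (sM (hardyField i) (sD i u)) :=
      ip_sM (symb_hardyField i) u (sD i u)
    rw [ip_comm, e2]
    rw [ip_comm (sD i u), e2] at e1
    linarith
  have h2 : sN w ^ 2 ≤ ∑ i, ip (sM (pd3 i (hardyField i)) u) u := by
    have : ∀ i, ip (sM (pd3 i (hardyField i)) u) u = ∫ x, pd3 i (hardyField i) x * u x * u x := by
      intro i
      rw [ip_eq, sM_coe ((symb_hardyField i).pd i)]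
    simp only [this]
    rw [sN_sq, ← integral_finsetSum]
    · refine integral_mono (Sch.integrable_sq w) ?_ fun x => ?_
      · refine integrable_finsetSum _ fun i _ => ?_
        have := Sch.integrable_mul (sM (pd3 i (hardyField i)) u) u
        rwa [sM_coe ((symb_hardyField i).pd i)] at this
      · have h3 := mul_le_mul_of_nonneg_right (div_hardyField x) (sq_nonneg (u x))
        simp only [hwc, mul_pow]
        refine h3.trans (le_of_eq ?_)
        rw [Finset.sum_mul]
        exact Finset.sum_congr rfl fun i _ => by ring
    · intro i _
      have := Sch.integrable_mul (sM (pd3 i (hardyField i)) u) u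
      rwa [sM_coe ((symb_hardyField i).pd i)] at this
  have h3 : ∀ i, ip (sM (pd3 i (hardyField i)) u) u ≤ 2 * (sN w * sN (sD i u)) := by
    intro i
    rw [h1]
    have e1 := abs_ip_le (sM (hardyField i) u) (sD i u)
    have e2 : sN (sM (hardyField i) u) ≤ 1 * sN w := by
      refine sN_le_of_le zero_le_one fun x => ?_
      rw [sM_coe (symb_hardyField i), hwc, one_mul, abs_mul, abs_mul, abs_of_pos (inv_pos.2 (jb_pos x))]
      exact mul_le_mul_of_nonneg_right (abs_hardyField_le i x) (abs_nonneg _)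
    have e3 := mul_le_mul_of_nonneg_right e2 (sN_nonneg (sD i u))
    have e4 := neg_le_abs (ip (sM (hardyField i) u) (sD i u))
    linarith
  have h4 : sN w ^ 2 ≤ 2 * (sN w * ∑ i, sN (sD i u)) := by
    refine h2.trans ((Finset.sum_le_sum fun i _ => h3 i).trans (le_of_eq ?_))
    rw [Finset.mul_sum, Finset.mul_sum]
  rcases (sN_nonneg w).eq_or_lt with h0 | h0
  · rw [← h0]
    exact mul_nonneg two_pos.le (Finset.sum_nonneg fun i _ => sN_nonneg _)
  · nlinarith

lemma hardy_symb {b : E3 → ℝ} (hb : Symb 1 b) :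
    ∃ C, 0 ≤ C ∧ ∀ u, sN (sM b u) ≤ C * ∑ i, sN (sD i u) := by
  obtain ⟨C, hC0, hC⟩ := hb.bound
  refine ⟨C * 2, by positivity, fun u => ?_⟩
  have h : sN (sM b u) ≤ C * sN (sM (fun x => (jb x)⁻¹) u) := by
    refine sN_le_of_le hC0 fun x => ?_
    rw [sM_coe hb, sM_coe symb_jb_inv, abs_mul, abs_mul, ← mul_assoc,
      abs_of_pos (inv_pos.2 (jb_pos x))]
    refine mul_le_mul_of_nonneg_right ?_ (abs_nonneg _)
    have := hC x
    rw [zpow_one] at this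
    rw [← div_eq_mul_inv, le_div_iff₀ (jb_pos x)]
    exact this
  refine h.trans ?_
  rw [mul_assoc]
  exact mul_le_mul_of_nonneg_left (hardy u) hC0

/-! ### The operators `1 - η² Δ` -/

/-- The operator `1 - η² Δ` on Schwartz functions. -/
def sL (η : ℝ) : Sch →L[ℝ] Sch := ContinuousLinearMap.id ℝ Sch - η ^ 2 • ∑ i, (sD i).comp (sD i)

lemma sL_apply (η : ℝ) (u : Sch) : sL η u = u - η ^ 2 • ∑ i, sD i (sD i u) := by
  simp [sL]

/-- Powers of `1 - η² Δ`. -/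
def sLp (η : ℝ) (n : ℕ) : Sch →L[ℝ] Sch := (sL η) ^ n

lemma sLp_zero (η : ℝ) (u : Sch) : sLp η 0 u = u := by simp [sLp]

lemma sLp_succ (η : ℝ) (n : ℕ) (u : Sch) : sLp η (n + 1) u = sLp η n (sL η u) := by
  simp only [sLp, pow_succ]
  rfl

lemma sLp_add (η : ℝ) (m n : ℕ) (u : Sch) : sLp η (m + n) u = sLp η m (sLp η n u) := by
  simp only [sLp, pow_add]
  rfl

lemma sLp_succ' (η : ℝ) (n : ℕ) (u : Sch) : sLp η (n + 1) u = sL η (sLp η n u) := by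
  simp only [sLp, pow_succ']
  rfl

lemma sD_sL (η : ℝ) (i : Fin 3) (u : Sch) : sD i (sL η u) = sL η (sD i u) := by
  simp only [sL_apply, map_sub, map_smul, map_sum]
  congr 2
  exact Finset.sum_congr rfl fun j _ => by rw [sD_comm i j, sD_comm i j]

lemma sD_sLp (η : ℝ) (n : ℕ) (i : Fin 3) (u : Sch) : sD i (sLp η n u) = sLp η n (sD i u) := by
  induction n with
  | zero => simp [sLp_zero]
  | succ n ih => rw [sLp_succ', sLp_succ', sD_sL, ih]

lemma ip_sL (η : ℝ) (u v : Sch) : ip (sL η u) v = ip u (sL η v) := by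
  rw [sL_apply, sL_apply, ip_sub_left, ip_sub_right, ip_smul_left, ip_smul_right, ip_sum_left,
    ip_sum_right]
  congr 2
  refine Finset.sum_congr rfl fun i _ => ?_
  rw [ip_sD, ← neg_neg (ip (sD i (sD i u)) v), ← ip_sD]

lemma ip_sLp (η : ℝ) (n : ℕ) (u v : Sch) : ip (sLp η n u) v = ip u (sLp η n v) := by
  induction n generalizing u v with
  | zero => simp [sLp_zero]
  | succ n ih => rw [sLp_succ, sLp_succ', ih, ip_sL]

lemma sN_sL_sq (η : ℝ) (u : Sch) :
    sN u ^ 2 + 2 * η ^ 2 * ∑ i, sN (sD i u) ^ 2 ≤ sN (sL η u) ^ 2 := by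
  set L := ∑ i, sD i (sD i u) with hL
  have h1 : ip u L = -∑ i, sN (sD i u) ^ 2 := by
    rw [hL, ip_sum_right, ← Finset.sum_neg_distrib]
    exact Finset.sum_congr rfl fun i _ => by rw [ip_sD, ip_self]
  have h2 : sN (sL η u) ^ 2 = sN u ^ 2 - 2 * η ^ 2 * ip u L + η ^ 4 * sN L ^ 2 := by
    rw [← ip_self, ← ip_self, ← ip_self, sL_apply, ← hL]
    simp only [ip_sub_left, ip_sub_right, ip_smul_left, ip_smul_right]
    rw [ip_comm L u]
    ring
  rw [h2, h1]
  have : 0 ≤ η ^ 4 * sN L ^ 2 := by positivity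
  linarith

lemma sN_le_sL (η : ℝ) (u : Sch) : sN u ≤ sN (sL η u) := by
  refine le_of_sq_le_sq ?_ (sN_nonneg _)
  have := sN_sL_sq η u
  have h : 0 ≤ 2 * η ^ 2 * ∑ i, sN (sD i u) ^ 2 :=
    mul_nonneg (by positivity) (Finset.sum_nonneg fun i _ => sq_nonneg _)
  linarith

lemma sN_sD_le_sL (η : ℝ) (i : Fin 3) (u : Sch) : η * sN (sD i u) ≤ sN (sL η u) := by
  refine le_of_sq_le_sq ?_ (sN_nonneg _)
  have h1 := sN_sL_sq η u
  have h2 : sN (sD i u) ^ 2 ≤ ∑ i, sN (sD i u) ^ 2 :=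
    Finset.single_le_sum (f := fun i => sN (sD i u) ^ 2) (fun _ _ => by positivity) (Finset.mem_univ i)
  have h3 := mul_le_mul_of_nonneg_left h2 (sq_nonneg η)
  have h4 : 0 ≤ η ^ 2 * sN (sD i u) ^ 2 := by positivity
  rw [mul_pow]
  nlinarith [sq_nonneg (sN u)]

lemma sN_sLp_le_succ (η : ℝ) (n : ℕ) (u : Sch) : sN (sLp η n u) ≤ sN (sLp η (n + 1) u) := by
  rw [sLp_succ']
  exact sN_le_sL η _

lemma sN_sLp_mono (η : ℝ) {m n : ℕ} (hmn : m ≤ n) (u : Sch) : sN (sLp η m u) ≤ sN (sLp η n u) := by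
  induction n, hmn using Nat.le_induction with
  | base => exact le_rfl
  | succ n _ ih => exact ih.trans (sN_sLp_le_succ η n u)

lemma sN_sLp_sD_le (η : ℝ) (n : ℕ) (i : Fin 3) (u : Sch) :
    η * sN (sLp η n (sD i u)) ≤ sN (sLp η (n + 1) u) := by
  rw [← sD_sLp, sLp_succ']
  exact sN_sD_le_sL η i _

/-- The Laplacian as a sum of iterated partial derivatives. -/
def lap3 (b : E3 → ℝ) (x : E3) : ℝ := ∑ i, pd3 i (pd3 i b) x

lemma Symb.lap {s : ℤ} {b : E3 → ℝ} (hb : Symb s b) : Symb (s + 2) (lap3 b) := by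
  refine Symb.sum _ fun i _ => ?_
  have := (hb.pd i).pd i
  rwa [show s + 1 + 1 = s + 2 by ring] at this

lemma sM_sum {ι : Type*} {s : ℤ} (S : Finset ι) {b : ι → E3 → ℝ} (hb : ∀ j, Symb s (b j)) (u : Sch) :
    sM (fun x => ∑ j ∈ S, b j x) u = ∑ j ∈ S, sM (b j) u := by
  ext x
  rw [sM_coe (Symb.sum S fun j _ => hb j)]
  rw [show (∑ j ∈ S, sM (b j) u) x = ∑ j ∈ S, (sM (b j) u) x by simp]
  simp only [sM_coe (hb _), Finset.sum_mul]

lemma sL_sM {s : ℤ} {b : E3 → ℝ} (hb : Symb s b) (η : ℝ) (u : Sch) :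
    sL η (sM b u) = sM b (sL η u) - η ^ 2 • sM (lap3 b) u
      - ∑ i, (2 * η ^ 2) • sM (pd3 i b) (sD i u) := by
  have h : sM (lap3 b) u = ∑ i, sM (pd3 i (pd3 i b)) u :=
    sM_sum _ (s := s + 1 + 1) (fun i => (hb.pd i).pd i) u
  rw [h]
  simp only [sL_apply, map_sub, map_smul, map_sum, sD_sM hb, sD_sM (hb.pd _), map_add,
    Finset.sum_add_distrib, ← Finset.smul_sum]
  module

/-! ### Commutator estimates -/

lemma commutator_sLp (n : ℕ) : ∀ b : E3 → ℝ, Symb 0 b → ∃ C, 0 ≤ C ∧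
    ∀ η : ℝ, 0 < η → η ≤ 1 → ∀ w, sN (sLp η n (sM b w) - sM b (sLp η n w)) ≤ C * η * sN (sLp η n w) := by
  induction n with
  | zero =>
    intro b _
    refine ⟨0, le_rfl, fun η _ _ w => ?_⟩
    simp [sLp_zero, sN]
  | succ n ih =>
    have cor : ∀ b : E3 → ℝ, Symb 0 b → ∃ C, 0 ≤ C ∧
        ∀ η : ℝ, 0 < η → η ≤ 1 → ∀ w, sN (sLp η n (sM b w)) ≤ C * sN (sLp η n w) := by
      intro b hb
      obtain ⟨C, hC0, hC⟩ := ih b hb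
      obtain ⟨D, hD0, hD⟩ := sN_sM_le hb
      refine ⟨C + D, by positivity, fun η h0 h1 w => ?_⟩
      have e := sN_add_le (sLp η n (sM b w) - sM b (sLp η n w)) (sM b (sLp η n w))
      rw [sub_add_cancel] at e
      have e1 : C * η * sN (sLp η n w) ≤ C * 1 * sN (sLp η n w) := by
        gcongr
        exact sN_nonneg _
      linarith [hC η h0 h1 w, hD (sLp η n w)]
    intro b hb
    obtain ⟨C, hC0, hC⟩ := ih b hb
    obtain ⟨C₁, hC₁0, hC₁⟩ := cor (lap3 b) (hb.lap.weaken (by norm_num))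
    choose C₂ hC₂0 hC₂ using fun i => cor (pd3 i b) ((hb.pd i).weaken (by norm_num))
    have hC₂' : 0 ≤ ∑ i, 2 * C₂ i := Finset.sum_nonneg fun i _ => mul_nonneg two_pos.le (hC₂0 i)
    refine ⟨C + C₁ + ∑ i, 2 * C₂ i, by positivity, fun η h0 h1 w => ?_⟩
    have e : sLp η (n + 1) (sM b w) - sM b (sLp η (n + 1) w) =
        (sLp η n (sM b (sL η w)) - sM b (sLp η n (sL η w))) - η ^ 2 • sLp η n (sM (lap3 b) w)
          - ∑ i, (2 * η ^ 2) • sLp η n (sM (pd3 i b) (sD i w)) := by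
      rw [sLp_succ, sLp_succ, sL_sM hb]
      simp only [map_sub, map_smul, map_sum]
      abel
    rw [e]
    have t1 : _ ≤ C * η * sN (sLp η n (sL η w)) := hC η h0 h1 (sL η w)
    rw [← sLp_succ η n w] at t1
    set Nw := sN (sLp η (n + 1) w) with hNw
    have t2 : sN (η ^ 2 • sLp η n (sM (lap3 b) w)) ≤ C₁ * η * Nw := by
      rw [sN_smul, abs_of_pos (by positivity)]
      have a1 := hC₁ η h0 h1 w
      have a2 := sN_sLp_le_succ η n w
      have a3 : η ^ 2 ≤ η := by nlinarith
      calc _ ≤ η * (C₁ * Nw) := mul_le_mul a3 (a1.trans (mul_le_mul_of_nonneg_left a2 hC₁0))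
            (sN_nonneg _) h0.le
        _ = _ := by ring
    have t3 : sN (∑ i, (2 * η ^ 2) • sLp η n (sM (pd3 i b) (sD i w))) ≤ (∑ i, 2 * C₂ i) * η * Nw := by
      refine (sN_sum_le _ _).trans ?_
      rw [Finset.sum_mul, Finset.sum_mul]
      refine Finset.sum_le_sum fun i _ => ?_
      rw [sN_smul, abs_of_pos (by positivity)]
      have a1 := hC₂ i η h0 h1 (sD i w)
      have a2 := sN_sLp_sD_le η n i w
      calc _ ≤ 2 * η ^ 2 * (C₂ i * sN (sLp η n (sD i w))) := by gcongr
        _ = 2 * C₂ i * η * (η * sN (sLp η n (sD i w))) := by ring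
        _ ≤ _ := mul_le_mul_of_nonneg_left a2 (mul_nonneg (mul_nonneg two_pos.le (hC₂0 i)) h0.le)
    calc _ ≤ _ := sN_sub_le _ _
      _ ≤ _ := add_le_add_left (sN_sub_le _ _) _
      _ ≤ C * η * Nw + C₁ * η * Nw + (∑ i, 2 * C₂ i) * η * Nw := by
        rw [← sLp_succ η n w]
        linarith
      _ = _ := by ring

lemma sN_sLp_sM_le (n : ℕ) {b : E3 → ℝ} (hb : Symb 0 b) : ∃ C, 0 ≤ C ∧
    ∀ η : ℝ, 0 < η → η ≤ 1 → ∀ w, sN (sLp η n (sM b w)) ≤ C * sN (sLp η n w) := by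
  obtain ⟨C, hC0, hC⟩ := commutator_sLp n b hb
  obtain ⟨D, hD0, hD⟩ := sN_sM_le hb
  refine ⟨C + D, by positivity, fun η h0 h1 w => ?_⟩
  have e := sN_add_le (sLp η n (sM b w) - sM b (sLp η n w)) (sM b (sLp η n w))
  rw [sub_add_cancel] at e
  have e1 : C * η * sN (sLp η n w) ≤ C * 1 * sN (sLp η n w) := by
    gcongr
    exact sN_nonneg _
  linarith [hC η h0 h1 w, hD (sLp η n w)]

lemma hardy_sLp (n : ℕ) : ∀ b : E3 → ℝ, Symb 1 b → ∃ C, 0 ≤ C ∧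
    ∀ η : ℝ, 0 < η → η ≤ 1 → ∀ u, sN (sLp η n (sM b u)) ≤ C * ∑ i, sN (sLp η n (sD i u)) := by
  induction n with
  | zero =>
    intro b hb
    obtain ⟨C, hC0, hC⟩ := hardy_symb hb
    exact ⟨C, hC0, fun η _ _ u => by simpa only [sLp_zero] using hC u⟩
  | succ n ih =>
    intro b hb
    obtain ⟨C, hC0, hC⟩ := ih b hb
    obtain ⟨C₁, hC₁0, hC₁⟩ := ih (lap3 b) (hb.lap.weaken (by norm_num))
    choose C₂ hC₂0 hC₂ using fun i => sN_sLp_sM_le n ((hb.pd i).weaken (t := 0) (by norm_num))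
    obtain ⟨C₃, hC₃0, hC₃⟩ := sN_sLp_sM_le n (hb.weaken (t := 0) (by norm_num))
    have hC₂' : 0 ≤ ∑ i, 2 * C₂ i := Finset.sum_nonneg fun i _ => mul_nonneg two_pos.le (hC₂0 i)
    refine ⟨C + C₁ + ∑ i, 2 * C₂ i + C₃, by positivity, fun η h0 h1 u => ?_⟩
    have e : sLp η (n + 1) (sM b u) = sLp η n (sM b u) - η ^ 2 • sLp η n (sM (lap3 b) u)
          - ∑ i, (2 * η ^ 2) • sLp η n (sM (pd3 i b) (sD i u))
          - ∑ i, η ^ 2 • sLp η n (sM b (sD i (sD i u))) := by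
      rw [sLp_succ, sL_sM hb, sL_apply]
      simp only [map_sub, map_smul, map_sum, ← Finset.smul_sum]
      abel
    rw [e]
    set T := ∑ i, sN (sLp η (n + 1) (sD i u)) with hT
    have hη2 : η ^ 2 ≤ 1 := by nlinarith
    have hsum : ∑ i, sN (sLp η n (sD i u)) ≤ T :=
      Finset.sum_le_sum fun i _ => sN_sLp_le_succ η n (sD i u)
    have hsingle : ∀ i, sN (sLp η (n + 1) (sD i u)) ≤ T := fun i =>
      Finset.single_le_sum (f := fun i => sN (sLp η (n + 1) (sD i u))) (fun _ _ => sN_nonneg _)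
        (Finset.mem_univ i)
    have hT0 : 0 ≤ T := Finset.sum_nonneg fun _ _ => sN_nonneg _
    have t1 : sN (sLp η n (sM b u)) ≤ C * T :=
      (hC η h0 h1 u).trans (mul_le_mul_of_nonneg_left hsum hC0)
    have t2 : sN (η ^ 2 • sLp η n (sM (lap3 b) u)) ≤ C₁ * T := by
      rw [sN_smul, abs_of_pos (by positivity)]
      exact (mul_le_of_le_one_left (sN_nonneg _) hη2).trans
        ((hC₁ η h0 h1 u).trans (mul_le_mul_of_nonneg_left hsum hC₁0))
    have t3 : sN (∑ i, (2 * η ^ 2) • sLp η n (sM (pd3 i b) (sD i u))) ≤ (∑ i, 2 * C₂ i) * T := by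
      refine (sN_sum_le _ _).trans ?_
      rw [Finset.sum_mul]
      refine Finset.sum_le_sum fun i _ => ?_
      rw [sN_smul, abs_of_pos (by positivity), mul_assoc, mul_assoc]
      refine mul_le_mul_of_nonneg_left ?_ two_pos.le
      exact (mul_le_of_le_one_left (sN_nonneg _) hη2).trans ((hC₂ i η h0 h1 _).trans
        (mul_le_mul_of_nonneg_left ((sN_sLp_le_succ η n _).trans (hsingle i)) (hC₂0 i)))
    have t4 : sN (∑ i, η ^ 2 • sLp η n (sM b (sD i (sD i u)))) ≤ C₃ * T := by
      refine (sN_sum_le _ _).trans ?_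
      rw [hT, Finset.mul_sum]
      refine Finset.sum_le_sum fun i _ => ?_
      rw [sN_smul, abs_of_pos (by positivity)]
      have a1 := hC₃ η h0 h1 (sD i (sD i u))
      have a2 := sN_sLp_sD_le η n i (sD i u)
      calc _ ≤ η ^ 2 * (C₃ * sN (sLp η n (sD i (sD i u)))) := by gcongr
        _ = C₃ * (η * (η * sN (sLp η n (sD i (sD i u))))) := by ring
        _ ≤ C₃ * (1 * sN (sLp η (n + 1) (sD i u))) := by
          refine mul_le_mul_of_nonneg_left ?_ hC₃0
          exact mul_le_mul h1 a2 (mul_nonneg h0.le (sN_nonneg _)) zero_le_one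
        _ = _ := by ring
    calc _ ≤ _ := sN_sub_le _ _
      _ ≤ _ := add_le_add_left (sN_sub_le _ _) _
      _ ≤ _ := add_le_add_left (add_le_add_left (sN_sub_le _ _) _) _
      _ ≤ C * T + C₁ * T + (∑ i, 2 * C₂ i) * T + C₃ * T := by linarith
      _ = _ := by ring

/-! ### Fourier analysis: a sup bound and surjectivity of the regularising operator -/

open scoped FourierTransform

/-- Complexification of a real Schwartz function. -/
def cx (g : Sch) : 𝓢(E3, ℂ) := g.postcompCLM Complex.ofRealCLM

lemma cx_apply (g : Sch) (x : E3) : cx g x = (g x : ℂ) := rfl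

lemma lineDerivOp_cx (i : Fin 3) (g : Sch) :
    LineDeriv.lineDerivOp (EuclideanSpace.single i (1 : ℝ)) (cx g) = cx (sD i g) := by
  ext x
  rw [cx_apply, sD_coe, SchwartzMap.lineDerivOp_apply_eq_fderiv]
  have h := Complex.ofRealCLM.hasFDerivAt.comp x (Sch.differentiableAt g x).hasFDerivAt
  have h2 : fderiv ℝ (cx g) x = Complex.ofRealCLM.comp (fderiv ℝ g x) := h.fderiv
  rw [h2]
  rfl

lemma fourier_lineDerivOp_single (i : Fin 3) (g : 𝓢(E3, ℂ)) (ξ : E3) :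
    𝓕 (LineDeriv.lineDerivOp (EuclideanSpace.single i (1 : ℝ)) g) ξ =
      2 * π * Complex.I * (ξ i : ℂ) * 𝓕 g ξ := by
  rw [SchwartzMap.fourier_lineDerivOp_eq, smul_apply,
    SchwartzMap.smulLeftCLM_apply_apply (by fun_prop)]
  have h : inner ℝ ξ (EuclideanSpace.single i (1 : ℝ)) = ξ i := by
    rw [EuclideanSpace.inner_single_right]
    simp
  rw [h]
  simp [mul_assoc]

lemma norm_sq_fourier_sD (i : Fin 3) (g : Sch) (ξ : E3) :
    ‖𝓕 (cx (sD i g)) ξ‖ ^ 2 = 4 * π ^ 2 * (ξ i) ^ 2 * ‖𝓕 (cx g) ξ‖ ^ 2 := by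
  rw [← lineDerivOp_cx, fourier_lineDerivOp_single]
  simp only [norm_mul, Complex.norm_real, Complex.norm_I, Complex.norm_ofNat, Real.norm_eq_abs,
    mul_pow, sq_abs]
  ring

lemma integral_norm_sq_fourier_cx (g : Sch) : ∫ ξ, ‖𝓕 (cx g) ξ‖ ^ 2 = sN g ^ 2 := by
  rw [SchwartzMap.integral_norm_sq_fourier, sN_sq]
  simp [cx_apply]

lemma integrable_norm_sq_fourier_cx (g : Sch) : Integrable fun ξ => ‖𝓕 (cx g) ξ‖ ^ 2 :=
  (SchwartzMap.memLp (𝓕 (cx g)) 2).integrable_norm_pow (by norm_num)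

lemma abs_le_integral_norm_fourier (g : Sch) (x : E3) : |g x| ≤ ∫ ξ, ‖𝓕 (cx g) ξ‖ := by
  have h : cx g x = 𝓕⁻ (⇑(𝓕 (cx g) : 𝓢(E3, ℂ))) x := by
    rw [← SchwartzMap.fourierInv_coe, FourierTransform.fourierInv_fourier_eq]
  have h2 : |g x| = ‖cx g x‖ := by rw [cx_apply, Complex.norm_real, Real.norm_eq_abs]
  rw [h2, h, Real.fourierInv_eq]
  refine (norm_integral_le_integral_norm _).trans (le_of_eq ?_)
  simp

lemma integrable_fourier_weight :
    Integrable fun ξ : E3 => (‖ξ‖ ^ 2 * (1 + ‖ξ‖ ^ 2))⁻¹ := by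
  have h := (integrable_fun_norm_addHaar (volume : Measure E3)
    (f := fun r : ℝ => (r ^ 2 * (1 + r ^ 2))⁻¹))
  refine h.2 ?_
  refine (integrable_inv_one_add_sq.integrableOn (s := Set.Ioi 0)).congr_fun (fun r hr => ?_)
    measurableSet_Ioi
  have hr : (0 : ℝ) < r := hr
  simp only [finrank_euclideanSpace, Fintype.card_fin, smul_eq_mul]
  field_simp

/-- The sum of squared `L²` norms of first and second derivatives. -/
def sE (g : Sch) : ℝ := ∑ i, sN (sD i g) ^ 2 + ∑ i, ∑ j, sN (sD i (sD j g)) ^ 2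

lemma sE_nonneg (g : Sch) : 0 ≤ sE g := by unfold sE; positivity

lemma sq_le_sE : ∃ C > 0, ∀ (g : Sch) (x : E3), (g x) ^ 2 ≤ C * sE g := by
  set K := ∫ ξ : E3, (‖ξ‖ ^ 2 * (1 + ‖ξ‖ ^ 2))⁻¹ with hK
  have hK0 : 0 ≤ K := integral_nonneg fun ξ => by positivity
  refine ⟨K + 1, by linarith, fun g x => ?_⟩
  set Q : E3 → ℝ := fun ξ => ∑ i, ‖𝓕 (cx (sD i g)) ξ‖ ^ 2 +
    ∑ i, ∑ j, ‖𝓕 (cx (sD i (sD j g))) ξ‖ ^ 2 with hQ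
  have hQi1 : Integrable fun ξ => ∑ i, ‖𝓕 (cx (sD i g)) ξ‖ ^ 2 :=
    integrable_finsetSum _ fun i _ => integrable_norm_sq_fourier_cx _
  have hQi2 : Integrable fun ξ => ∑ i, ∑ j, ‖𝓕 (cx (sD i (sD j g))) ξ‖ ^ 2 :=
    integrable_finsetSum _ fun i _ => integrable_finsetSum _ fun j _ =>
      integrable_norm_sq_fourier_cx _
  have hQi : Integrable Q := hQi1.add hQi2
  have hQE : ∫ ξ, Q ξ = sE g := by
    rw [hQ, integral_add hQi1 hQi2, integral_finsetSum _ fun i _ =>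
      integrable_norm_sq_fourier_cx _, integral_finsetSum _ fun i _ =>
        integrable_finsetSum _ fun j _ => integrable_norm_sq_fourier_cx _]
    unfold sE
    congr 1
    · simp_rw [integral_norm_sq_fourier_cx]
    · refine Finset.sum_congr rfl fun i _ => ?_
      rw [integral_finsetSum _ fun j _ => integrable_norm_sq_fourier_cx _]
      simp_rw [integral_norm_sq_fourier_cx]
  have hWQ : ∀ ξ : E3, ‖ξ‖ ^ 2 * (1 + ‖ξ‖ ^ 2) * ‖𝓕 (cx g) ξ‖ ^ 2 ≤ Q ξ := fun ξ => by
    have hpi : 1 ≤ 4 * π ^ 2 := by nlinarith [pi_gt_three]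
    simp only [hQ, norm_sq_fourier_sD, EuclideanSpace.norm_sq_eq, Fin.sum_univ_three,
      Real.norm_eq_abs, sq_abs]
    set G := ‖𝓕 (cx g) ξ‖ ^ 2
    set p := 4 * π ^ 2
    have hG : 0 ≤ G := by positivity
    have hp2 : 1 ≤ p * p := by nlinarith
    set S := ξ 0 ^ 2 + ξ 1 ^ 2 + ξ 2 ^ 2 with hS
    have hS0 : 0 ≤ S := by positivity
    have e1 : S * G ≤ p * (S * G) := le_mul_of_one_le_left (by positivity) hpi
    have e2 : S * S * G ≤ p * p * (S * S * G) := le_mul_of_one_le_left (by positivity) hp2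
    calc S * (1 + S) * G = S * G + S * S * G := by ring
      _ ≤ p * (S * G) + p * p * (S * S * G) := add_le_add e1 e2
      _ = _ := by rw [hS]; ring
  have hmain : ∀ t : ℝ, 0 < t → 2 * t * |g x| ≤ t ^ 2 * (K + 1) + sE g := by
    intro t ht
    have h1 : ∫ ξ, ‖𝓕 (cx g) ξ‖ ≤
        ∫ ξ, ((t / 2) * (‖ξ‖ ^ 2 * (1 + ‖ξ‖ ^ 2))⁻¹ + (1 / (2 * t)) * Q ξ) := by
      refine integral_mono_ae (SchwartzMap.integrable _).norm
        ((integrable_fourier_weight.const_mul _).add (hQi.const_mul _)) ?_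
      have hne : ∀ᵐ ξ : E3, ξ ≠ 0 := by simp [ae_iff]
      filter_upwards [hne] with ξ hξ
      have hW : 0 < ‖ξ‖ ^ 2 * (1 + ‖ξ‖ ^ 2) := by
        have := norm_pos_iff.2 hξ
        positivity
      have h3 := hWQ ξ
      set W := ‖ξ‖ ^ 2 * (1 + ‖ξ‖ ^ 2)
      set G := ‖𝓕 (cx g) ξ‖
      have h4 : G ≤ t / 2 * W⁻¹ + 1 / (2 * t) * (W * G ^ 2) := by
        have : 0 ≤ (t - W * G) ^ 2 / (2 * t * W) := by positivity
        have e : (t - W * G) ^ 2 / (2 * t * W) = t / 2 * W⁻¹ + 1 / (2 * t) * (W * G ^ 2) - G := by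
          field_simp
          ring
        linarith
      refine h4.trans ?_
      gcongr
    rw [integral_add (integrable_fourier_weight.const_mul _) (hQi.const_mul _),
      integral_const_mul, integral_const_mul, hQE, ← hK] at h1
    have h5 := (abs_le_integral_norm_fourier g x).trans h1
    have h6 := mul_le_mul_of_nonneg_left h5 (by positivity : 0 ≤ 2 * t)
    have e : 2 * t * (t / 2 * K + 1 / (2 * t) * sE g) = t ^ 2 * K + sE g := by
      field_simp
    rw [e] at h6
    nlinarith
  rcases (abs_nonneg (g x)).eq_or_lt with h | h
  · have : g x = 0 := abs_eq_zero.1 h.symm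
    rw [this]
    have := mul_nonneg (by linarith : 0 ≤ K + 1) (sE_nonneg g)
    simpa using this
  · have h1 := hmain (|g x| / (K + 1)) (by positivity)
    have e1 : 2 * (|g x| / (K + 1)) * |g x| = 2 * (|g x| ^ 2 / (K + 1)) := by ring
    have e2 : (|g x| / (K + 1)) ^ 2 * (K + 1) = |g x| ^ 2 / (K + 1) := by field_simp
    rw [e1, e2, sq_abs] at h1
    have h2 : (g x) ^ 2 / (K + 1) ≤ sE g := by linarith
    rw [div_le_iff₀ (by linarith)] at h2
    linarith

lemma sL_surjective (η : ℝ) : Function.Surjective (sL η) := by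
  intro w
  set m : E3 → ℝ := fun ξ => (1 + ‖(2 * π * η) • ξ‖ ^ 2) ^ (-1 : ℝ) with hm
  have hmt : m.HasTemperateGrowth := by
    have h1 : (fun x : E3 => (1 + ‖x‖ ^ 2) ^ (-1 : ℝ)).HasTemperateGrowth :=
      Function.hasTemperateGrowth_one_add_norm_sq_rpow E3 (-1)
    exact h1.comp (g := fun x : E3 => (1 + ‖x‖ ^ 2) ^ (-1 : ℝ))
      (f := fun ξ => (2 * π * η) • ξ) (by fun_prop)
  set vc := SchwartzMap.fourierMultiplierCLM ℂ m (cx w) with hvc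
  have hF : ∀ ξ, 𝓕 vc ξ = m ξ • 𝓕 (cx w) ξ := fun ξ => by
    rw [hvc, SchwartzMap.fourierMultiplierCLM_apply, FourierTransform.fourier_fourierInv_eq,
      SchwartzMap.smulLeftCLM_apply_apply hmt]
  have hmul : vc - (η ^ 2 : ℝ) • ∑ i : Fin 3, LineDeriv.lineDerivOp (EuclideanSpace.single i (1 : ℝ))
      (LineDeriv.lineDerivOp (EuclideanSpace.single i (1 : ℝ)) vc) = cx w := by
    have hinj : Function.Injective (FourierTransform.fourierCLM ℝ 𝓢(E3, ℂ)) := fun a b hab => by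
      have h : 𝓕 a = 𝓕 b := hab
      rw [← FourierTransform.fourierInv_fourier_eq (F := 𝓢(E3, ℂ)) a, h,
        FourierTransform.fourierInv_fourier_eq]
    apply hinj
    rw [map_sub, map_smul, map_sum]
    ext ξ
    rw [sub_apply, smul_apply, sum_apply]
    simp only [FourierTransform.fourierCLM_apply, fourier_lineDerivOp_single, hF]
    have hpos : (0 : ℝ) < 1 + ‖(2 * π * η) • ξ‖ ^ 2 := by positivity
    have h1 : m ξ * (1 + (2 * π * η) ^ 2 * ‖ξ‖ ^ 2) = 1 := by
      have : ‖(2 * π * η) • ξ‖ ^ 2 = (2 * π * η) ^ 2 * ‖ξ‖ ^ 2 := by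
        rw [norm_smul, mul_pow, Real.norm_eq_abs, sq_abs]
      rw [← this, hm]
      simp only [Real.rpow_neg_one]
      exact inv_mul_cancel₀ hpos.ne'
    have h2 : (m ξ : ℂ) * (1 + (2 * π * η) ^ 2 * (‖ξ‖ ^ 2 : ℝ)) = 1 := by exact_mod_cast h1
    rw [EuclideanSpace.norm_sq_eq] at h2
    simp only [Fin.sum_univ_three, Real.norm_eq_abs, sq_abs, Complex.real_smul] at h2 ⊢
    push_cast at h2 ⊢
    linear_combination (𝓕 (cx w) ξ) * h2 + (- 4 * π ^ 2 * η ^ 2 * (ξ 0 ^ 2 + ξ 1 ^ 2 + ξ 2 ^ 2)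
      * m ξ * 𝓕 (cx w) ξ) * Complex.I_sq
  refine ⟨vc.postcompCLM Complex.reCLM, ?_⟩
  have hD : ∀ (i : Fin 3) (h : 𝓢(E3, ℂ)), sD i (h.postcompCLM Complex.reCLM) =
      (LineDeriv.lineDerivOp (EuclideanSpace.single i (1 : ℝ)) h).postcompCLM Complex.reCLM := by
    intro i h
    ext x
    rw [SchwartzMap.postcompCLM_apply, SchwartzMap.lineDerivOp_apply_eq_fderiv, sD_coe]
    have h1 := Complex.reCLM.hasFDerivAt.comp x (h.differentiableAt (x := x)).hasFDerivAt
    have h2 : fderiv ℝ (h.postcompCLM Complex.reCLM) x = Complex.reCLM.comp (fderiv ℝ h x) :=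
      h1.fderiv
    unfold pd3
    rw [h2]
    rfl
  rw [sL_apply]
  simp only [hD]
  ext x
  have h3 := congrArg (fun h : 𝓢(E3, ℂ) => Complex.re (h x)) hmul
  simp only [cx_apply, Complex.ofReal_re, sub_apply, smul_apply, sum_apply, Complex.sub_re,
    Complex.smul_re, Complex.re_sum] at h3
  rw [← h3]
  simp [SchwartzMap.postcompCLM_apply]

lemma sLp_surjective (η : ℝ) (n : ℕ) : Function.Surjective (sLp η n) := by
  induction n with
  | zero => exact fun w => ⟨w, sLp_zero η w⟩
  | succ n ih =>
    intro w
    obtain ⟨v, rfl⟩ := ih w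
    obtain ⟨u, rfl⟩ := sL_surjective η v
    exact ⟨u, sLp_succ η n u⟩

/-! ### Lax–Milgram for a bilinear form on a dense subspace -/

section LaxMilgram

variable {V H : Type*} [AddCommGroup V] [Module ℝ V] [NormedAddCommGroup H] [InnerProductSpace ℝ H]
  [CompleteSpace H]

lemma exists_riesz_of_denseRange {T : V →ₗ[ℝ] H} (hT : DenseRange T) (F : V →ₗ[ℝ] ℝ) {C : ℝ}
    (hF : ∀ v, |F v| ≤ C * ‖T v‖) : ∃ w : H, ∀ v, inner ℝ w (T v) = F v := by
  refine ⟨(InnerProductSpace.toDual ℝ H).symm (F.extendOfNorm T), fun v => ?_⟩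
  rw [InnerProductSpace.toDual_symm_apply]
  exact LinearMap.extendOfNorm_eq hT ⟨C, hF⟩ v

lemma exists_approx_of_denseRange {T : V →ₗ[ℝ] H} (hT : DenseRange T) (B : V →ₗ[ℝ] V →ₗ[ℝ] ℝ)
    {C c C' : ℝ} (hC : 0 ≤ C)
    (hB : ∀ u v, |B u v| ≤ C * ‖T u‖ * ‖T v‖) (hc : 0 < c)
    (hco : ∀ u, c * ‖T u‖ ^ 2 ≤ B u u) (F : V →ₗ[ℝ] ℝ) (hF : ∀ v, |F v| ≤ C' * ‖T v‖) :
    ∃ u : ℕ → V, CauchySeq (fun n => T (u n)) ∧ ∀ v, Tendsto (fun n => B (u n) v) atTop (nhds (F v)) := by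
  choose A₀ hA₀ using fun u => exists_riesz_of_denseRange hT (B u) (hB u)
  let A : V →ₗ[ℝ] H :=
    { toFun := A₀
      map_add' := fun u v => hT.eq_of_inner_left ℝ fun w => by
        simp only [inner_add_left, hA₀, map_add, LinearMap.add_apply]
      map_smul' := fun r u => hT.eq_of_inner_left ℝ fun w => by
        simp [inner_smul_left, hA₀] }
  have hA : ∀ u v, inner ℝ (A u) (T v) = B u v := hA₀
  obtain ⟨φ, hφ⟩ := exists_riesz_of_denseRange hT F hF
  have hdense : (LinearMap.range A).topologicalClosure = ⊤ := by
    rw [Submodule.topologicalClosure_eq_top_iff, Submodule.eq_bot_iff]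
    intro w hw
    have hw0 : ∀ u, inner ℝ (A u) w = 0 := fun u =>
      (Submodule.mem_orthogonal _ _).1 hw _ (LinearMap.mem_range_self A u)
    have hle : ∀ v, c * ‖T v‖ ≤ C * ‖T v - w‖ := by
      intro v
      have hAv : ‖A v‖ ≤ C * ‖T v‖ := by
        have hcl : ∀ z : H, |inner ℝ (A v) z| ≤ C * ‖T v‖ * ‖z‖ := by
          have hclosed : IsClosed {z : H | |inner ℝ (A v) z| ≤ C * ‖T v‖ * ‖z‖} :=
            isClosed_le (by fun_prop) (by fun_prop)
          intro z
          refine hT.induction_on (p := fun z => |inner ℝ (A v) z| ≤ C * ‖T v‖ * ‖z‖) z hclosed ?_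
          intro x
          rw [hA]
          exact hB v x
        have h1 := hcl (A v)
        rw [real_inner_self_eq_norm_sq, abs_of_nonneg (by positivity)] at h1
        rcases (norm_nonneg (A v)).eq_or_lt with h0 | h0
        · rw [← h0] at h1 ⊢
          positivity
        · nlinarith
      have h1 : inner ℝ (A v) (T v - w) = B v v := by rw [inner_sub_right, hA, hw0, sub_zero]
      have h2 : c * ‖T v‖ ^ 2 ≤ C * ‖T v‖ * ‖T v - w‖ :=
        (hco v).trans (h1 ▸ (real_inner_le_norm _ _).trans
          (mul_le_mul_of_nonneg_right hAv (norm_nonneg _)))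
      rcases (norm_nonneg (T v)).eq_or_lt with h3 | h3
      · rw [← h3, mul_zero]
        positivity
      · nlinarith
    have hclosed : IsClosed {z : H | c * ‖z‖ ≤ C * ‖z - w‖} :=
      isClosed_le (by fun_prop) (by fun_prop)
    have h1 : c * ‖w‖ ≤ C * ‖w - w‖ :=
      hT.induction_on (p := fun z => c * ‖z‖ ≤ C * ‖z - w‖) w hclosed hle
    rw [sub_self, norm_zero, mul_zero] at h1
    have : ‖w‖ ≤ 0 := by nlinarith [norm_nonneg w]
    exact norm_le_zero_iff.1 this
  have hmem : φ ∈ closure (LinearMap.range A : Set H) := by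
    rw [← Submodule.topologicalClosure_coe, hdense]
    trivial
  obtain ⟨z, hz, hzφ⟩ := mem_closure_iff_seq_limit.1 hmem
  choose u hu using hz
  have hAu : Tendsto (fun n => A (u n)) atTop (nhds φ) := by simpa only [hu] using hzφ
  refine ⟨u, ?_, fun v => ?_⟩
  · have hcs := hAu.cauchySeq
    rw [Metric.cauchySeq_iff] at hcs ⊢
    intro ε hε
    obtain ⟨N, hN⟩ := hcs (c * ε) (by positivity)
    refine ⟨N, fun m hm n hn => ?_⟩
    have h1 := hN m hm n hn
    rw [dist_eq_norm, ← map_sub] at h1 ⊢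
    set d := u m - u n
    have h2 : c * ‖T d‖ ^ 2 ≤ ‖A d‖ * ‖T d‖ :=
      (hco d).trans (hA d d ▸ real_inner_le_norm _ _)
    rcases (norm_nonneg (T d)).eq_or_lt with h3 | h3
    · rwa [← h3]
    · have h4 : c * ‖T d‖ ≤ ‖A d‖ := by nlinarith
      exact lt_of_mul_lt_mul_left (h4.trans_lt h1) hc.le
  · rw [← hφ]
    simp only [← hA]
    exact hAu.inner tendsto_const_nhds

/-- A coercive variational problem on a space with a Hilbertian seminorm `‖T ·‖` admits an
approximating sequence which is Cauchy for the seminorm. -/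
theorem exists_approx_of_coercive (T : V →ₗ[ℝ] H) (B : V →ₗ[ℝ] V →ₗ[ℝ] ℝ)
    {C c C' : ℝ} (hC : 0 ≤ C)
    (hB : ∀ u v, |B u v| ≤ C * ‖T u‖ * ‖T v‖) (hc : 0 < c)
    (hco : ∀ u, c * ‖T u‖ ^ 2 ≤ B u u) (F : V →ₗ[ℝ] ℝ) (hF : ∀ v, |F v| ≤ C' * ‖T v‖) :
    ∃ u : ℕ → V, CauchySeq (fun n => T (u n)) ∧ ∀ v, Tendsto (fun n => B (u n) v) atTop (nhds (F v)) := by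
  let W := (LinearMap.range T).topologicalClosure
  let T' : V →ₗ[ℝ] W := T.codRestrict W fun v =>
    Submodule.le_topologicalClosure _ (LinearMap.mem_range_self T v)
  have hT' : DenseRange T' := by
    intro ⟨w, hw⟩
    rw [closure_subtype]
    have h2 : w ∈ closure (LinearMap.range T : Set H) := hw
    refine closure_mono ?_ h2
    rintro _ ⟨v, rfl⟩
    exact ⟨T' v, ⟨v, rfl⟩, rfl⟩
  have : CompleteSpace W := (Submodule.isClosed_topologicalClosure _).completeSpace_coe
  have hn : ∀ v, ‖T' v‖ = ‖T v‖ := fun v => rfl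
  obtain ⟨u, hu, hu'⟩ := exists_approx_of_denseRange hT' B (C := C) (c := c) (C' := C') hC
    (by simpa only [hn] using hB) hc (by simpa only [hn] using hco) F (by simpa only [hn] using hF)
  exact ⟨u, hu.map (uniformContinuous_subtype_val), hu'⟩

end LaxMilgram

/-! ### The regularised variational problem -/

/-- The operator `-∂_μ (a^{μν} ∂_ν u) + q u` on Schwartz functions. -/
def sA (a : Fin 3 → Fin 3 → E3 → ℝ) (q : E3 → ℝ) : Sch →L[ℝ] Sch :=
  sM q - ∑ μ, ∑ ν, (sD μ).comp ((sM (a μ ν)).comp (sD ν))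

lemma sA_apply (a : Fin 3 → Fin 3 → E3 → ℝ) (q : E3 → ℝ) (u : Sch) :
    sA a q u = sM q u - ∑ μ, ∑ ν, sD μ (sM (a μ ν) (sD ν u)) := by
  simp [sA]

/-- The seminorm `∑ᵢ ‖Λ^m ∂ᵢ u‖`. -/
def sX (η : ℝ) (m : ℕ) (u : Sch) : ℝ := ∑ i, sN (sLp η m (sD i u))

lemma sX_nonneg (η : ℝ) (m : ℕ) (u : Sch) : 0 ≤ sX η m u :=
  Finset.sum_nonneg fun _ _ => sN_nonneg _

lemma sN_le_sX (η : ℝ) (m : ℕ) (u : Sch) (i : Fin 3) : sN (sLp η m (sD i u)) ≤ sX η m u :=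
  Finset.single_le_sum (f := fun i => sN (sLp η m (sD i u))) (fun _ _ => sN_nonneg _)
    (Finset.mem_univ i)

lemma sX_zero_le (η : ℝ) (m : ℕ) (u : Sch) : ∑ i, sN (sD i u) ≤ sX η m u := by
  refine Finset.sum_le_sum fun i _ => ?_
  have := sN_sLp_mono η (Nat.zero_le m) (sD i u)
  rwa [sLp_zero] at this

lemma ip_symb_le {q : E3 → ℝ} (hq : Symb 3 q) (m l : ℕ) (hl : l ≤ 2 * m) :
    ∃ C, 0 ≤ C ∧ ∀ η : ℝ, 0 < η → η ≤ 1 → ∀ u v,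
      |ip (sM q u) (sLp η l v) - ip (sM q u) v| ≤ C * η * (sX η m u * sX η m v) := by
  induction l with
  | zero => exact ⟨0, le_rfl, fun η _ _ u v => by simp [sLp_zero]⟩
  | succ l ih =>
    obtain ⟨C, hC0, hC⟩ := ih (by omega)
    choose D hD0 hD using fun i => hardy_sLp m (pd3 i q) ((hq.pd i).weaken (by norm_num))
    obtain ⟨K, hK0, hK⟩ := sN_sLp_sM_le m (hq.weaken (show (0 : ℤ) ≤ 3 by norm_num))
    refine ⟨C + ∑ i, (D i + K), add_nonneg hC0 (Finset.sum_nonneg fun i _ => add_nonneg (hD0 i) hK0),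
      fun η h0 h1 u v => ?_⟩
    have key : ∀ i, |ip (sM q u) (sD i (sD i (sLp η l v)))| ≤ (D i + K) * (sX η m u * sX η m v) := by
      intro i
      obtain ⟨l1, l2, hl1, hl2, rfl⟩ : ∃ l1 l2, l1 ≤ m ∧ l2 ≤ m ∧ l = l1 + l2 :=
        ⟨min l m, l - min l m, by omega, by omega, by omega⟩
      rw [ip_sD, sD_sLp, sLp_add, ← ip_sLp, abs_neg]
      refine (abs_ip_le _ _).trans ?_
      have e1 : sN (sLp η l2 (sD i v)) ≤ sX η m v := (sN_sLp_mono η hl2 _).trans (sN_le_sX η m v i)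
      have e2 : sN (sLp η l1 (sD i (sM q u))) ≤ (D i + K) * sX η m u := by
        refine (sN_sLp_mono η hl1 _).trans ?_
        rw [sD_sM hq, map_add]
        refine (sN_add_le _ _).trans ?_
        rw [add_mul]
        refine add_le_add (hD i η h0 h1 u) ((hK η h0 h1 _).trans ?_)
        exact mul_le_mul_of_nonneg_left (sN_le_sX η m u i) hK0
      calc _ ≤ (D i + K) * sX η m u * sX η m v :=
            mul_le_mul e2 e1 (sN_nonneg _) (mul_nonneg (add_nonneg (hD0 i) hK0) (sX_nonneg _ _ _))
        _ = _ := by ring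
    have e : ip (sM q u) (sLp η (l + 1) v) - ip (sM q u) v =
        (ip (sM q u) (sLp η l v) - ip (sM q u) v) -
          η ^ 2 * ∑ i, ip (sM q u) (sD i (sD i (sLp η l v))) := by
      rw [sLp_succ', sL_apply, ip_sub_right, ip_smul_right, ip_sum_right]
      ring
    rw [e]
    have hX : 0 ≤ sX η m u * sX η m v := mul_nonneg (sX_nonneg _ _ _) (sX_nonneg _ _ _)
    have h2 : |η ^ 2 * ∑ i, ip (sM q u) (sD i (sD i (sLp η l v)))| ≤
        η * ((∑ i, (D i + K)) * (sX η m u * sX η m v)) := by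
      rw [abs_mul, abs_of_nonneg (by positivity)]
      have h3 : |∑ i, ip (sM q u) (sD i (sD i (sLp η l v)))| ≤
          (∑ i, (D i + K)) * (sX η m u * sX η m v) := by
        refine (Finset.abs_sum_le_sum_abs _ _).trans ?_
        rw [Finset.sum_mul]
        exact Finset.sum_le_sum fun i _ => key i
      exact mul_le_mul (by nlinarith) h3 (abs_nonneg _) h0.le
    refine (abs_sub _ _).trans ((add_le_add (hC η h0 h1 u v) h2).trans (le_of_eq ?_))
    ring

lemma abs_ip_symb_le {q : E3 → ℝ} (hq : Symb 3 q) : ∃ C, 0 ≤ C ∧ ∀ u v,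
    |ip (sM q u) v| ≤ C * ((∑ i, sN (sD i u)) * ∑ i, sN (sD i v)) := by
  have hb : Symb 1 (fun x => q x * jb x) := (hq.mul symb_jb).weaken (by norm_num)
  obtain ⟨C, hC0, hC⟩ := hardy_symb hb
  refine ⟨C * 2, by positivity, fun u v => ?_⟩
  have e : ip (sM q u) v = ip (sM (fun x => q x * jb x) u) (sM (fun x => (jb x)⁻¹) v) := by
    rw [ip_eq, ip_eq, sM_coe hq, sM_coe hb, sM_coe symb_jb_inv]
    refine integral_congr_ae (Eventually.of_forall fun x => ?_)
    have := (jb_pos x).ne'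
    simp only
    field_simp
  rw [e]
  refine (abs_ip_le _ _).trans ((mul_le_mul (hC u) (hardy v) (sN_nonneg _) ?_).trans (le_of_eq ?_))
  · exact mul_nonneg hC0 (Finset.sum_nonneg fun _ _ => sN_nonneg _)
  · ring

lemma ip_symb_nonneg {q : E3 → ℝ} {s : ℤ} (hq : Symb s q) (h0 : ∀ x, 0 ≤ q x) (u : Sch) :
    0 ≤ ip (sM q u) u := by
  rw [ip_eq, sM_coe hq]
  refine integral_nonneg fun x => ?_
  simp only
  rw [mul_assoc]
  exact mul_nonneg (h0 x) (mul_self_nonneg _)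

lemma integrable_symb_mul {s : ℤ} {p : E3 → ℝ} (hp : Symb s p) (w : Sch) :
    Integrable fun x => p x * w x := by
  rw [← sM_coe hp]
  exact SchwartzMap.integrable _

lemma integral_symb_mul_sD {s : ℤ} {p : E3 → ℝ} (hp : Symb s p) (i : Fin 3) (w : Sch) :
    ∫ x, p x * sD i w x = -∫ x, pd3 i p x * w x := by
  refine integral_mul_fderiv_eq_neg_fderiv_mul_of_integrable (integrable_symb_mul (hp.pd i) w)
    (integrable_symb_mul hp (sD i w)) (integrable_symb_mul hp w)
    (fun x _ => smooth_differentiable hp.smooth x) (fun x _ => Sch.differentiableAt w x)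

lemma integral_symb_mul_sL {s : ℤ} {p : E3 → ℝ} (hp : Symb s p) (η : ℝ) :
    ∃ p', Symb s p' ∧ ∀ w : Sch, ∫ x, p x * sL η w x = ∫ x, p' x * w x := by
  refine ⟨fun x => p x + -(η ^ 2) * ∑ i, pd3 i (pd3 i p) x,
    hp.add ((Symb.sum _ fun i _ => ((hp.pd i).pd i).weaken (by omega)).const_mul _), fun w => ?_⟩
  have h1 : ∀ x, p x * sL η w x = p x * w x - η ^ 2 * ∑ i, p x * sD i (sD i w) x := by
    intro x
    rw [sL_apply]
    simp only [sub_apply, smul_apply, sum_apply, smul_eq_mul, Finset.mul_sum, mul_sub]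
    congr 1
    exact Finset.sum_congr rfl fun i _ => by ring
  have h2 : ∀ x, (p x + -(η ^ 2) * ∑ i, pd3 i (pd3 i p) x) * w x =
      p x * w x - η ^ 2 * ∑ i, pd3 i (pd3 i p) x * w x := by
    intro x
    rw [← Finset.sum_mul]
    ring
  simp only [h1, h2]
  have i1 : ∀ i : Fin 3, Integrable fun x => p x * sD i (sD i w) x := fun i =>
    integrable_symb_mul hp _
  have i2 : ∀ i : Fin 3, Integrable fun x => pd3 i (pd3 i p) x * w x := fun i =>
    integrable_symb_mul ((hp.pd i).pd i) _
  rw [integral_sub (integrable_symb_mul hp w) ((integrable_finsetSum _ fun i _ => i1 i).const_mul _),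
    integral_sub (integrable_symb_mul hp w) ((integrable_finsetSum _ fun i _ => i2 i).const_mul _),
    integral_const_mul, integral_const_mul, integral_finsetSum _ fun i _ => i1 i,
    integral_finsetSum _ fun i _ => i2 i]
  congr 2
  refine Finset.sum_congr rfl fun i _ => ?_
  rw [integral_symb_mul_sD hp, integral_symb_mul_sD (hp.pd i), neg_neg]

lemma integral_symb_mul_sLp {s : ℤ} (n : ℕ) (η : ℝ) : ∀ {p : E3 → ℝ}, Symb s p →
    ∃ p', Symb s p' ∧ ∀ w : Sch, ∫ x, p x * sLp η n w x = ∫ x, p' x * w x := by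
  induction n with
  | zero => exact fun {p} hp => ⟨p, hp, fun w => by simp [sLp_zero]⟩
  | succ n ih =>
    intro p hp
    obtain ⟨p₁, hp₁, h₁⟩ := ih hp
    obtain ⟨p₂, hp₂, h₂⟩ := integral_symb_mul_sL hp₁ η
    exact ⟨p₂, hp₂, fun w => by rw [sLp_succ, h₁, h₂]⟩

lemma memLp_symb_two {p : E3 → ℝ} (hp : Symb 2 p) : MemLp p 2 (volume : Measure E3) := by
  obtain ⟨C, hC0, hC⟩ := hp.bound
  have h4 : Integrable (fun x : E3 => C ^ 2 * (1 + ‖x‖ ^ 2) ^ (-(4 : ℝ) / 2)) :=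
    (integrable_rpow_neg_one_add_norm_sq (by simp; norm_num)).const_mul _
  rw [memLp_two_iff_integrable_sq hp.smooth.continuous.aestronglyMeasurable]
  refine h4.mono' (hp.smooth.continuous.pow 2).aestronglyMeasurable (Eventually.of_forall fun x => ?_)
  have e : (1 + ‖x‖ ^ 2) ^ (-(4 : ℝ) / 2) = ((jb x) ^ 4)⁻¹ := by
    have : (1 + ‖x‖ ^ 2) = jb x ^ 2 := (jb_sq x).symm
    rw [this, ← Real.rpow_natCast, ← Real.rpow_mul (jb_pos x).le, ← Real.rpow_natCast,
      ← Real.rpow_neg (jb_pos x).le]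
    norm_num
  have hj := jb_pos x
  rw [e, Real.norm_eq_abs, abs_pow, sq_abs, ← div_eq_mul_inv, le_div_iff₀ (by positivity)]
  have h := hC x
  have h' : |p x| * jb x ^ 2 ≤ C := by exact_mod_cast h
  calc p x ^ 2 * jb x ^ 4 = (|p x| * jb x ^ 2) ^ 2 := by rw [mul_pow, sq_abs]; ring
    _ ≤ C ^ 2 := pow_le_pow_left₀ (by positivity) h' 2

lemma abs_integral_symb_mul_le {p : E3 → ℝ} (hp : Symb 3 p) : ∃ C, 0 ≤ C ∧ ∀ w : Sch,
    |∫ x, p x * w x| ≤ C * ∑ i, sN (sD i w) := by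
  have hb : MemLp (fun x => p x * jb x) 2 (volume : Measure E3) := memLp_symb_two (hp.mul symb_jb)
  refine ⟨‖hb.toLp‖ * 2, by positivity, fun w => ?_⟩
  have e : ∫ x, p x * w x = inner ℝ hb.toLp (sJ (sM (fun x => (jb x)⁻¹) w)) := by
    rw [L2.inner_def]
    refine integral_congr_ae ?_
    filter_upwards [hb.coeFn_toLp, SchwartzMap.coeFn_toLp (sM (fun x => (jb x)⁻¹) w) 2 volume]
      with x h1 h2
    have h3 : (sJ (sM (fun x => (jb x)⁻¹) w)) x = (jb x)⁻¹ * w x := by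
      rw [show (sJ (sM (fun x => (jb x)⁻¹) w)) x = _ from h2, sM_coe symb_jb_inv]
    rw [h1, h3]
    have := (jb_pos x).ne'
    simp
    field_simp
  rw [e]
  refine (abs_real_inner_le_norm _ _).trans ?_
  rw [mul_assoc]
  exact mul_le_mul_of_nonneg_left (hardy w) (norm_nonneg _)

/-! ### Solving the regularised problem -/

lemma ip_sA_sLp {a : Fin 3 → Fin 3 → E3 → ℝ} {q : E3 → ℝ} (η : ℝ) (m : ℕ) (u v : Sch) :
    ip (sA a q u) (sLp η (2 * m) v) =
      ∑ μ, ∑ ν, ip (sLp η m (sM (a μ ν) (sD ν u))) (sLp η m (sD μ v)) +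
        ip (sM q u) (sLp η (2 * m) v) := by
  rw [sA_apply, ip_sub_left, ip_sum_left]
  simp only [ip_sum_left]
  have h : ∀ μ ν, ip (sD μ (sM (a μ ν) (sD ν u))) (sLp η (2 * m) v) =
      -ip (sLp η m (sM (a μ ν) (sD ν u))) (sLp η m (sD μ v)) := fun μ ν => by
    rw [ip_sLp, ← sLp_add, ← two_mul, ← sD_sLp, ip_sD, neg_neg]
  simp only [h, Finset.sum_neg_distrib]
  ring

lemma ip_sA_symm {a : Fin 3 → Fin 3 → E3 → ℝ} {q : E3 → ℝ} (h : Coeffs a q) (u v : Sch) :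
    ip (sA a q u) v = ip u (sA a q v) := by
  simp only [sA_apply, ip_sub_left, ip_sub_right, ip_sum_left, ip_sum_right]
  rw [ip_sM h.symb_q, Finset.sum_comm]
  congr 1
  refine Finset.sum_congr rfl fun ν _ => Finset.sum_congr rfl fun μ _ => ?_
  rw [ip_sD, ← neg_eq_iff_eq_neg.2 (ip_sD μ (sM (a μ ν) (sD ν u)) v), ip_sM (h.symb_a μ ν),
    h.symm μ ν]

lemma sA_bounded {a : Fin 3 → Fin 3 → E3 → ℝ} {q : E3 → ℝ} (h : Coeffs a q) (m : ℕ) :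
    ∃ C, 0 ≤ C ∧ ∀ η : ℝ, 0 < η → η ≤ 1 → ∀ u v,
      |ip (sA a q u) (sLp η (2 * m) v)| ≤ C * (sX η m u * sX η m v) := by
  choose K hK0 hK using fun μ ν => sN_sLp_sM_le m (h.symb_a μ ν)
  obtain ⟨C₁, hC₁0, hC₁⟩ := ip_symb_le h.symb_q m (2 * m) le_rfl
  obtain ⟨C₂, hC₂0, hC₂⟩ := abs_ip_symb_le h.symb_q
  refine ⟨∑ μ, ∑ ν, K μ ν + (C₁ + C₂), add_nonneg (Finset.sum_nonneg fun μ _ =>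
    Finset.sum_nonneg fun ν _ => hK0 μ ν) (by positivity), fun η h0 h1 u v => ?_⟩
  have hX : 0 ≤ sX η m u * sX η m v := mul_nonneg (sX_nonneg _ _ _) (sX_nonneg _ _ _)
  rw [ip_sA_sLp, add_mul]
  refine (abs_add_le _ _).trans (add_le_add ?_ ?_)
  · rw [Finset.sum_mul]
    refine (Finset.abs_sum_le_sum_abs _ _).trans (Finset.sum_le_sum fun μ _ => ?_)
    rw [Finset.sum_mul]
    refine (Finset.abs_sum_le_sum_abs _ _).trans (Finset.sum_le_sum fun ν _ => ?_)
    refine (abs_ip_le _ _).trans ?_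
    have e1 := (hK μ ν η h0 h1 (sD ν u)).trans
      (mul_le_mul_of_nonneg_left (sN_le_sX η m u ν) (hK0 μ ν))
    refine (mul_le_mul e1 (sN_le_sX η m v μ) (sN_nonneg _)
      (mul_nonneg (hK0 μ ν) (sX_nonneg _ _ _))).trans (le_of_eq (by ring))
  · have e1 := hC₁ η h0 h1 u v
    have e2 : |ip (sM q u) v| ≤ C₂ * (sX η m u * sX η m v) := by
      refine (hC₂ u v).trans (mul_le_mul_of_nonneg_left ?_ hC₂0)
      exact mul_le_mul (sX_zero_le η m u) (sX_zero_le η m v)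
        (Finset.sum_nonneg fun _ _ => sN_nonneg _) (sX_nonneg _ _ _)
    have e3 : C₁ * η * (sX η m u * sX η m v) ≤ C₁ * (sX η m u * sX η m v) :=
      mul_le_mul_of_nonneg_right (by nlinarith) hX
    have e4 := abs_sub_abs_le_abs_sub (ip (sM q u) (sLp η (2 * m) v)) (ip (sM q u) v)
    linarith

lemma ip_elliptic {a : Fin 3 → Fin 3 → E3 → ℝ} (ha : ∀ μ ν, Symb 0 (a μ ν)) {c : ℝ}
    (hc : ∀ x (ξ : Fin 3 → ℝ), c * ∑ i, ξ i ^ 2 ≤ ∑ μ, ∑ ν, a μ ν x * ξ μ * ξ ν) (w : Fin 3 → Sch) :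
    c * ∑ i, sN (w i) ^ 2 ≤ ∑ μ, ∑ ν, ip (sM (a μ ν) (w ν)) (w μ) := by
  have hi : ∀ μ ν, Integrable fun x => a μ ν x * w ν x * w μ x := fun μ ν => by
    have := Sch.integrable_mul (sM (a μ ν) (w ν)) (w μ)
    rwa [sM_coe (ha μ ν)] at this
  have e : ∑ μ, ∑ ν, ip (sM (a μ ν) (w ν)) (w μ) = ∫ x, ∑ μ, ∑ ν, a μ ν x * w ν x * w μ x := by
    rw [integral_finsetSum _ fun μ _ => integrable_finsetSum _ fun ν _ => hi μ ν]
    refine Finset.sum_congr rfl fun μ _ => ?_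
    rw [integral_finsetSum _ fun ν _ => hi μ ν]
    refine Finset.sum_congr rfl fun ν _ => ?_
    rw [ip_eq, sM_coe (ha μ ν)]
  have e' : c * ∑ i, sN (w i) ^ 2 = ∫ x, c * ∑ i, w i x ^ 2 := by
    rw [integral_const_mul, integral_finsetSum _ fun i _ => Sch.integrable_sq _]
    simp only [sN_sq]
  rw [e, e']
  refine integral_mono ((integrable_finsetSum _ fun i _ => Sch.integrable_sq _).const_mul _)
    (integrable_finsetSum _ fun μ _ => integrable_finsetSum _ fun ν _ => hi μ ν) fun x => ?_
  refine (hc x fun i => w i x).trans (le_of_eq ?_)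
  exact Finset.sum_congr rfl fun μ _ => Finset.sum_congr rfl fun ν _ => by ring

lemma sX_sq_le (η : ℝ) (m : ℕ) (u : Sch) : sX η m u ^ 2 ≤ 3 * ∑ i, sN (sLp η m (sD i u)) ^ 2 := by
  have := sq_sum_le_card_mul_sum_sq (s := Finset.univ) (f := fun i => sN (sLp η m (sD i u)))
  simpa [sX] using this

lemma sA_coercive {a : Fin 3 → Fin 3 → E3 → ℝ} {q : E3 → ℝ} (h : Coeffs a q) (m : ℕ) :
    ∃ c > 0, ∃ η : ℝ, 0 < η ∧ η ≤ 1 ∧ ∀ u, c * sX η m u ^ 2 ≤ ip (sA a q u) (sLp η (2 * m) u) := by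
  obtain ⟨c, hc0, hc⟩ := h.elliptic
  choose K hK0 hK using fun μ ν => commutator_sLp m _ (h.symb_a μ ν)
  obtain ⟨C₁, hC₁0, hC₁⟩ := ip_symb_le h.symb_q m (2 * m) le_rfl
  set S := ∑ μ, ∑ ν, K μ ν with hS
  have hS0 : 0 ≤ S := Finset.sum_nonneg fun μ _ => Finset.sum_nonneg fun ν _ => hK0 μ ν
  set η := min 1 (c / (6 * (S + C₁ + 1))) with hη
  have hη0 : 0 < η := lt_min one_pos (by positivity)
  have hη1 : η ≤ 1 := min_le_left _ _
  have hη2 : (S + C₁) * η ≤ c / 6 := by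
    have h1 : η ≤ c / (6 * (S + C₁ + 1)) := min_le_right _ _
    rw [le_div_iff₀ (by positivity)] at h1
    nlinarith
  refine ⟨c / 6, by positivity, η, hη0, hη1, fun u => ?_⟩
  set X := sX η m u with hX
  have hX0 : 0 ≤ X := sX_nonneg _ _ _
  have h1 : c * ∑ i, sN (sLp η m (sD i u)) ^ 2 - S * η * X ^ 2 ≤
      ∑ μ, ∑ ν, ip (sLp η m (sM (a μ ν) (sD ν u))) (sLp η m (sD μ u)) := by
    have e1 := ip_elliptic h.symb_a hc fun i => sLp η m (sD i u)
    have e2 : ∑ μ, ∑ ν, ip (sM (a μ ν) (sLp η m (sD ν u))) (sLp η m (sD μ u)) - S * η * X ^ 2 ≤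
        ∑ μ, ∑ ν, ip (sLp η m (sM (a μ ν) (sD ν u))) (sLp η m (sD μ u)) := by
      rw [sub_le_iff_le_add, hS, Finset.sum_mul, Finset.sum_mul, ← Finset.sum_add_distrib]
      refine Finset.sum_le_sum fun μ _ => ?_
      rw [Finset.sum_mul, Finset.sum_mul, ← Finset.sum_add_distrib]
      refine Finset.sum_le_sum fun ν _ => ?_
      have e3 := abs_ip_le (sLp η m (sM (a μ ν) (sD ν u)) - sM (a μ ν) (sLp η m (sD ν u)))
        (sLp η m (sD μ u))
      have e4 : sN (sLp η m (sM (a μ ν) (sD ν u)) - sM (a μ ν) (sLp η m (sD ν u))) *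
          sN (sLp η m (sD μ u)) ≤ K μ ν * η * X ^ 2 := by
        refine (mul_le_mul ((hK μ ν η hη0 hη1 (sD ν u)).trans (mul_le_mul_of_nonneg_left
          (sN_le_sX η m u ν) (mul_nonneg (hK0 μ ν) hη0.le))) (sN_le_sX η m u μ) (sN_nonneg _)
          (mul_nonneg (mul_nonneg (hK0 μ ν) hη0.le) hX0)).trans (le_of_eq (by ring))
      rw [ip_sub_left] at e3
      have e5 := neg_abs_le (ip (sLp η m (sM (a μ ν) (sD ν u))) (sLp η m (sD μ u)) -
        ip (sM (a μ ν) (sLp η m (sD ν u))) (sLp η m (sD μ u)))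
      linarith
    linarith
  have h2 := sX_sq_le η m u
  have h3 := hC₁ η hη0 hη1 u u
  have h4 := ip_symb_nonneg h.symb_q h.nonneg u
  have h5 := neg_abs_le (ip (sM q u) (sLp η (2 * m) u) - ip (sM q u) u)
  rw [ip_sA_sLp]
  have h6 : (S + C₁) * η * X ^ 2 ≤ c / 6 * X ^ 2 := mul_le_mul_of_nonneg_right hη2 (by positivity)
  have h7 := mul_le_mul_of_nonneg_left h2 hc0.le
  nlinarith

/-- The map `u ↦ (Λ^m ∂ᵢ u)ᵢ` into a Hilbert space. -/
def sT (η : ℝ) (m : ℕ) : Sch →ₗ[ℝ] PiLp 2 fun _ : Fin 3 => Lp ℝ 2 (volume : Measure E3) where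
  toFun u := WithLp.toLp 2 fun i => sJ (sLp η m (sD i u))
  map_add' u v := by
    ext1 i
    simp
  map_smul' c u := by
    ext1 i
    simp

lemma norm_sT_sq (η : ℝ) (m : ℕ) (u : Sch) :
    ‖sT η m u‖ ^ 2 = ∑ i, sN (sLp η m (sD i u)) ^ 2 := by
  rw [PiLp.norm_sq_eq_of_L2]
  rfl

lemma norm_sT_le (η : ℝ) (m : ℕ) (u : Sch) : ‖sT η m u‖ ≤ sX η m u := by
  refine le_of_sq_le_sq ?_ (sX_nonneg _ _ _)
  rw [norm_sT_sq]
  have h := fun i => sN_nonneg (sLp η m (sD i u))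
  simp only [sX, Fin.sum_univ_three]
  nlinarith [mul_nonneg (h 0) (h 1), mul_nonneg (h 0) (h 2), mul_nonneg (h 1) (h 2)]

lemma sX_le_norm_sT (η : ℝ) (m : ℕ) (u : Sch) : sX η m u ≤ 2 * ‖sT η m u‖ := by
  refine le_of_sq_le_sq ?_ (by positivity)
  have := sX_sq_le η m u
  rw [← norm_sT_sq] at this
  nlinarith [sq_nonneg ‖sT η m u‖]

/-- The variational solution: a sequence of Schwartz functions which is Cauchy in a norm
controlling `m` derivatives of the gradient, solving the equation weakly in the limit. -/
theorem exists_weak_sequence {a : Fin 3 → Fin 3 → E3 → ℝ} {q : E3 → ℝ} (h : Coeffs a q) (m : ℕ) :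
    ∃ η : ℝ, 0 < η ∧ ∃ u : ℕ → Sch,
      (∀ ε > 0, ∃ N, ∀ n ≥ N, ∀ k ≥ N, sX η m (u n - u k) ≤ ε) ∧
      ∀ w, Tendsto (fun n => ip (u n) (sA a q w)) atTop (nhds (-∫ x, q x * w x)) := by
  obtain ⟨c, hc0, η, hη0, hη1, hco⟩ := sA_coercive h m
  obtain ⟨C, hC0, hC⟩ := sA_bounded h m
  obtain ⟨p, hp, hpq⟩ := integral_symb_mul_sLp m η h.symb_q
  obtain ⟨K, hK0, hK⟩ := abs_integral_symb_mul_le hp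
  let B : Sch →ₗ[ℝ] Sch →ₗ[ℝ] ℝ := LinearMap.mk₂ ℝ (fun u v => ip (sA a q u) (sLp η (2 * m) v))
    (fun u v w => by rw [map_add, ip_add_left]) (fun r u v => by rw [map_smul, ip_smul_left]; rfl)
    (fun u v w => by rw [map_add, ip_add_right]) (fun r u v => by rw [map_smul, ip_smul_right]; rfl)
  let F : Sch →ₗ[ℝ] ℝ :=
    { toFun := fun v => -∫ x, q x * sLp η (2 * m) v x
      map_add' := fun v w => by
        rw [map_add, ← neg_add, ← integral_add (integrable_symb_mul h.symb_q _)
          (integrable_symb_mul h.symb_q _)]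
        simp [mul_add]
      map_smul' := fun r v => by
        rw [map_smul, smul_eq_mul, RingHom.id_apply, mul_neg, ← integral_const_mul]
        congr 2
        funext x
        simp only [smul_apply, smul_eq_mul]
        ring }
  have hB : ∀ u v, |B u v| ≤ C * 4 * ‖sT η m u‖ * ‖sT η m v‖ := fun u v => by
    refine (hC η hη0 hη1 u v).trans ?_
    have h1 := mul_le_mul (sX_le_norm_sT η m u) (sX_le_norm_sT η m v) (sX_nonneg _ _ _) (by positivity)
    calc _ ≤ C * (2 * ‖sT η m u‖ * (2 * ‖sT η m v‖)) := mul_le_mul_of_nonneg_left h1 hC0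
      _ = _ := by ring
  have hBc : ∀ u, c * ‖sT η m u‖ ^ 2 ≤ B u u := fun u => by
    refine le_trans (mul_le_mul_of_nonneg_left ?_ hc0.le) (hco u)
    exact pow_le_pow_left₀ (norm_nonneg _) (norm_sT_le η m u) 2
  have hF : ∀ v, |F v| ≤ K * 2 * ‖sT η m v‖ := fun v => by
    change |-∫ x, q x * sLp η (2 * m) v x| ≤ _
    rw [abs_neg, two_mul, sLp_add η m m, hpq]
    refine (hK _).trans ?_
    rw [mul_assoc]
    refine mul_le_mul_of_nonneg_left ?_ hK0
    have h1 : ∑ i, sN (sD i (sLp η m v)) = sX η m v :=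
      Finset.sum_congr rfl fun i _ => by rw [sD_sLp]
    rw [h1]
    exact sX_le_norm_sT η m v
  obtain ⟨u, hu, hu'⟩ := exists_approx_of_coercive (sT η m) B (by positivity) hB hc0 hBc F hF
  refine ⟨η, hη0, u, fun ε hε => ?_, fun w => ?_⟩
  · obtain ⟨N, hN⟩ := Metric.cauchySeq_iff.1 hu (ε / 2) (by positivity)
    refine ⟨N, fun n hn k hk => ?_⟩
    have h1 := hN n hn k hk
    rw [dist_eq_norm, ← map_sub] at h1
    have h2 := sX_le_norm_sT η m (u n - u k)
    linarith
  · obtain ⟨v, rfl⟩ := sLp_surjective η (2 * m) w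
    have h1 := hu' v
    refine h1.congr fun n => ?_
    exact ip_sA_symm h (u n) _

/-! ### Passing to the limit -/

/-- The divergence-form operator `∂_μ (a^{μν} ∂_ν u)`. -/
def divA (a : Fin 3 → Fin 3 → E3 → ℝ) (u : E3 → ℝ) (x : E3) : ℝ :=
  ∑ μ, pd3 μ (fun y => ∑ ν, a μ ν y * pd3 ν u y) x

/-- Cauchy in the norm controlling `m` derivatives of the gradient. -/
def XCauchy (m : ℕ) (f : ℕ → Sch) : Prop :=
  ∃ η : ℝ, 0 < η ∧ ∀ ε > 0, ∃ N, ∀ n ≥ N, ∀ k ≥ N, sX η m (f n - f k) ≤ ε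

lemma sX_sD_le {η : ℝ} (hη : 0 < η) (m : ℕ) (i : Fin 3) (w : Sch) :
    sX η m (sD i w) ≤ η⁻¹ * sX η (m + 1) w := by
  rw [sX, sX, Finset.mul_sum]
  refine Finset.sum_le_sum fun j _ => ?_
  rw [sD_comm, inv_mul_eq_div, le_div_iff₀ hη, mul_comm]
  exact sN_sLp_sD_le η m i (sD j w)

lemma sX_le_succ (η : ℝ) (m : ℕ) (w : Sch) : sX η m w ≤ sX η (m + 1) w :=
  Finset.sum_le_sum fun _ _ => sN_sLp_le_succ η m _

lemma XCauchy.sD {m : ℕ} {f : ℕ → Sch} (h : XCauchy (m + 1) f) (i : Fin 3) :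
    XCauchy m fun n => sD i (f n) := by
  obtain ⟨η, hη, h⟩ := h
  refine ⟨η, hη, fun ε hε => ?_⟩
  obtain ⟨N, hN⟩ := h (η * ε) (by positivity)
  refine ⟨N, fun n hn k hk => ?_⟩
  rw [← map_sub]
  refine (sX_sD_le hη m i _).trans ?_
  rw [inv_mul_eq_div, div_le_iff₀ hη, mul_comm]
  exact hN n hn k hk

lemma XCauchy.pred {m : ℕ} {f : ℕ → Sch} (h : XCauchy (m + 1) f) : XCauchy m f := by
  obtain ⟨η, hη, h⟩ := h
  refine ⟨η, hη, fun ε hε => ?_⟩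
  obtain ⟨N, hN⟩ := h ε hε
  exact ⟨N, fun n hn k hk => (sX_le_succ η m _).trans (hN n hn k hk)⟩

lemma XCauchy.one {m : ℕ} {f : ℕ → Sch} (h : XCauchy (m + 1) f) : XCauchy 1 f := by
  induction m with
  | zero => exact h
  | succ m ih => exact ih h.pred

lemma sE_le {η : ℝ} (hη : 0 < η) (w : Sch) : sE w ≤ (1 + 3 * (η⁻¹) ^ 2) * sX η 1 w ^ 2 := by
  have key : ∀ v : Sch, ∑ i, sN (sD i v) ^ 2 ≤ sX η 0 v ^ 2 := fun v => by
    have h := fun i => sN_nonneg (sD i v)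
    simp only [sX, sLp_zero, Fin.sum_univ_three]
    nlinarith [mul_nonneg (h 0) (h 1), mul_nonneg (h 0) (h 2), mul_nonneg (h 1) (h 2)]
  have h1 : ∑ i, sN (sD i w) ^ 2 ≤ sX η 1 w ^ 2 :=
    (key w).trans (pow_le_pow_left₀ (sX_nonneg _ _ _) (sX_le_succ η 0 w) 2)
  have h2 : ∑ i, ∑ j, sN (sD i (sD j w)) ^ 2 ≤ ∑ _j : Fin 3, (η⁻¹ * sX η 1 w) ^ 2 := by
    rw [Finset.sum_comm]
    exact Finset.sum_le_sum fun j _ => (key (sD j w)).trans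
      (pow_le_pow_left₀ (sX_nonneg _ _ _) (sX_sD_le hη 0 j w) 2)
  rw [Finset.sum_const, Finset.card_univ, Fintype.card_fin, nsmul_eq_mul] at h2
  unfold sE
  push_cast at h2
  nlinarith

lemma XCauchy.uniformCauchy {f : ℕ → Sch} (h : XCauchy 1 f) :
    UniformCauchySeqOn (fun n => ⇑(f n)) atTop Set.univ := by
  obtain ⟨η, hη, h⟩ := h
  obtain ⟨C, hC0, hC⟩ := sq_le_sE
  set K := C * (1 + 3 * (η⁻¹) ^ 2) with hK
  have hK0 : 0 < K := by positivity
  rw [Metric.uniformCauchySeqOn_iff]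
  intro ε hε
  obtain ⟨N, hN⟩ := h (ε / (2 * √K)) (by positivity)
  refine ⟨N, fun n hn k hk x _ => ?_⟩
  have h1 := hN n hn k hk
  have h2 := (hC (f n - f k) x).trans (mul_le_mul_of_nonneg_left (sE_le hη (f n - f k)) hC0.le)
  rw [← mul_assoc, ← hK] at h2
  have h3 := pow_le_pow_left₀ (sX_nonneg _ _ _) h1 2
  have h4 : K * (ε / (2 * √K)) ^ 2 = (ε / 2) ^ 2 := by
    have := Real.sq_sqrt hK0.le
    field_simp
    rw [this]
  have h5 : ((f n - f k) x) ^ 2 ≤ (ε / 2) ^ 2 :=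
    h2.trans ((mul_le_mul_of_nonneg_left h3 hK0.le).trans_eq h4)
  have h6 := abs_le_of_sq_le_sq h5 (by positivity)
  rw [Real.dist_eq]
  have h7 : (f n - f k) x = f n x - f k x := rfl
  rw [← h7]
  linarith

lemma exists_uniform_limit {f : ℕ → Sch} (h : XCauchy 1 f) :
    ∃ g : E3 → ℝ, TendstoUniformly (fun n => ⇑(f n)) g atTop := by
  have hc := h.uniformCauchy
  have hp : ∀ x, ∃ y, Tendsto (fun n => f n x) atTop (nhds y) := fun x =>
    cauchySeq_tendsto_of_complete (hc.cauchySeq (Set.mem_univ x))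
  choose g hg using hp
  exact ⟨g, tendstoUniformlyOn_univ.1 (hc.tendstoUniformlyOn_of_tendsto fun x _ => hg x)⟩

/-- The continuous linear form with given coordinates. -/
def coordForm (c : Fin 3 → ℝ) : E3 →L[ℝ] ℝ := ∑ i, c i • EuclideanSpace.proj i

lemma norm_coordForm_le (c : Fin 3 → ℝ) : ‖coordForm c‖ ≤ ∑ i, |c i| := by
  refine (norm_sum_le _ _).trans (Finset.sum_le_sum fun i _ => ?_)
  rw [norm_smul, Real.norm_eq_abs]
  refine mul_le_of_le_one_right (abs_nonneg _) ?_
  refine ContinuousLinearMap.opNorm_le_bound _ zero_le_one fun x => ?_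
  rw [one_mul]
  exact PiLp.norm_apply_le x i

lemma coordForm_single (c : Fin 3 → ℝ) (i : Fin 3) : coordForm c (EuclideanSpace.single i 1) = c i := by
  fin_cases i <;> simp [coordForm, Fin.sum_univ_three]

lemma fderiv_eq_coordForm (g : E3 → ℝ) (x : E3) : fderiv ℝ g x = coordForm fun i => pd3 i g x := by
  refine ContinuousLinearMap.coe_injective ((EuclideanSpace.basisFun (Fin 3) ℝ).toBasis.ext fun i => ?_)
  simp only [OrthonormalBasis.coe_toBasis, EuclideanSpace.basisFun_apply, ContinuousLinearMap.coe_coe]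
  rw [coordForm_single]
  rfl

lemma hasFDerivAt_uniform_limit {f : ℕ → Sch} {g : E3 → ℝ} {d : Fin 3 → E3 → ℝ}
    (hg : TendstoUniformly (fun n => ⇑(f n)) g atTop)
    (hd : ∀ i, TendstoUniformly (fun n => ⇑(sD i (f n))) (d i) atTop) (x : E3) :
    HasFDerivAt g (coordForm fun i => d i x) x := by
  have h : TendstoUniformly (fun n x => fderiv ℝ (f n) x) (fun x => coordForm fun i => d i x) atTop := by
    rw [Metric.tendstoUniformly_iff]
    intro ε hε
    have h1 : ∀ᶠ n in atTop, ∀ i, ∀ x, dist (d i x) (sD i (f n) x) < ε / 4 := by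
      rw [eventually_all]
      exact fun i => Metric.tendstoUniformly_iff.1 (hd i) _ (by positivity)
    filter_upwards [h1] with n hn x
    rw [fderiv_eq_coordForm, dist_eq_norm]
    have e : coordForm (fun i => d i x) - coordForm (fun i => pd3 i (f n) x) =
        coordForm fun i => d i x - pd3 i (f n) x := by
      simp [coordForm, sub_smul]
    rw [e]
    refine (norm_coordForm_le _).trans_lt ?_
    have h2 : ∀ i, |d i x - pd3 i (f n) x| < ε / 4 := fun i => hn i x
    rw [Fin.sum_univ_three]
    linarith [h2 0, h2 1, h2 2]
  exact hasFDerivAt_of_tendstoUniformly h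
    (fun n x => (Sch.differentiableAt (f n) x).hasFDerivAt)
    (fun x => hg.tendsto_at x) x

lemma pd3_of_hasFDerivAt {g : E3 → ℝ} {c : Fin 3 → ℝ} {x : E3} (h : HasFDerivAt g (coordForm c) x)
    (i : Fin 3) : pd3 i g x = c i := by
  rw [pd3, h.fderiv, coordForm_single]

lemma contDiff_uniform_limit (k : ℕ) : ∀ {f : ℕ → Sch} {g : E3 → ℝ}, XCauchy (k + 1) f →
    TendstoUniformly (fun n => ⇑(f n)) g atTop → ContDiff ℝ k g := by
  induction k with
  | zero =>
    intro f g _ hg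
    exact contDiff_zero.2 (hg.continuous (Frequently.of_forall fun n => (f n).continuous))
  | succ k ih =>
    intro f g hf hg
    have hex : ∀ i, ∃ d : E3 → ℝ, TendstoUniformly (fun n => ⇑(sD i (f n))) d atTop ∧ ContDiff ℝ k d := by
      intro i
      have h2 := hf.sD i
      obtain ⟨d, hd⟩ := exists_uniform_limit h2.one
      exact ⟨d, hd, ih h2 hd⟩
    choose d hd hdk using hex
    have hder := hasFDerivAt_uniform_limit hg hd
    push_cast
    rw [contDiff_succ_iff_hasFDerivAt]
    refine ⟨fun x => coordForm fun i => d i x, ?_, hder⟩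
    unfold coordForm
    exact ContDiff.sum fun i _ => (hdk i).smul contDiff_const

lemma sN_eq_eLpNorm (u : Sch) : eLpNorm u 2 volume = ENNReal.ofReal (sN u) := by
  have h : ‖sJ u‖ = (eLpNorm u 2 volume).toReal := SchwartzMap.norm_toLp
  rw [sN, h, ENNReal.ofReal_toReal (SchwartzMap.memLp u 2 volume).eLpNorm_ne_top]

lemma memLp_of_tendsto {f : ℕ → Sch} {g : E3 → ℝ} {M : ℝ} (hM : ∀ᶠ n in atTop, sN (f n) ≤ M)
    (hg : Continuous g) (h : ∀ x, Tendsto (fun n => f n x) atTop (nhds (g x))) :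
    MemLp g 2 (volume : Measure E3) := by
  refine ⟨hg.aestronglyMeasurable, ?_⟩
  have h1 := Lp.eLpNorm_lim_le_liminf_eLpNorm (p := 2) (μ := (volume : Measure E3))
    (fun n => (f n).continuous.aestronglyMeasurable) g (Eventually.of_forall h)
  refine h1.trans_lt (lt_of_le_of_lt ?_ (ENNReal.ofReal_lt_top (r := M)))
  refine Filter.liminf_le_of_frequently_le' (Eventually.frequently ?_)
  filter_upwards [hM] with n hn
  rw [sN_eq_eLpNorm]
  exact ENNReal.ofReal_le_ofReal hn

lemma XCauchy.bounded {m : ℕ} {f : ℕ → Sch} (h : XCauchy m f) :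
    ∃ M, ∀ᶠ n in atTop, ∑ i, sN (_root_.sD i (f n)) ≤ M := by
  obtain ⟨η, hη, h⟩ := h
  obtain ⟨N, hN⟩ := h 1 one_pos
  refine ⟨1 + ∑ i, sN (_root_.sD i (f N)), ?_⟩
  filter_upwards [eventually_ge_atTop N] with n hn
  have h1 := (sX_zero_le η m _).trans (hN n hn N le_rfl)
  have h2 : ∑ i, sN (_root_.sD i (f n)) ≤
      ∑ i, (sN (_root_.sD i (f n - f N)) + sN (_root_.sD i (f N))) := by
    refine Finset.sum_le_sum fun i _ => ?_
    have := sN_add_le (_root_.sD i (f n - f N)) (_root_.sD i (f N))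
    rwa [← map_add, sub_add_cancel] at this
  rw [Finset.sum_add_distrib] at h2
  linarith

lemma tendsto_zero_of_uniform_limit {f : ℕ → Sch} {g : E3 → ℝ}
    (h : TendstoUniformly (fun n => ⇑(f n)) g atTop) : Tendsto g (cocompact E3) (nhds 0) := by
  rw [Metric.tendsto_nhds]
  intro ε hε
  obtain ⟨n, hn⟩ := (Metric.tendstoUniformly_iff.1 h (ε / 2) (by positivity)).exists
  have h0 : Tendsto (f n) (cocompact E3) (nhds 0) := (f n).toZeroAtInfty.zero_at_infty'
  filter_upwards [Metric.tendsto_nhds.1 h0 (ε / 2) (by positivity)] with x hx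
  have h1 := hn x
  have h2 := dist_triangle (g x) (f n x) 0
  linarith

lemma integral_mul_pd3 {f g : E3 → ℝ} (hf : ContDiff ℝ 1 f) (hg : ContDiff ℝ 1 g)
    (hc : HasCompactSupport g) (i : Fin 3) : ∫ x, f x * pd3 i g x = -∫ x, pd3 i f x * g x := by
  have hpf : Continuous (pd3 i f) := (hf.continuous_fderiv (by norm_num)).clm_apply continuous_const
  have hpg : Continuous (pd3 i g) := (hg.continuous_fderiv (by norm_num)).clm_apply continuous_const
  have hcg : HasCompactSupport (pd3 i g) := hc.fderiv_apply ℝ _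
  exact integral_mul_fderiv_eq_neg_fderiv_mul_of_integrable
    ((hpf.mul hg.continuous).integrable_of_hasCompactSupport hc.mul_left)
    ((hf.continuous.mul hpg).integrable_of_hasCompactSupport hcg.mul_left)
    ((hf.continuous.mul hg.continuous).integrable_of_hasCompactSupport hc.mul_left)
    (fun x _ => hf.differentiable (by norm_num) x) (fun x _ => hg.differentiable (by norm_num) x)

lemma ContDiff.pd_nat {g : E3 → ℝ} {k : ℕ} (hg : ContDiff ℝ (k + 1 : ℕ) g) (i : Fin 3) :
    ContDiff ℝ k (pd3 i g) :=
  (hg.fderiv_right (by norm_cast)).clm_apply contDiff_const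

lemma contDiff_divA_of_symb {a : Fin 3 → Fin 3 → E3 → ℝ} (ha : ∀ μ ν, Symb 0 (a μ ν)) {k : ℕ}
    {u : E3 → ℝ} (hu : ContDiff ℝ (k + 1 : ℕ) u) (μ : Fin 3) :
    ContDiff ℝ k fun y => ∑ ν, a μ ν y * pd3 ν u y :=
  ContDiff.sum fun ν _ => ((ha μ ν).smooth.of_le (by exact_mod_cast le_top)).mul (hu.pd_nat ν)

lemma continuous_divA {a : Fin 3 → Fin 3 → E3 → ℝ} (ha : ∀ μ ν, Symb 0 (a μ ν))
    {u : E3 → ℝ} (hu : ContDiff ℝ 2 u) : Continuous (divA a u) :=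
  continuous_finsetSum _ fun μ _ =>
    (ContDiff.pd_nat (k := 0) (contDiff_divA_of_symb ha (k := 1) hu μ) μ).continuous

lemma integral_mul_divA {a : Fin 3 → Fin 3 → E3 → ℝ} (ha : ∀ μ ν, Symb 0 (a μ ν))
    {u w : E3 → ℝ} (hu : ContDiff ℝ 2 u) (hw : ContDiff ℝ 1 w) (hc : HasCompactSupport w) :
    ∫ x, divA a u x * w x = -∫ x, ∑ μ, ∑ ν, a μ ν x * pd3 ν u x * pd3 μ w x := by
  have hF : ∀ μ, ContDiff ℝ 1 fun y => ∑ ν, a μ ν y * pd3 ν u y :=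
    fun μ => contDiff_divA_of_symb ha (k := 1) hu μ
  have hcp : ∀ μ, Continuous (pd3 μ w) := fun μ =>
    (hw.continuous_fderiv (by norm_num)).clm_apply continuous_const
  have h1 : ∀ μ, Integrable fun x => pd3 μ (fun y => ∑ ν, a μ ν y * pd3 ν u y) x * w x := fun μ =>
    ((((hF μ).continuous_fderiv (by norm_num)).clm_apply continuous_const).mul
      hw.continuous).integrable_of_hasCompactSupport hc.mul_left
  have h2 : ∀ μ, Integrable fun x => (∑ ν, a μ ν x * pd3 ν u x) * pd3 μ w x := fun μ =>
    ((hF μ).continuous.mul (hcp μ)).integrable_of_hasCompactSupport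
      (HasCompactSupport.mul_left (hc.fderiv_apply ℝ _))
  simp only [divA, ← Finset.sum_mul]
  simp only [Finset.sum_mul _ _ (w _)]
  rw [integral_finsetSum _ fun μ _ => h1 μ, integral_finsetSum _ fun μ _ => h2 μ,
    ← Finset.sum_neg_distrib]
  refine Finset.sum_congr rfl fun μ _ => ?_
  rw [integral_mul_pd3 (hF μ) hw hc, neg_neg]

lemma sA_coe {a : Fin 3 → Fin 3 → E3 → ℝ} {q : E3 → ℝ} (h : Coeffs a q) (w : Sch) (x : E3) :
    sA a q w x = q x * w x - divA a w x := by
  rw [sA_apply, divA, sub_apply, sM_coe h.symb_q]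
  congr 1
  rw [sum_apply]
  refine Finset.sum_congr rfl fun μ _ => ?_
  rw [sum_apply, pd3_sum (f := fun ν y => a μ ν y * pd3 ν w y) _ fun ν _ =>
    ((h.symb_a μ ν).smooth.mul (Sch.smooth (sD ν w))).differentiable (by simp) x]
  refine Finset.sum_congr rfl fun ν _ => ?_
  rw [sD_coe, sM_coe (h.symb_a μ ν), sD_coe]

lemma tendsto_ip_of_uniform {f : ℕ → Sch} {g : E3 → ℝ}
    (hg : TendstoUniformly (fun n => ⇑(f n)) g atTop) (v : Sch) :
    Tendsto (fun n => ip (f n) v) atTop (nhds (∫ x, g x * v x)) := by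
  simp only [ip_eq]
  obtain ⟨N, hN⟩ := eventually_atTop.1 (Metric.tendstoUniformly_iff.1 hg 1 one_pos)
  refine tendsto_integral_filter_of_dominated_convergence
    (fun x => ‖f N x * v x‖ + 2 * ‖v x‖)
    (Eventually.of_forall fun n => ((f n).continuous.mul v.continuous).aestronglyMeasurable) ?_
    ((Sch.integrable_mul (f N) v).norm.add (v.integrable.norm.const_mul 2)) ?_
  · filter_upwards [eventually_ge_atTop N] with n hn
    refine Eventually.of_forall fun x => ?_
    have h1 := hN n hn x
    have h2 := hN N le_rfl x
    rw [dist_eq_norm] at h1 h2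
    rw [norm_mul, norm_mul, ← add_mul]
    refine mul_le_mul_of_nonneg_right ?_ (norm_nonneg _)
    have h3 : f n x = f N x + (g x - f N x) - (g x - f n x) := by ring
    rw [h3]
    refine (norm_sub_le _ _).trans ?_
    have := norm_add_le (f N x) (g x - f N x)
    linarith
  · exact Eventually.of_forall fun x => (hg.tendsto_at x).mul_const _

lemma hasCompactSupport_flux {a : Fin 3 → Fin 3 → E3 → ℝ} {w : E3 → ℝ}
    (hc : HasCompactSupport w) (μ : Fin 3) :
    HasCompactSupport fun y => ∑ ν, a μ ν y * pd3 ν w y := by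
  simp only [Fin.sum_univ_three]
  exact ((HasCompactSupport.mul_left (hc.fderiv_apply ℝ _)).add
    (HasCompactSupport.mul_left (hc.fderiv_apply ℝ _))).add
    (HasCompactSupport.mul_left (hc.fderiv_apply ℝ _))

lemma hasCompactSupport_divA {a : Fin 3 → Fin 3 → E3 → ℝ} {w : E3 → ℝ}
    (hc : HasCompactSupport w) : HasCompactSupport (divA a w) := by
  unfold divA
  simp only [Fin.sum_univ_three (f := fun μ => pd3 μ _ _)]
  exact (((hasCompactSupport_flux hc _).fderiv_apply ℝ _).add
    ((hasCompactSupport_flux hc _).fderiv_apply ℝ _)).add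
    ((hasCompactSupport_flux hc _).fderiv_apply ℝ _)

lemma integral_mul_divA_symm {a : Fin 3 → Fin 3 → E3 → ℝ} {q : E3 → ℝ} (h : Coeffs a q)
    {u w : E3 → ℝ} (hu : ContDiff ℝ 2 u) (hw : ContDiff ℝ 2 w) (hc : HasCompactSupport w) :
    ∫ x, divA a u x * w x = ∫ x, u x * divA a w x := by
  have hu1 : ContDiff ℝ 1 u := hu.of_le (by norm_num)
  have hcF := hasCompactSupport_flux (a := a) hc
  have hF : ∀ μ, ContDiff ℝ 1 fun y => ∑ ν, a μ ν y * pd3 ν w y :=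
    fun μ => contDiff_divA_of_symb h.symb_a (k := 1) hw μ
  have hcp : ∀ μ, Continuous (pd3 μ u) := fun μ =>
    (hu1.continuous_fderiv (by norm_num)).clm_apply continuous_const
  have hi1 : ∀ μ, Integrable fun x => u x * pd3 μ (fun y => ∑ ν, a μ ν y * pd3 ν w y) x :=
    fun μ => (hu1.continuous.mul (((hF μ).continuous_fderiv (by norm_num)).clm_apply
      continuous_const)).integrable_of_hasCompactSupport
      (HasCompactSupport.mul_left ((hcF μ).fderiv_apply ℝ _))
  have hi2 : ∀ μ, Integrable fun x => pd3 μ u x * ∑ ν, a μ ν x * pd3 ν w x := fun μ =>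
    ((hcp μ).mul (hF μ).continuous).integrable_of_hasCompactSupport (hcF μ).mul_left
  rw [integral_mul_divA h.symb_a hu (hw.of_le (by norm_num)) hc]
  calc -∫ x, ∑ μ, ∑ ν, a μ ν x * pd3 ν u x * pd3 μ w x
      = -∫ x, ∑ μ, pd3 μ u x * ∑ ν, a μ ν x * pd3 ν w x := by
        congr 1
        refine integral_congr_ae (Eventually.of_forall fun x => ?_)
        simp only [Finset.mul_sum]
        rw [Finset.sum_comm]
        refine Finset.sum_congr rfl fun μ _ => Finset.sum_congr rfl fun ν _ => ?_
        rw [h.symm ν μ]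
        ring
    _ = ∑ μ, ∫ x, u x * pd3 μ (fun y => ∑ ν, a μ ν y * pd3 ν w y) x := by
        rw [integral_finsetSum _ fun μ _ => hi2 μ, ← Finset.sum_neg_distrib]
        exact Finset.sum_congr rfl fun μ _ => (integral_mul_pd3 hu1 (hF μ) (hcF μ) μ).symm
    _ = ∫ x, u x * divA a w x := by
        rw [← integral_finsetSum _ fun μ _ => hi1 μ]
        refine integral_congr_ae (Eventually.of_forall fun x => ?_)
        simp only [divA]
        rw [Finset.mul_sum]

/-- The decaying solution of `∂_μ(a^{μν} ∂_ν u) = q u + q`, with any finite order of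
differentiability. -/
structure IsSol (a : Fin 3 → Fin 3 → E3 → ℝ) (q : E3 → ℝ) (u : E3 → ℝ) : Prop where
  tendsto : Tendsto u (cocompact E3) (nhds 0)
  memLp : MemLp (fun x => (jb x)⁻¹ * u x) 2 (volume : Measure E3)
  memLp_pd : ∀ i, MemLp (pd3 i u) 2 (volume : Measure E3)
  eq : ∀ x, divA a u x = q x * u x + q x

theorem exists_isSol_nat {a : Fin 3 → Fin 3 → E3 → ℝ} {q : E3 → ℝ} (h : Coeffs a q) (k : ℕ) :
    ∃ u, ContDiff ℝ (k + 2 : ℕ) u ∧ IsSol a q u := by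
  obtain ⟨η, hη, f, hf, hweak⟩ := exists_weak_sequence h (k + 3)
  have hX : XCauchy (k + 2 + 1) f := ⟨η, hη, hf⟩
  obtain ⟨u, hu⟩ := exists_uniform_limit hX.one
  have hC : ContDiff ℝ (k + 2 : ℕ) u := contDiff_uniform_limit (k + 2) hX hu
  have hC2 : ContDiff ℝ 2 u := hC.of_le (by norm_cast; omega)
  have hC1 : ContDiff ℝ 1 u := hC2.of_le (by norm_num)
  choose d hd using fun i => exists_uniform_limit (hX.sD i).one
  have hder := hasFDerivAt_uniform_limit hu hd
  have hpd : ∀ i, pd3 i u = d i := fun i => funext fun x => pd3_of_hasFDerivAt (hder x) i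
  obtain ⟨M, hM⟩ := hX.bounded
  have hjc : Continuous fun x : E3 => (jb x)⁻¹ := symb_jb_inv.smooth.continuous
  refine ⟨u, hC, tendsto_zero_of_uniform_limit hu, ?_, fun i => ?_, ?_⟩
  · refine memLp_of_tendsto (f := fun n => sM (fun x => (jb x)⁻¹) (f n)) (M := 2 * M) ?_
      (hjc.mul hC.continuous) fun x => ?_
    · filter_upwards [hM] with n hn
      exact (hardy _).trans (by linarith)
    · simp only [sM_coe symb_jb_inv]
      exact (hu.tendsto_at x).const_mul _
  · refine memLp_of_tendsto (f := fun n => sD i (f n)) (M := M) ?_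
      ((hC1.continuous_fderiv (by norm_num)).clm_apply continuous_const) fun x => ?_
    · filter_upwards [hM] with n hn
      exact (Finset.single_le_sum (f := fun i => sN (sD i (f n)))
        (fun j _ => sN_nonneg _) (Finset.mem_univ i)).trans hn
    · rw [hpd i]
      exact (hd i).tendsto_at x
  · have hq : Continuous q := h.symb_q.smooth.continuous
    have hcont : Continuous fun x => q x * u x + q x - divA a u x :=
      ((hq.mul hC.continuous).add hq).sub (continuous_divA h.symb_a hC2)
    have hae := ae_eq_zero_of_integral_contDiff_smul_eq_zero
      (μ := (volume : Measure E3)) hcont.locallyIntegrable fun w hw hc => ?_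
    · have := (hcont.ae_eq_iff_eq volume continuous_const).1 hae
      intro x
      have hx : q x * u x + q x - divA a u x = 0 := congrFun this x
      linarith
    · set W := hc.toSchwartzMap hw with hWdef
      have hWc : ⇑W = w := rfl
      have hw2 : ContDiff ℝ 2 w := contDiff_infty.1 hw 2
      have h1 := tendsto_nhds_unique (hweak W) (tendsto_ip_of_uniform hu (sA a q W))
      simp only [sA_coe h, hWc, mul_sub] at h1
      have hi1 : Integrable fun x => u x * (q x * w x) :=
        (hC.continuous.mul (hq.mul hw.continuous)).integrable_of_hasCompactSupport
          hc.mul_left.mul_left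
      have hi3 : Integrable fun x => q x * w x :=
        (hq.mul hw.continuous).integrable_of_hasCompactSupport hc.mul_left
      have hi2 : Integrable fun x => divA a u x * w x :=
        ((continuous_divA h.symb_a hC2).mul hw.continuous).integrable_of_hasCompactSupport
          hc.mul_left
      have hi4 : Integrable fun x => u x * divA a w x :=
        (hC.continuous.mul (continuous_divA h.symb_a hw2)).integrable_of_hasCompactSupport
          (hasCompactSupport_divA hc).mul_left
      rw [integral_sub hi1 hi4, ← integral_mul_divA_symm h hC2 hw2 hc] at h1
      have h2 : ∀ x, w x • (q x * u x + q x - divA a u x) =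
          u x * (q x * w x) + q x * w x - divA a u x * w x := fun x => by
        rw [smul_eq_mul]; ring
      simp only [h2]
      have h3 := integral_sub (hi1.add hi3) hi2
      have h4 := integral_add hi1 hi3
      simp only [Pi.add_apply] at h3 h4
      rw [h3, h4]
      linarith

/-! ### The maximum principle -/

lemma deriv_line {g : E3 → ℝ} (hg : Differentiable ℝ g) (x ξ : E3) (t : ℝ) :
    deriv (fun s : ℝ => g (x + s • ξ)) t = ∑ i, ξ i * pd3 i g (x + t • ξ) := by
  have h1 : HasDerivAt (fun s : ℝ => x + s • ξ) ξ t := by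
    simpa using ((hasDerivAt_id t).smul_const ξ).const_add x
  have h2 := (hg (x + t • ξ)).hasFDerivAt.comp_hasDerivAt t h1
  rw [HasDerivAt.deriv (f := fun s : ℝ => g (x + s • ξ)) h2, fderiv_eq_sum_pd3]
  simp [mul_comm]

lemma IsLocalMin.second_deriv_nonneg {φ : ℝ → ℝ} (hφ : Continuous φ) {t : ℝ}
    (h : IsLocalMin φ t) : 0 ≤ deriv (deriv φ) t := by
  by_contra! hneg
  have h1 := isLocalMax_of_deriv_deriv_neg hneg h.deriv_eq_zero hφ.continuousAt
  have h2 : φ =ᶠ[nhds t] fun _ => φ t := by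
    filter_upwards [h, h1] with s h3 h4
    exact le_antisymm h4 h3
  have h3 : deriv (deriv φ) t = 0 := by
    rw [h2.deriv.deriv_eq]
    simp
  exact hneg.ne h3

lemma IsLocalMin.hessian_nonneg {g : E3 → ℝ} (hg : ContDiff ℝ 2 g) {x : E3} (h : IsLocalMin g x)
    (ξ : E3) : 0 ≤ ∑ i, ξ i * ∑ j, ξ j * pd3 j (pd3 i g) x := by
  have hpd : ∀ i, Differentiable ℝ (pd3 i g) := fun i =>
    (ContDiff.pd_nat (k := 1) hg i).differentiable (by norm_num)
  have hline : ContinuousAt (fun s : ℝ => x + s • ξ) 0 := by fun_prop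
  have hmin : IsLocalMin (fun s : ℝ => g (x + s • ξ)) 0 := by
    have h0 : ∀ᶠ y in nhds (x + (0 : ℝ) • ξ), g (x + (0 : ℝ) • ξ) ≤ g y := by
      rw [zero_smul, add_zero]
      exact h
    exact hline.eventually h0
  have h1 := hmin.second_deriv_nonneg (by have := hg.continuous; fun_prop)
  have h2 : deriv (fun s : ℝ => g (x + s • ξ)) = fun s => ∑ i, ξ i * pd3 i g (x + s • ξ) :=
    funext fun s => deriv_line (hg.differentiable (by norm_num)) x ξ s
  have hd : ∀ i, DifferentiableAt ℝ (fun s : ℝ => pd3 i g (x + s • ξ)) 0 := fun i =>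
    (hpd i _).comp (0 : ℝ) (by fun_prop)
  rw [h2, deriv_fun_sum fun i _ => (hd i).const_mul _] at h1
  simpa [deriv_const_mul _ (hd _), deriv_line (hpd _)] using h1

lemma divA_eq {a : Fin 3 → Fin 3 → E3 → ℝ} (ha : ∀ μ ν, Symb 0 (a μ ν)) {u : E3 → ℝ}
    (hu : ContDiff ℝ 2 u) (x : E3) :
    divA a u x = ∑ μ, ∑ ν, (pd3 μ (a μ ν) x * pd3 ν u x + a μ ν x * pd3 μ (pd3 ν u) x) := by
  have hpd : ∀ i, Differentiable ℝ (pd3 i u) := fun i =>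
    (ContDiff.pd_nat (k := 1) hu i).differentiable (by norm_num)
  have had := fun μ ν => smooth_differentiable (ha μ ν).smooth
  refine Finset.sum_congr rfl fun μ _ => ?_
  rw [pd3_sum (f := fun ν y => a μ ν y * pd3 ν u y) _ fun ν _ => (had μ ν x).mul (hpd ν x)]
  exact Finset.sum_congr rfl fun ν _ => pd3_mul (had μ ν x) (hpd ν x) μ

lemma divA_sub_mul {a : Fin 3 → Fin 3 → E3 → ℝ} (ha : ∀ μ ν, Symb 0 (a μ ν)) {u v : E3 → ℝ}
    (hu : ContDiff ℝ 2 u) (hv : ContDiff ℝ 2 v) (c : ℝ) (x : E3) :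
    divA a (fun y => u y - c * v y) x = divA a u x - c * divA a v x := by
  have hpd : ∀ {w : E3 → ℝ}, ContDiff ℝ 2 w → ∀ i, Differentiable ℝ (pd3 i w) := fun hw i =>
    (ContDiff.pd_nat (k := 1) hw i).differentiable (by norm_num)
  have hd : ∀ {w : E3 → ℝ}, ContDiff ℝ 2 w → Differentiable ℝ w := fun hw =>
    hw.differentiable (by norm_num)
  have h1 : ∀ i, pd3 i (fun y => u y - c * v y) = fun y => pd3 i u y - c * pd3 i v y := fun i => by
    funext y
    rw [pd3_sub (hd hu y) ((hd hv y).const_mul c), pd3_const_mul c (hd hv y)]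
  rw [divA_eq ha (hu.sub (contDiff_const.mul hv)), divA_eq ha hu, divA_eq ha hv]
  simp only [Finset.mul_sum, ← Finset.sum_sub_distrib]
  refine Finset.sum_congr rfl fun μ _ => Finset.sum_congr rfl fun ν _ => ?_
  rw [h1 ν, pd3_sub (hpd hu ν x) ((hpd hv ν x).const_mul c), pd3_const_mul c (hpd hv ν x)]
  ring

lemma divA_nonneg_of_isLocalMin {a : Fin 3 → Fin 3 → E3 → ℝ} {q : E3 → ℝ} (h : Coeffs a q)
    {g : E3 → ℝ} (hg : ContDiff ℝ 2 g) {x : E3} (hx : IsLocalMin g x) : 0 ≤ divA a g x := by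
  have h0 : ∀ i, pd3 i g x = 0 := fun i => by rw [pd3, hx.fderiv_eq_zero]; simp
  obtain ⟨c, hc, hell⟩ := h.elliptic
  have hA : (Matrix.of fun μ ν => a μ ν x).PosSemidef := by
    refine .of_dotProduct_mulVec_nonneg (Matrix.IsHermitian.ext fun i j => ?_) fun ξ => ?_
    · simp [h.symm i j]
    · have h1 : 0 ≤ c * ∑ i, ξ i ^ 2 := by positivity
      refine (h1.trans (hell x ξ)).trans_eq ?_
      simp only [dotProduct, Matrix.mulVec, Finset.mul_sum, Matrix.of_apply, star_trivial]
      exact Finset.sum_congr rfl fun μ _ => Finset.sum_congr rfl fun ν _ => by ring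
  have hH : (Matrix.of fun μ ν => pd3 μ (pd3 ν g) x).PosSemidef := by
    refine .of_dotProduct_mulVec_nonneg (Matrix.IsHermitian.ext fun i j => ?_) fun ξ => ?_
    · simpa using congrFun (pd3_comm hg j i) x
    · refine (hx.hessian_nonneg hg (WithLp.toLp 2 ξ)).trans_eq ?_
      simp only [dotProduct, Matrix.mulVec, Finset.mul_sum, Matrix.of_apply, star_trivial]
      rw [Finset.sum_comm]
      exact Finset.sum_congr rfl fun μ _ => Finset.sum_congr rfl fun ν _ => by ring
  have h1 := (hA.hadamard hH).dotProduct_mulVec_nonneg fun _ => 1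
  rw [divA_eq h.symb_a hg]
  refine h1.trans_eq ?_
  simp [dotProduct, Matrix.mulVec, h0, Matrix.hadamard]

lemma Symb.abs_le {s : ℤ} {g : E3 → ℝ} (hg : Symb s g) (hs : 0 ≤ s) :
    ∃ C, 0 ≤ C ∧ ∀ x, |g x| ≤ C := by
  simpa using (hg.weaken hs).bound

lemma exists_radius {P : E3 → Prop} (h : ∀ᶠ y in cocompact E3, P y) :
    ∃ R, ∀ y : E3, R ≤ ‖y‖ → P y := by
  obtain ⟨t, ht, hts⟩ := mem_cocompact.1 h
  obtain ⟨r, hr⟩ := ht.isBounded.subset_closedBall 0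
  refine ⟨r + 1, fun y hy => hts fun hyt => ?_⟩
  have := mem_closedBall_zero_iff.1 (hr hyt)
  linarith

/-- A strict subsolution of the homogeneous equation, positive on `ℝ³`. -/
lemma exists_barrier {a : Fin 3 → Fin 3 → E3 → ℝ} {q : E3 → ℝ} (h : Coeffs a q) :
    ∃ g : E3 → ℝ, ContDiff ℝ ∞ g ∧ (∀ x, 0 < g x) ∧ ∀ x, q x * g x < divA a g x := by
  obtain ⟨c, hc, hell⟩ := h.elliptic
  obtain ⟨Q, hQ0, hQ⟩ := h.symb_q.abs_le (by norm_num)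
  have hdiv : Symb 1 fun x => ∑ μ, pd3 μ (a μ 0) x := Symb.sum _ fun μ _ => by
    simpa using (h.symb_a μ 0).pd μ
  obtain ⟨B, hB0, hB⟩ := hdiv.abs_le (by norm_num)
  set l := (B + Q + 1) / c + 1 with hl
  have hl1 : 1 ≤ l := by rw [hl]; have : 0 ≤ (B + Q + 1) / c := by positivity
                         linarith
  have hlc : B + Q + 1 ≤ l * c := by rw [hl]; field_simp; linarith
  have hcoord : ContDiff ℝ ∞ fun x : E3 => x 0 := (Symb.coord 0).smooth
  have hg : ContDiff ℝ ∞ fun x : E3 => Real.exp (l * x 0) := (contDiff_const.mul hcoord).exp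
  have hpd : ∀ ν, pd3 ν (fun x : E3 => Real.exp (l * x 0)) =
      fun x => (if ν = 0 then l else 0) * Real.exp (l * x 0) := fun ν => by
    funext x
    have h1 : HasFDerivAt (fun x : E3 => l * x 0) (l • (EuclideanSpace.proj 0 : E3 →L[ℝ] ℝ)) x :=
      (EuclideanSpace.proj 0 : E3 →L[ℝ] ℝ).hasFDerivAt.const_mul l
    rw [pd3, h1.exp.fderiv]
    simp [eq_comm, mul_comm]
  refine ⟨fun x => Real.exp (l * x 0), hg, fun x => Real.exp_pos _, fun x => ?_⟩
  have hd := smooth_differentiable hg x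
  have h1 : divA a (fun x => Real.exp (l * x 0)) x =
      (l * (∑ μ, pd3 μ (a μ 0) x) + l * l * a 0 0 x) * Real.exp (l * x 0) := by
    rw [divA_eq h.symb_a (contDiff_infty.1 hg 2)]
    simp only [hpd, pd3_const_mul _ hd]
    simp [Fin.sum_univ_three]
    ring
  have h2 : c ≤ a 0 0 x := by
    have := hell x fun i => if i = 0 then 1 else 0
    simpa [Fin.sum_univ_three] using this
  have h3 : -B ≤ ∑ μ, pd3 μ (a μ 0) x := neg_le_of_abs_le (hB x)
  have h4 : q x ≤ Q := le_of_abs_le (hQ x)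
  rw [h1]
  refine mul_lt_mul_of_pos_right ?_ (Real.exp_pos _)
  nlinarith [mul_le_mul_of_nonneg_left h3 (by linarith : 0 ≤ l),
    mul_le_mul_of_nonneg_left h2 (by positivity : 0 ≤ l * l)]

lemma le_on_closedBall {a : Fin 3 → Fin 3 → E3 → ℝ} {q : E3 → ℝ} (h : Coeffs a q) {w g : E3 → ℝ}
    (hw : ContDiff ℝ 2 w) (hg : ContDiff ℝ 2 g) (heq : ∀ x, divA a w x = q x * w x)
    (hlt : ∀ x, q x * g x < divA a g x) {δ R m : ℝ} (hδ : 0 < δ) (hR : 0 ≤ R) (hm : m ≤ 0)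
    (hbd : ∀ x, ‖x‖ = R → m ≤ w x - δ * g x) (x : E3) (hx : ‖x‖ ≤ R) : m ≤ w x - δ * g x := by
  set v : E3 → ℝ := fun y => w y - δ * g y with hv
  have hvC : ContDiff ℝ 2 v := hw.sub (contDiff_const.mul hg)
  obtain ⟨y, hy, hmin⟩ := (isCompact_closedBall (0 : E3) R).exists_isMinOn
    ⟨0, by simpa using hR⟩ hvC.continuous.continuousOn
  have hxy : v y ≤ v x := hmin (by simpa using hx)
  refine le_trans ?_ hxy
  by_contra! hlt'
  have hyR : ‖y‖ < R := by
    refine lt_of_le_of_ne (by simpa using hy) fun hyR => ?_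
    exact absurd (hbd y hyR) (not_le.2 hlt')
  have hloc : IsLocalMin v y := by
    filter_upwards [Metric.ball_mem_nhds y (sub_pos.2 hyR)] with z hz
    refine hmin ?_
    rw [mem_closedBall_zero_iff]
    rw [mem_ball_iff_norm] at hz
    have := norm_add_le (z - y) y
    rw [sub_add_cancel] at this
    linarith
  have h1 := divA_nonneg_of_isLocalMin h hvC hloc
  rw [hv, divA_sub_mul h.symb_a hw hg, heq] at h1
  have h2 : q y * v y ≤ 0 := mul_nonpos_of_nonneg_of_nonpos (h.nonneg y) (hlt'.le.trans hm)
  have h3 := mul_lt_mul_of_pos_left (hlt y) hδ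
  have h4 : q y * v y = q y * w y - δ * (q y * g y) := by rw [hv]; ring
  linarith

lemma nonneg_of_tendsto {a : Fin 3 → Fin 3 → E3 → ℝ} {q : E3 → ℝ} (h : Coeffs a q) {w : E3 → ℝ}
    (hw : ContDiff ℝ 2 w) (heq : ∀ x, divA a w x = q x * w x)
    (h0 : Tendsto w (cocompact E3) (nhds 0)) (x : E3) : 0 ≤ w x := by
  by_contra! hx
  obtain ⟨g, hg, hgpos, hlt⟩ := exists_barrier h
  have hfar : ∀ᶠ y in cocompact E3, w x / 2 < w y := h0.eventually (lt_mem_nhds (by linarith))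
  obtain ⟨R, hR⟩ : ∃ R, ∀ y : E3, R ≤ ‖y‖ → w x / 2 < w y := exists_radius hfar
  set R' := max R (‖x‖) with hR'
  have hR0 : 0 ≤ R' := (norm_nonneg x).trans (le_max_right _ _)
  obtain ⟨z, -, hz⟩ := (isCompact_closedBall (0 : E3) R').exists_isMaxOn
    ⟨0, by simpa using hR0⟩ hg.continuous.continuousOn
  have hz' : ∀ y : E3, ‖y‖ ≤ R' → g y ≤ g z := fun y hy => hz (by simpa using hy)
  set δ := -w x / (4 * g z) with hδ
  have hδz : δ * g z = -w x / 4 := by have := hgpos z; rw [hδ]; field_simp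
  have hδ0 : 0 < δ := div_pos (by linarith) (by linarith [hgpos z])
  have h1 := le_on_closedBall h hw (contDiff_infty.1 hg 2) heq hlt (m := 3 * w x / 4) hδ0 hR0
    (by linarith) (fun y hy => ?_) x (le_max_right _ _)
  · have := mul_pos hδ0 (hgpos x)
    linarith
  · have h2 := hR y (by rw [hy]; exact le_max_left _ _)
    have h3 := mul_le_mul_of_nonneg_left (hz' y hy.le) hδ0.le
    linarith

lemma eq_of_tendsto {a : Fin 3 → Fin 3 → E3 → ℝ} {q p : E3 → ℝ} (h : Coeffs a q) {u v : E3 → ℝ}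
    {l : ℝ} (hu : ContDiff ℝ 2 u) (hv : ContDiff ℝ 2 v) (hue : ∀ x, divA a u x = q x * u x + p x)
    (hve : ∀ x, divA a v x = q x * v x + p x) (hul : Tendsto u (cocompact E3) (nhds l))
    (hvl : Tendsto v (cocompact E3) (nhds l)) : u = v := by
  have key : ∀ {u v : E3 → ℝ}, ContDiff ℝ 2 u → ContDiff ℝ 2 v →
      (∀ x, divA a u x = q x * u x + p x) → (∀ x, divA a v x = q x * v x + p x) →
      Tendsto u (cocompact E3) (nhds l) → Tendsto v (cocompact E3) (nhds l) → ∀ x, v x ≤ u x := by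
    intro u v hu hv hue hve hul hvl x
    have h1 := nonneg_of_tendsto h (w := fun y => u y - 1 * v y) (hu.sub (contDiff_const.mul hv))
      (fun y => by rw [divA_sub_mul h.symb_a hu hv, hue, hve]; ring)
      (by simpa using hul.sub hvl) x
    linarith
  exact funext fun x => le_antisymm (key hv hu hve hue hvl hul x) (key hu hv hue hve hul hvl x)

lemma exists_pos_le {a : Fin 3 → Fin 3 → E3 → ℝ} {q : E3 → ℝ} (h : Coeffs a q) {w : E3 → ℝ}
    (hw : ContDiff ℝ 2 w) (heq : ∀ x, divA a w x = q x * w x)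
    (h1 : Tendsto w (cocompact E3) (nhds 1)) : ∃ ε > 0, ∀ x, ε ≤ w x := by
  obtain ⟨g, hg, hgpos, hlt⟩ := exists_barrier h
  obtain ⟨R, hR⟩ : ∃ R, ∀ y : E3, R ≤ ‖y‖ → 1 / 2 < w y :=
    exists_radius (h1.eventually (lt_mem_nhds (by norm_num)))
  refine exists_pos_lower_bound hw.continuous (fun x => ?_) one_pos h1
  set R' := max R (‖x‖) with hR'
  have hR0 : 0 ≤ R' := (norm_nonneg x).trans (le_max_right _ _)
  obtain ⟨z, -, hz⟩ := (isCompact_closedBall (0 : E3) R').exists_isMaxOn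
    ⟨0, by simpa using hR0⟩ hg.continuous.continuousOn
  have hz' : ∀ y : E3, ‖y‖ ≤ R' → g y ≤ g z := fun y hy => hz (by simpa using hy)
  have hδ0 : 0 < 1 / (2 * g z) := by have := hgpos z; positivity
  have hδz : 1 / (2 * g z) * g z = 1 / 2 := by have := hgpos z; field_simp
  have h1 := le_on_closedBall h hw (contDiff_infty.1 hg 2) heq hlt (m := 0) hδ0 hR0
    le_rfl (fun y hy => ?_) x (le_max_right _ _)
  · have := mul_pos hδ0 (hgpos x)
    linarith
  · have h2 := hR y (by rw [hy]; exact le_max_left _ _)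
    have h3 := mul_le_mul_of_nonneg_left (hz' y hy.le) hδ0.le
    linarith

theorem exists_isSol {a : Fin 3 → Fin 3 → E3 → ℝ} {q : E3 → ℝ} (h : Coeffs a q) :
    ∃ u, ContDiff ℝ ∞ u ∧ IsSol a q u := by
  obtain ⟨u, hu, hsol⟩ := exists_isSol_nat h 0
  refine ⟨u, contDiff_infty.2 fun k => ?_, hsol⟩
  obtain ⟨v, hv, hvsol⟩ := exists_isSol_nat h k
  have hv2 : ContDiff ℝ 2 v := hv.of_le (by norm_cast; omega)
  rw [eq_of_tendsto h hu hv2 hsol.eq hvsol.eq hsol.tendsto hvsol.tendsto]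
  exact hv.of_le (by norm_cast; omega)

/-! ### Weighted square-integrability -/

/-- Membership of `⟨x⟩^s g` in `L²`. -/
def L2w (s : ℤ) (g : E3 → ℝ) : Prop := MemLp (fun x => jb x ^ s * g x) 2 (volume : Measure E3)

lemma L2w.integrable_sq {s : ℤ} {g : E3 → ℝ} (h : L2w s g) :
    Integrable fun x => (jb x ^ s * g x) ^ 2 := MemLp.integrable_sq h

lemma L2w.add (s : ℤ) (f g : E3 → ℝ) (hf : L2w s f) (hg : L2w s g) :
    L2w s (fun x => f x + g x) := by
  refine (MemLp.add hf hg).congr_norm ?_ (Eventually.of_forall fun x => ?_)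
  · exact (hf.aestronglyMeasurable.add hg.aestronglyMeasurable).congr
      (Eventually.of_forall fun x => by simp only [Pi.add_apply]; ring)
  · simp only [Pi.add_apply, mul_add]

lemma L2w.symb_mul (s t : ℤ) (f g : E3 → ℝ) (hfc : Continuous f) (hgc : Continuous g)
    (hf : DecayBd s f) (hg : L2w t g) : L2w (s + t) (fun x => f x * g x) := by
  obtain ⟨C, hC⟩ := hf
  refine MemLp.of_le_mul (c := C) hg
    ((continuous_jb_zpow _).mul (hfc.mul hgc)).aestronglyMeasurable
    (Eventually.of_forall fun x => ?_)
  have hj := jb_pos x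
  have h1 : jb x ^ (s + t) * (f x * g x) = (f x * jb x ^ s) * (jb x ^ t * g x) := by
    rw [zpow_add₀ hj.ne']; ring
  rw [h1, norm_mul]
  refine mul_le_mul_of_nonneg_right ?_ (norm_nonneg _)
  rw [norm_mul, Real.norm_eq_abs, Real.norm_eq_abs, abs_of_pos (zpow_pos hj s)]
  exact hC x

lemma L2w.weaken {s t : ℤ} (hst : t ≤ s) {g : E3 → ℝ} (hgc : Continuous g) (hg : L2w s g) :
    L2w t g := by
  have h1 : DecayBd (t - s) fun _ : E3 => (1 : ℝ) := ⟨1, fun x => by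
    rw [abs_one, one_mul]
    exact zpow_le_one_of_nonpos₀ (one_le_jb x) (by linarith)⟩
  simpa using L2w.symb_mul _ _ _ _ continuous_const hgc h1 hg

lemma tower_L2w_add {n : ℕ} {s : ℤ} {f g : E3 → ℝ} (hf : ContDiff ℝ ∞ f) (hg : ContDiff ℝ ∞ g)
    (h₁ : Tower L2w n s f) (h₂ : Tower L2w n s g) : Tower L2w n s (fun x => f x + g x) :=
  Tower.add (fun s f g _ _ => L2w.add s f g) hf hg h₁ h₂

lemma tower_L2w_sum {n : ℕ} {s : ℤ} {f : Fin 3 → E3 → ℝ} (hf : ∀ i, ContDiff ℝ ∞ (f i))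
    (h : ∀ i, Tower L2w n s (f i)) : Tower L2w n s (fun x => ∑ i, f i x) := by
  simp only [Fin.sum_univ_three]
  exact tower_L2w_add ((hf 0).add (hf 1)) (hf 2) (tower_L2w_add (hf 0) (hf 1) (h 0) (h 1)) (h 2)

lemma Symb.mul_tower_L2w {n : ℕ} {s t r : ℤ} {f g : E3 → ℝ} (hf : Symb s f)
    (hg : ContDiff ℝ ∞ g) (h : Tower L2w n t g) (hr : s + t = r) :
    Tower L2w n r (fun x => f x * g x) := by
  subst hr
  exact Tower.mul (fun s f g _ _ => L2w.add s f g)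
    (fun s t f g hf hg => L2w.symb_mul s t f g hf.continuous hg.continuous) hf.smooth hg
    (hf.tower n) h

lemma Tower.weaken_L2w {n : ℕ} {s t : ℤ} {g : E3 → ℝ} (hg : ContDiff ℝ ∞ g)
    (h : Tower L2w n s g) (hst : t ≤ s) : Tower L2w n t g := by
  have := Tower.weaken (Q := L2w) (k := s - t)
    (fun r g hg h => L2w.weaken (by linarith) hg.continuous h) hg h
  simpa using this

lemma Symb.tower_L2w {s t : ℤ} {p : E3 → ℝ} (hp : Symb s p) (hst : t + 2 ≤ s) (n : ℕ) :
    Tower L2w n t p := by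
  induction n generalizing s t p with
  | zero =>
    have h : Symb 2 fun x => jb x ^ t * p x := by
      have := (symb_jb_zpow t).mul hp
      exact this.weaken (by linarith)
    exact memLp_symb_two h
  | succ n ih => exact ⟨(ih hp hst).base, fun i => ih (hp.pd i) (by linarith)⟩

/-! ### The Caccioppoli estimate -/

lemma pd3_comp_affine {g : E3 → ℝ} (hg : Differentiable ℝ g) (c : ℝ) (x : E3) (i : Fin 3) :
    pd3 i (fun y => g (x + c • y)) = fun y => c * pd3 i g (x + c • y) := by
  funext y
  have h1 : HasFDerivAt (fun y : E3 => x + c • y) (c • ContinuousLinearMap.id ℝ E3) y :=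
    ((hasFDerivAt_id y).const_smul c).const_add x
  have h2 := (hg (x + c • y)).hasFDerivAt.comp y h1
  rw [pd3, HasFDerivAt.fderiv (f := fun y => g (x + c • y)) h2]
  simp [pd3]

/-- A smooth bump function supported in the ball of radius `1 / 2`. -/
def bump : ContDiffBump (0 : E3) := ⟨1 / 4, 1 / 2, by norm_num, by norm_num⟩

lemma bump_smooth : ContDiff ℝ ∞ bump := bump.contDiff

/-- The cutoff at scale `n + 1`. -/
def cutoff (n : ℕ) (x : E3) : ℝ := bump (((n : ℝ) + 1)⁻¹ • x)

lemma cutoff_smooth (n : ℕ) : ContDiff ℝ ∞ (cutoff n) :=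
  bump_smooth.comp (contDiff_const_smul _)

lemma cutoff_hasCompactSupport (n : ℕ) : HasCompactSupport (cutoff n) :=
  bump.hasCompactSupport.comp_smul (by positivity)

lemma abs_cutoff_le (n : ℕ) (x : E3) : |cutoff n x| ≤ 1 := by
  rw [cutoff, abs_of_nonneg bump.nonneg]
  exact bump.le_one

lemma tendsto_cutoff (x : E3) : Tendsto (fun n => cutoff n x) atTop (nhds 1) := by
  have h1 : Tendsto (fun n : ℕ => ((n : ℝ) + 1)⁻¹ • x) atTop (nhds 0) := by
    have := (tendsto_one_div_add_atTop_nhds_zero_nat (𝕜 := ℝ)).smul_const x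
    simpa [one_div] using this
  have h2 := (bump.continuous.tendsto 0).comp h1
  rwa [bump.one_of_mem_closedBall (by simp [bump])] at h2

lemma exists_abs_pd3_cutoff_le : ∃ B, 0 ≤ B ∧ ∀ n i x, |pd3 i (cutoff n) x| * jb x ≤ B := by
  have h1 : ∀ i, ∃ B, ∀ y : E3, ‖pd3 i bump y * (1 + ‖y‖)‖ ≤ B := fun i =>
    ((contDiff_pd3 bump_smooth i).continuous.mul
      (by fun_prop)).bounded_above_of_compact_support
      (HasCompactSupport.mul_right (bump.hasCompactSupport.fderiv_apply ℝ _))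
  choose B hB using h1
  have hB0 : ∀ i, 0 ≤ B i := fun i => (norm_nonneg _).trans (hB i 0)
  refine ⟨∑ i, B i, Finset.sum_nonneg fun i _ => hB0 i, fun n i x => ?_⟩
  refine le_trans ?_ (Finset.single_le_sum (fun i _ => hB0 i) (Finset.mem_univ i))
  set r : ℝ := ((n : ℝ) + 1)⁻¹ with hr
  have hr0 : 0 < r := by positivity
  have hr1 : r ≤ 1 := inv_le_one_of_one_le₀ (by linarith [n.cast_nonneg (α := ℝ)])
  have h2 : pd3 i (cutoff n) x = r * pd3 i bump (r • x) := by
    have := congrFun (pd3_comp_affine (smooth_differentiable bump_smooth) r 0 i) x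
    simp only [zero_add] at this
    exact this
  refine le_trans ?_ (hB i (r • x))
  rw [h2, norm_mul, abs_mul, abs_of_pos hr0, Real.norm_eq_abs,
    Real.norm_eq_abs, mul_right_comm, mul_comm]
  refine mul_le_mul_of_nonneg_left ?_ (abs_nonneg _)
  rw [norm_smul, Real.norm_eq_abs, abs_of_pos hr0, abs_of_nonneg (by positivity)]
  have := jb_le_one_add_norm x
  nlinarith [norm_nonneg x]

lemma memLp_of_integral_sq_le {f : ℕ → E3 → ℝ} {g : E3 → ℝ} {M : ℝ} (hfc : ∀ n, Continuous (f n))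
    (hg : Continuous g) (hfi : ∀ n, MemLp (f n) 2 (volume : Measure E3))
    (hM : ∀ n, ∫ x, f n x ^ 2 ≤ M)
    (h : ∀ x, Tendsto (fun n => f n x) atTop (nhds (g x))) :
    MemLp g 2 (volume : Measure E3) := by
  refine ⟨hg.aestronglyMeasurable, ?_⟩
  have h1 := Lp.eLpNorm_lim_le_liminf_eLpNorm (p := 2) (μ := (volume : Measure E3))
    (fun n => (hfc n).aestronglyMeasurable) g (Eventually.of_forall h)
  refine h1.trans_lt (lt_of_le_of_lt ?_ (ENNReal.ofReal_lt_top (r := M ^ (1 / 2 : ℝ))))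
  refine Filter.liminf_le_of_frequently_le' (Eventually.frequently (Eventually.of_forall fun n => ?_))
  rw [(hfi n).eLpNorm_eq_integral_rpow_norm (by norm_num) (by norm_num)]
  refine ENNReal.ofReal_le_ofReal ?_
  rw [ENNReal.toReal_ofNat, ← one_div]
  refine Real.rpow_le_rpow (by positivity) (le_trans (le_of_eq ?_) (hM n)) (by norm_num)
  refine integral_congr_ae (Eventually.of_forall fun x => ?_)
  simp

lemma caccioppoli_pointwise {A : Fin 3 → Fin 3 → ℝ} {c A0 : ℝ} (hc : 0 < c)
    (hA0 : ∀ μ ν, |A μ ν| ≤ A0)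
    (hsymm : ∀ μ ν, A μ ν = A ν μ) (hell : ∀ ξ : Fin 3 → ℝ, c * ∑ i, ξ i ^ 2 ≤
      ∑ μ, ∑ ν, A μ ν * ξ μ * ξ ν) (p d G : Fin 3 → ℝ) (ψ w : ℝ) :
    c / 4 * ∑ i, (ψ * p i) ^ 2 ≤
      (∑ μ, ∑ ν, A μ ν * p ν * (2 * ψ * d μ * w + ψ ^ 2 * p μ)) -
        ∑ μ, G μ * (2 * ψ * d μ * w + ψ ^ 2 * p μ) +
      (c + 3 * A0 + 1) * ∑ i, (w * d i) ^ 2 + (c⁻¹ + 1) * ∑ i, (ψ * G i) ^ 2 := by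
  have h1 := hell fun i => ψ * p i + w * d i
  have h2 : ∑ μ, ∑ ν, A μ ν * (ψ * p μ + w * d μ) * (ψ * p ν + w * d ν) =
      (∑ μ, ∑ ν, A μ ν * p ν * (2 * ψ * d μ * w + ψ ^ 2 * p μ)) +
      ∑ μ, ∑ ν, A μ ν * (w * d μ) * (w * d ν) := by
    simp only [Fin.sum_univ_three]
    rw [hsymm 1 0, hsymm 2 0, hsymm 2 1]
    ring
  have h3 : ∑ μ, ∑ ν, A μ ν * (w * d μ) * (w * d ν) ≤ 3 * A0 * ∑ i, (w * d i) ^ 2 := by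
    calc ∑ μ, ∑ ν, A μ ν * (w * d μ) * (w * d ν)
        ≤ ∑ μ, ∑ ν, A0 * (((w * d μ) ^ 2 + (w * d ν) ^ 2) / 2) := by
          refine Finset.sum_le_sum fun μ _ => Finset.sum_le_sum fun ν _ => ?_
          have e1 := abs_le.1 (hA0 μ ν)
          nlinarith [sq_nonneg (w * d μ - w * d ν), sq_nonneg (w * d μ + w * d ν)]
      _ = _ := by
          simp only [Fin.sum_univ_three]
          ring
  have h4 : ∑ μ, G μ * (2 * ψ * d μ * w + ψ ^ 2 * p μ) ≤
      c / 2 * ∑ i, (ψ * p i + w * d i) ^ 2 + ∑ i, (w * d i) ^ 2 +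
        (c⁻¹ + 1) * ∑ i, (ψ * G i) ^ 2 := by
    simp only [Finset.mul_sum, ← Finset.sum_add_distrib]
    refine Finset.sum_le_sum fun i _ => ?_
    have e1 : G i * (2 * ψ * d i * w + ψ ^ 2 * p i) =
        (ψ * G i) * (ψ * p i + w * d i) + (ψ * G i) * (w * d i) := by ring
    have e2 : (ψ * G i) * (ψ * p i + w * d i) ≤
        c / 2 * (ψ * p i + w * d i) ^ 2 + c⁻¹ * (ψ * G i) ^ 2 := by
      have : c / 2 * (ψ * p i + w * d i) ^ 2 + c⁻¹ * (ψ * G i) ^ 2 -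
          (ψ * G i) * (ψ * p i + w * d i) =
          c / 4 * (ψ * p i + w * d i) ^ 2 + c⁻¹ * (c / 2 * (ψ * p i + w * d i) - ψ * G i) ^ 2 := by
        field_simp
        ring
      have h5 : 0 ≤ c / 4 * (ψ * p i + w * d i) ^ 2 +
        c⁻¹ * (c / 2 * (ψ * p i + w * d i) - ψ * G i) ^ 2 := by positivity
      linarith
    have e3 : (ψ * G i) * (w * d i) ≤ (w * d i) ^ 2 + (ψ * G i) ^ 2 := by
      nlinarith [sq_nonneg (ψ * G i - w * d i), sq_nonneg (ψ * G i), sq_nonneg (w * d i)]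
    rw [e1]
    linarith
  have h5 : c / 4 * ∑ i, (ψ * p i) ^ 2 ≤
      c / 2 * ∑ i, (ψ * p i + w * d i) ^ 2 + c * ∑ i, (w * d i) ^ 2 := by
    simp only [Finset.mul_sum, ← Finset.sum_add_distrib]
    refine Finset.sum_le_sum fun i _ => ?_
    nlinarith [mul_nonneg hc.le (sq_nonneg (ψ * p i + 2 * (w * d i))), mul_nonneg hc.le (sq_nonneg (w * d i))]
  linarith

lemma caccioppoli {a : Fin 3 → Fin 3 → E3 → ℝ} {q : E3 → ℝ} (h : Coeffs a q) {w : E3 → ℝ}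
    (hw : ContDiff ℝ ∞ w) {G : Fin 3 → E3 → ℝ} (hG : ∀ μ, ContDiff ℝ ∞ (G μ)) {t : ℤ}
    (hwt : L2w t w) (hGt : ∀ μ, L2w (t + 1) (G μ))
    (heq : ∀ x, divA a w x = ∑ μ, pd3 μ (G μ) x) (i : Fin 3) : L2w (t + 1) (pd3 i w) := by
  obtain ⟨c, hc, hell⟩ := h.elliptic
  choose A hA0 hA using fun μ ν => (h.symb_a μ ν).abs_le le_rfl
  set A0 := ∑ μ, ∑ ν, A μ ν with hA0def
  have hAle : ∀ x μ ν, |a μ ν x| ≤ A0 := fun x μ ν => by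
    refine (hA μ ν x).trans ?_
    refine (Finset.single_le_sum (f := fun ν => A μ ν) (fun ν _ => hA0 μ ν)
      (Finset.mem_univ ν)).trans ?_
    exact Finset.single_le_sum (f := fun μ => ∑ ν, A μ ν)
      (fun μ _ => Finset.sum_nonneg fun ν _ => hA0 μ ν) (Finset.mem_univ μ)
  have hA00 : 0 ≤ A0 := (abs_nonneg _).trans (hAle 0 0 0)
  obtain ⟨B, hB0, hB⟩ := exists_abs_pd3_cutoff_le
  choose D hD0 hD using fun i => ((symb_jb_zpow (t + 1)).pd i).bound
  set K := B + ∑ i, D i with hK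
  have hK0 : 0 ≤ K := add_nonneg hB0 (Finset.sum_nonneg fun i _ => hD0 i)
  set ψ : ℕ → E3 → ℝ := fun n x => cutoff n x * jb x ^ (t + 1) with hψ
  have hψs : ∀ n, ContDiff ℝ ∞ (ψ n) := fun n => (cutoff_smooth n).mul (contDiff_jb_zpow _)
  have hψc : ∀ n, HasCompactSupport (ψ n) := fun n => (cutoff_hasCompactSupport n).mul_right
  have hψd : ∀ n μ x, |pd3 μ (ψ n) x| ≤ K * jb x ^ t := fun n μ x => by
    have hj := jb_pos x
    rw [hψ, pd3_mul (smooth_differentiable (cutoff_smooth n) x)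
      (smooth_differentiable (contDiff_jb_zpow _) x)]
    have h1 : |pd3 μ (cutoff n) x * jb x ^ (t + 1)| ≤ B * jb x ^ t := by
      rw [abs_mul, abs_of_pos (zpow_pos hj _), zpow_add_one₀ hj.ne']
      calc |pd3 μ (cutoff n) x| * (jb x ^ t * jb x)
          = (|pd3 μ (cutoff n) x| * jb x) * jb x ^ t := by ring
        _ ≤ _ := mul_le_mul_of_nonneg_right (hB n μ x) (zpow_pos hj _).le
    have h2 : |cutoff n x * pd3 μ (fun y => jb y ^ (t + 1)) x| ≤ (∑ i, D i) * jb x ^ t := by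
      have h3 := hD μ x
      rw [show -(t + 1) + 1 = -t by ring, zpow_neg, ← div_eq_mul_inv, div_le_iff₀ (zpow_pos hj _)]
        at h3
      rw [abs_mul]
      refine (mul_le_of_le_one_left (abs_nonneg _) (abs_cutoff_le n x)).trans (h3.trans ?_)
      exact mul_le_mul_of_nonneg_right (Finset.single_le_sum (fun i _ => hD0 i)
        (Finset.mem_univ μ)) (zpow_pos hj _).le
    refine (abs_add_le _ _).trans ?_
    rw [hK, add_mul]
    exact add_le_add h1 h2
  set F : E3 → ℝ := fun x => (c + 3 * A0 + 1) * (3 * (K ^ 2 * (jb x ^ t * w x) ^ 2)) +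
    (c⁻¹ + 1) * ∑ μ, (jb x ^ (t + 1) * G μ x) ^ 2 with hF
  have hFi : Integrable F :=
    (((hwt.integrable_sq.const_mul _).const_mul _).const_mul _).add
      ((integrable_finsetSum _ fun μ _ => (hGt μ).integrable_sq).const_mul _)
  have hcts : Continuous (pd3 i w) := (contDiff_pd3 hw i).continuous
  have hψpc : ∀ n, HasCompactSupport fun x => ψ n x * pd3 i w x := fun n => (hψc n).mul_right
  have hψpd : ∀ n, Continuous fun x => ψ n x * pd3 i w x := fun n =>
    (hψs n).continuous.mul hcts
  refine memLp_of_integral_sq_le (f := fun n x => ψ n x * pd3 i w x) (M := (c / 4)⁻¹ * ∫ x, F x)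
    hψpd ((continuous_jb_zpow _).mul hcts)
    (fun n => (hψpd n).memLp_of_hasCompactSupport (hψpc n)) (fun n => ?_) fun x => ?_
  · set T : E3 → ℝ := fun x => ψ n x * (ψ n x * w x) with hT
    have hTs : ContDiff ℝ ∞ T := (hψs n).mul ((hψs n).mul hw)
    have hTc : HasCompactSupport T := (hψc n).mul_right
    have hTpd : ∀ μ x, pd3 μ T x = 2 * ψ n x * pd3 μ (ψ n) x * w x + ψ n x ^ 2 * pd3 μ w x := by
      intro μ x
      have e1 := smooth_differentiable (hψs n) x
      have e2 := smooth_differentiable hw x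
      rw [hT, pd3_mul e1 (e1.fun_mul e2), pd3_mul e1 e2]
      ring
    have hTpc : ∀ μ, HasCompactSupport (pd3 μ T) := fun μ => hTc.fderiv_apply ℝ _
    have hTpd' : ∀ μ, Continuous (pd3 μ T) := fun μ => (contDiff_pd3 hTs μ).continuous
    set P : E3 → ℝ := fun x => ∑ μ, ∑ ν, a μ ν x * pd3 ν w x * pd3 μ T x with hP
    set Q : E3 → ℝ := fun x => ∑ μ, G μ x * pd3 μ T x with hQ
    have hQi1 : ∀ μ, Integrable fun x => G μ x * pd3 μ T x := fun μ =>
      ((hG μ).continuous.mul (hTpd' μ)).integrable_of_hasCompactSupport (hTpc μ).mul_left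
    have hQi : Integrable Q := integrable_finsetSum _ fun μ _ => hQi1 μ
    have hPi : Integrable P := integrable_finsetSum _ fun μ _ => integrable_finsetSum _ fun ν _ =>
      ((((h.symb_a μ ν).smooth.continuous.mul (contDiff_pd3 hw ν).continuous).mul
        (hTpd' μ)).integrable_of_hasCompactSupport (hTpc μ).mul_left)
    have hPQ : ∫ x, P x = ∫ x, Q x := by
      have e1 := integral_mul_divA h.symb_a (contDiff_infty.1 hw 2) (contDiff_infty.1 hTs 1) hTc
      have e2 : ∫ x, Q x = -∫ x, divA a w x * T x := by
        simp only [hQ, heq, Finset.sum_mul]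
        rw [integral_finsetSum _ fun μ _ => hQi1 μ, integral_finsetSum _ fun μ _ => ?_,
          ← Finset.sum_neg_distrib]
        · exact Finset.sum_congr rfl fun μ _ => integral_mul_pd3 (contDiff_infty.1 (hG μ) 1)
            (contDiff_infty.1 hTs 1) hTc μ
        · exact ((contDiff_pd3 (hG μ) μ).continuous.mul
            hTs.continuous).integrable_of_hasCompactSupport hTc.mul_left
      rw [e2, e1, neg_neg]
    have hpt : ∀ x, c / 4 * (ψ n x * pd3 i w x) ^ 2 ≤ P x - Q x + F x := fun x => by
      have hj := jb_pos x
      have e1 := caccioppoli_pointwise hc (hAle x) (fun μ ν => congrFun (h.symm μ ν) x) (hell x)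
        (fun μ => pd3 μ w x) (fun μ => pd3 μ (ψ n) x) (fun μ => G μ x) (ψ n x) (w x)
      have e2 : (ψ n x * pd3 i w x) ^ 2 ≤ ∑ i, (ψ n x * pd3 i w x) ^ 2 :=
        Finset.single_le_sum (f := fun i => (ψ n x * pd3 i w x) ^ 2) (fun _ _ => sq_nonneg _)
          (Finset.mem_univ i)
      have e3 : ∑ i, (w x * pd3 i (ψ n) x) ^ 2 ≤ 3 * (K ^ 2 * (jb x ^ t * w x) ^ 2) := by
        have : ∀ i, (w x * pd3 i (ψ n) x) ^ 2 ≤ K ^ 2 * (jb x ^ t * w x) ^ 2 := fun i => by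
          rw [← mul_pow, ← sq_abs, ← sq_abs (K * (jb x ^ t * w x))]
          refine pow_le_pow_left₀ (abs_nonneg _) ?_ 2
          rw [abs_mul, abs_mul, abs_mul, abs_of_nonneg hK0, abs_of_pos (zpow_pos hj t)]
          calc |w x| * |pd3 i (ψ n) x| ≤ |w x| * (K * jb x ^ t) :=
                mul_le_mul_of_nonneg_left (hψd n i x) (abs_nonneg _)
            _ = _ := by ring
        refine (Finset.sum_le_sum fun i _ => this i).trans_eq ?_
        simp
      have e4 : ∑ μ, (ψ n x * G μ x) ^ 2 ≤ ∑ μ, (jb x ^ (t + 1) * G μ x) ^ 2 := by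
        refine Finset.sum_le_sum fun μ _ => ?_
        rw [← sq_abs, ← sq_abs (jb x ^ (t + 1) * G μ x)]
        refine pow_le_pow_left₀ (abs_nonneg _) ?_ 2
        rw [hψ]
        simp only [abs_mul, mul_assoc]
        exact mul_le_of_le_one_left (by positivity) (abs_cutoff_le n x)
      have e5 := mul_le_mul_of_nonneg_left e2 (by positivity : 0 ≤ c / 4)
      have e6 := mul_le_mul_of_nonneg_left e3 (by positivity : 0 ≤ c + 3 * A0 + 1)
      have e7 := mul_le_mul_of_nonneg_left e4 (by positivity : 0 ≤ c⁻¹ + 1)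
      simp only [hP, hQ, hF, hTpd]
      linarith
    have hL : Integrable fun x => (ψ n x * pd3 i w x) ^ 2 :=
      ((hψpd n).memLp_of_hasCompactSupport (p := 2) (hψpc n)).integrable_sq
    have h1 := integral_mono (hL.const_mul (c / 4)) ((hPi.sub hQi).add hFi) hpt
    have h2 : ∫ x, ((P - Q) + F) x = ∫ x, F x := by
      rw [integral_add' (hPi.sub hQi) hFi, integral_sub' hPi hQi, hPQ]
      ring
    rw [h2, integral_const_mul] at h1
    rw [inv_mul_eq_div, le_div_iff₀ (by positivity)]
    linarith
  · have := ((tendsto_cutoff x).mul_const (jb x ^ (t + 1))).mul_const (pd3 i w x)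
    simpa using this

/-! ### Weighted regularity -/

lemma divA_pd3 {a : Fin 3 → Fin 3 → E3 → ℝ} (ha : ∀ μ ν, ContDiff ℝ ∞ (a μ ν)) {v F : E3 → ℝ}
    (hv : ContDiff ℝ ∞ v) (heq : ∀ x, divA a v x = F x) (i : Fin 3) (x : E3) :
    divA a (pd3 i v) x =
      pd3 i F x - ∑ μ, pd3 μ (fun y => ∑ ν, pd3 i (a μ ν) y * pd3 ν v y) x := by
  have hflux : ∀ μ, ContDiff ℝ ∞ fun y => ∑ ν, a μ ν y * pd3 ν v y := fun μ =>
    ContDiff.sum fun ν _ => (ha μ ν).mul (contDiff_pd3 hv ν)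
  have h1 : pd3 i F x = ∑ μ, pd3 μ (pd3 i fun y => ∑ ν, a μ ν y * pd3 ν v y) x := by
    rw [← funext heq]
    unfold divA
    rw [pd3_sum _ fun μ _ => smooth_differentiable (contDiff_pd3 (hflux μ) μ) x]
    exact Finset.sum_congr rfl fun μ _ =>
      congrFun (pd3_comm (contDiff_infty.1 (hflux μ) 2) i μ) x
  have h2 : ∀ μ, (pd3 i fun y => ∑ ν, a μ ν y * pd3 ν v y) = fun y =>
      (∑ ν, pd3 i (a μ ν) y * pd3 ν v y) + ∑ ν, a μ ν y * pd3 ν (pd3 i v) y := fun μ => by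
    funext y
    rw [pd3_sum _ fun ν _ => smooth_differentiable ((ha μ ν).mul (contDiff_pd3 hv ν)) y,
      ← Finset.sum_add_distrib]
    refine Finset.sum_congr rfl fun ν _ => ?_
    rw [pd3_mul (smooth_differentiable (ha μ ν) y) (smooth_differentiable (contDiff_pd3 hv ν) y),
      pd3_comm (contDiff_infty.1 hv 2) i ν]
  rw [h1, divA, ← Finset.sum_sub_distrib]
  refine Finset.sum_congr rfl fun μ _ => ?_
  have e1 : ContDiff ℝ ∞ fun y => ∑ ν, pd3 i (a μ ν) y * pd3 ν v y :=
    ContDiff.sum fun ν _ => (contDiff_pd3 (ha μ ν) i).mul (contDiff_pd3 hv ν)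
  have e2 : ContDiff ℝ ∞ fun y => ∑ ν, a μ ν y * pd3 ν (pd3 i v) y :=
    ContDiff.sum fun ν _ => (ha μ ν).mul (contDiff_pd3 (contDiff_pd3 hv i) ν)
  rw [h2, pd3_add (smooth_differentiable e1 x) (smooth_differentiable e2 x), add_sub_cancel_left]

lemma tower_L2w_commutator {a : Fin 3 → Fin 3 → E3 → ℝ} (ha : ∀ μ ν, Symb 0 (a μ ν)) {v : E3 → ℝ}
    (hv : ContDiff ℝ ∞ v) {n : ℕ} {s : ℤ} (h : Tower L2w (n + 1) s v) (i μ : Fin 3) :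
    Tower L2w n (s + 2) fun y => ∑ ν, pd3 i (a μ ν) y * pd3 ν v y :=
  tower_L2w_sum (fun ν => (contDiff_pd3 (ha μ ν).smooth i).mul (contDiff_pd3 hv ν)) fun ν =>
    ((ha μ ν).pd i).mul_tower_L2w (contDiff_pd3 hv ν) (h.2 ν) (by ring)

lemma tower_L2w_sub {n : ℕ} {s : ℤ} {f g : E3 → ℝ} (hf : ContDiff ℝ ∞ f) (hg : ContDiff ℝ ∞ g)
    (h₁ : Tower L2w n s f) (h₂ : Tower L2w n s g) : Tower L2w n s (fun x => f x - g x) := by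
  have := tower_L2w_add hf (contDiff_const.mul hg) h₁
    ((Symb.const (-1)).mul_tower_L2w hg h₂ (zero_add s))
  simpa [sub_eq_add_neg] using this

lemma tower_L2w_second {a : Fin 3 → Fin 3 → E3 → ℝ} {q : E3 → ℝ} (h : Coeffs a q) {v F : E3 → ℝ}
    (hv : ContDiff ℝ ∞ v) (hF : ContDiff ℝ ∞ F) (heq : ∀ x, divA a v x = F x) {s : ℤ}
    (hvt : Tower L2w 1 s v) (hFt : L2w (s + 2) F) : Tower L2w 2 s v := by
  refine ⟨hvt.1, fun i => ⟨hvt.2 i, fun j => ?_⟩⟩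
  have hR : ∀ μ, ContDiff ℝ ∞ fun y => ∑ ν, pd3 i (a μ ν) y * pd3 ν v y := fun μ =>
    ContDiff.sum fun ν _ => (contDiff_pd3 (h.symb_a μ ν).smooth i).mul (contDiff_pd3 hv ν)
  have hRt := fun μ => tower_L2w_commutator h.symb_a hv hvt i μ
  have hδ : ∀ μ, ContDiff ℝ ∞ fun y => (if μ = i then (1 : ℝ) else 0) * F y := fun μ =>
    contDiff_const.mul hF
  refine caccioppoli h (contDiff_pd3 hv i)
    (G := fun μ y => (if μ = i then 1 else 0) * F y - ∑ ν, pd3 i (a μ ν) y * pd3 ν v y)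
    (fun μ => (hδ μ).sub (hR μ)) (hvt.2 i) (fun μ => ?_) (fun x => ?_) j
  · have h1 : Tower L2w 0 (s + 2) fun y => (if μ = i then (1 : ℝ) else 0) * F y :=
      (Symb.const _).mul_tower_L2w (n := 0) hF hFt (zero_add _)
    rw [show s + 1 + 1 = s + 2 by ring]
    exact tower_L2w_sub (n := 0) (hδ μ) (hR μ) h1 (hRt μ)
  · rw [divA_pd3 (fun μ ν => (h.symb_a μ ν).smooth) hv heq]
    simp_rw [pd3_sub (smooth_differentiable (hδ _) x) (smooth_differentiable (hR _) x),
      pd3_const_mul _ (smooth_differentiable hF x), Finset.sum_sub_distrib]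
    simp

lemma tower_L2w_elliptic {a : Fin 3 → Fin 3 → E3 → ℝ} {q : E3 → ℝ} (h : Coeffs a q) (n : ℕ)
    {v F : E3 → ℝ} (hv : ContDiff ℝ ∞ v) (hF : ContDiff ℝ ∞ F) (heq : ∀ x, divA a v x = F x)
    {s : ℤ} (hvt : Tower L2w 1 s v) (hFt : Tower L2w n (s + 2) F) : Tower L2w (n + 2) s v := by
  induction n generalizing v F s with
  | zero => exact tower_L2w_second h hv hF heq hvt hFt
  | succ n ih =>
    have h1 : Tower L2w (n + 2) s v := ih hv hF heq hvt hFt.pred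
    refine ⟨hvt.1, fun i => ?_⟩
    have hR : ∀ μ, ContDiff ℝ ∞ fun y => ∑ ν, pd3 i (a μ ν) y * pd3 ν v y := fun μ =>
      ContDiff.sum fun ν _ => (contDiff_pd3 (h.symb_a μ ν).smooth i).mul (contDiff_pd3 hv ν)
    have hRp := fun μ => contDiff_pd3 (hR μ) μ
    refine ih (contDiff_pd3 hv i) ((contDiff_pd3 hF i).sub (ContDiff.sum fun μ _ => hRp μ))
      (divA_pd3 (fun μ ν => (h.symb_a μ ν).smooth) hv heq i)
      ((h1.2 i).mono (by omega)) ?_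
    rw [show s + 1 + 2 = s + 2 + 1 by ring]
    exact tower_L2w_sub (contDiff_pd3 hF i) (ContDiff.sum fun μ _ => hRp μ) (hFt.2 i)
      (tower_L2w_sum hRp fun μ => (tower_L2w_commutator h.symb_a hv h1 i μ).2 μ)

lemma IsSol.tower_L2w {a : Fin 3 → Fin 3 → E3 → ℝ} {q u : E3 → ℝ} (h : Coeffs a q)
    (hu : ContDiff ℝ ∞ u) (hsol : IsSol a q u) (n : ℕ) : Tower L2w n (-1) u := by
  have h0 : Tower L2w 1 (-1) u := by
    refine ⟨?_, fun i => ?_⟩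
    · simpa [L2w] using hsol.memLp
    · simpa [L2w, Tower] using hsol.memLp_pd i
  suffices ∀ n, Tower L2w (n + 1) (-1) u from (this n).pred
  intro n
  induction n with
  | zero => exact h0
  | succ n ih =>
    have h1 : Tower L2w n 1 fun x => q x * u x :=
      (h.symb_q.mul_tower_L2w hu ih.pred (r := 2) (by norm_num)).weaken_L2w
        (h.symb_q.smooth.mul hu) (by norm_num)
    have h2 : Tower L2w n 1 q := h.symb_q.tower_L2w (by norm_num) n
    exact tower_L2w_elliptic h n hu ((h.symb_q.smooth.mul hu).add h.symb_q.smooth) hsol.eq h0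
      (tower_L2w_add (h.symb_q.smooth.mul hu) h.symb_q.smooth h1 h2)

/-! ### Pointwise decay -/

lemma zpow_le_of_comparable (s : ℤ) : ∃ K, 0 ≤ K ∧ ∀ a b : ℝ, 0 < a → 0 < b → a ≤ 3 * b →
    b ≤ 3 * a → a ^ s ≤ K * b ^ s := by
  refine ⟨3 ^ s.natAbs, by positivity, fun a b ha hb hab hba => ?_⟩
  obtain hs | hs := s.natAbs_eq
  · rw [hs, zpow_natCast, zpow_natCast, Int.natAbs_natCast, ← mul_pow]
    exact pow_le_pow_left₀ ha.le hab _
  · rw [hs, zpow_neg, zpow_neg, zpow_natCast, zpow_natCast, Int.natAbs_neg, Int.natAbs_natCast,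
      ← div_eq_mul_inv, le_div_iff₀ (by positivity), inv_mul_le_iff₀ (by positivity), mul_comm,
      ← mul_pow]
    exact pow_le_pow_left₀ hb.le hba _

/-- The sum of the absolute values of all derivatives of order at most two. -/
def jet (W : E3 → ℝ) (y : E3) : ℝ :=
  |W y| + ∑ i, |pd3 i W y| + ∑ i, ∑ j, |pd3 j (pd3 i W) y|

/-- The weighted analogue of `jet`. -/
def wjet (s : ℤ) (v : E3 → ℝ) (x : E3) : ℝ :=
  |jb x ^ s * v x| + ∑ i, |jb x ^ (s + 1) * pd3 i v x| +
    ∑ i, ∑ j, |jb x ^ (s + 1 + 1) * pd3 j (pd3 i v) x|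

lemma jet_nonneg (W : E3 → ℝ) (y : E3) : 0 ≤ jet W y := by unfold jet; positivity

lemma memLp_wjet {s : ℤ} {v : E3 → ℝ} (h : Tower L2w 2 s v) :
    MemLp (wjet s v) 2 (volume : Measure E3) :=
  (MemLp.add h.1.norm (memLp_finsetSum _ fun i _ => (h.2 i).1.norm)).add
    (memLp_finsetSum _ fun i _ => memLp_finsetSum _ fun j _ => ((h.2 i).2 j).norm)

lemma abs_le_jet (W : E3 → ℝ) (y : E3) : |W y| ≤ jet W y := by
  unfold jet
  have h1 : 0 ≤ ∑ i, |pd3 i W y| := by positivity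
  have h2 : 0 ≤ ∑ i, ∑ j, |pd3 j (pd3 i W) y| := by positivity
  linarith

lemma abs_pd3_le_jet (W : E3 → ℝ) (i : Fin 3) (y : E3) : |pd3 i W y| ≤ jet W y := by
  unfold jet
  have h1 := Finset.single_le_sum (f := fun i => |pd3 i W y|) (fun _ _ => abs_nonneg _)
    (Finset.mem_univ i)
  have h2 : 0 ≤ ∑ i, ∑ j, |pd3 j (pd3 i W) y| := by positivity
  have h3 := abs_nonneg (W y)
  linarith

lemma abs_pd3_pd3_le_jet (W : E3 → ℝ) (i j : Fin 3) (y : E3) : |pd3 j (pd3 i W) y| ≤ jet W y := by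
  unfold jet
  have h1 := Finset.single_le_sum (f := fun j => |pd3 j (pd3 i W) y|) (fun _ _ => abs_nonneg _)
    (Finset.mem_univ j)
  have h2 := Finset.single_le_sum (f := fun i => ∑ j, |pd3 j (pd3 i W) y|)
    (fun _ _ => Finset.sum_nonneg fun _ _ => abs_nonneg _) (Finset.mem_univ i)
  have h3 : 0 ≤ ∑ i, |pd3 i W y| := by positivity
  have h4 := abs_nonneg (W y)
  linarith

lemma pd3_bump_mul {W : E3 → ℝ} (hW : ContDiff ℝ ∞ W) (i : Fin 3) :
    pd3 i (fun y => bump y * W y) = fun y => pd3 i bump y * W y + bump y * pd3 i W y := by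
  funext y
  exact pd3_mul (smooth_differentiable bump_smooth y) (smooth_differentiable hW y) i

lemma exists_bump_jet : ∃ B, 0 ≤ B ∧ ∀ W, ContDiff ℝ ∞ W → ∀ i j y,
    |pd3 i (fun y => bump y * W y) y| ≤ B * jet W y ∧
    |pd3 i (pd3 j fun y => bump y * W y) y| ≤ B * jet W y := by
  have hc1 := fun i => contDiff_pd3 bump_smooth i
  have hs1 : ∀ i, HasCompactSupport (pd3 i bump) := fun i =>
    bump.hasCompactSupport.fderiv_apply ℝ _
  choose B₁ hB₁ using fun i => (hc1 i).continuous.bounded_above_of_compact_support (hs1 i)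
  choose B₂ hB₂ using fun i j =>
    (contDiff_pd3 (hc1 j) i).continuous.bounded_above_of_compact_support
      ((hs1 j).fderiv_apply ℝ (EuclideanSpace.single i 1))
  have h1 : ∀ i, 0 ≤ B₁ i := fun i => (norm_nonneg _).trans (hB₁ i 0)
  have h2 : ∀ i j, 0 ≤ B₂ i j := fun i j => (norm_nonneg _).trans (hB₂ i j 0)
  set S₁ := ∑ i, B₁ i
  set S₂ := ∑ i, ∑ j, B₂ i j
  have hS₁ : ∀ i y, |pd3 i bump y| ≤ S₁ := fun i y =>
    (hB₁ i y).trans (Finset.single_le_sum (fun i _ => h1 i) (Finset.mem_univ i))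
  have hS₂ : ∀ i j y, |pd3 i (pd3 j bump) y| ≤ S₂ := fun i j y =>
    (hB₂ i j y).trans <| (Finset.single_le_sum (fun j _ => h2 i j) (Finset.mem_univ j)).trans <|
      Finset.single_le_sum (f := fun i => ∑ j, B₂ i j)
        (fun i _ => Finset.sum_nonneg fun j _ => h2 i j) (Finset.mem_univ i)
  have hS₁0 : 0 ≤ S₁ := Finset.sum_nonneg fun i _ => h1 i
  have hS₂0 : 0 ≤ S₂ := Finset.sum_nonneg fun i _ => Finset.sum_nonneg fun j _ => h2 i j
  have hb : ∀ y, |bump y| ≤ 1 := fun y => by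
    rw [abs_of_nonneg bump.nonneg]
    exact bump.le_one
  have hmul : ∀ {a b A N : ℝ}, 0 ≤ A → |a| ≤ A → |b| ≤ N → |a * b| ≤ A * N :=
    fun hA ha hb => by
      rw [abs_mul]
      exact mul_le_mul ha hb (abs_nonneg _) hA
  refine ⟨S₂ + 2 * S₁ + 1, by linarith, fun W hW i j y => ⟨?_, ?_⟩⟩
  · have e1 := hmul hS₁0 (hS₁ i y) (abs_le_jet W y)
    have e2 := hmul zero_le_one (hb y) (abs_pd3_le_jet W i y)
    rw [pd3_bump_mul hW]
    refine (abs_add_le _ _).trans ?_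
    nlinarith [mul_nonneg hS₂0 (jet_nonneg W y), mul_nonneg hS₁0 (jet_nonneg W y)]
  · have d1 := smooth_differentiable (hc1 j) y
    have d2 := smooth_differentiable hW y
    have d3 := smooth_differentiable bump_smooth y
    have d4 := smooth_differentiable (contDiff_pd3 hW j) y
    rw [pd3_bump_mul hW, pd3_add (d1.fun_mul d2) (d3.fun_mul d4), pd3_mul d1 d2, pd3_mul d3 d4]
    have e1 := hmul hS₂0 (hS₂ i j y) (abs_le_jet W y)
    have e2 := hmul hS₁0 (hS₁ j y) (abs_pd3_le_jet W i y)
    have e3 := hmul hS₁0 (hS₁ i y) (abs_pd3_le_jet W j y)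
    have e4 := hmul zero_le_one (hb y) (abs_pd3_pd3_le_jet W j i y)
    have e5 := abs_add_le (pd3 i (pd3 j bump) y * W y) (pd3 j bump y * pd3 i W y)
    have e6 := abs_add_le (pd3 i bump y * pd3 j W y) (bump y * pd3 i (pd3 j W) y)
    refine (abs_add_le _ _).trans ?_
    linarith

lemma pd3_eq_zero {g : E3 → ℝ} {y : E3} (hy : y ∉ tsupport g) (i : Fin 3) : pd3 i g y = 0 :=
  image_eq_zero_of_notMem_tsupport fun h => hy (tsupport_fderiv_apply_subset ℝ _ h)

lemma pd3_pd3_eq_zero {g : E3 → ℝ} {y : E3} (hy : y ∉ tsupport g) (i j : Fin 3) :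
    pd3 i (pd3 j g) y = 0 :=
  pd3_eq_zero (fun h => hy (tsupport_fderiv_apply_subset ℝ _ h)) i

lemma exists_jet_le_wjet (s : ℤ) : ∃ K, 0 ≤ K ∧ ∀ v, ContDiff ℝ ∞ v → ∀ x₀ y : E3, 2 ≤ ‖x₀‖ →
    ‖y‖ ≤ 1 / 2 →
    ‖x₀‖ ^ s * jet (fun y => v (x₀ + ‖x₀‖ • y)) y ≤ K * wjet s v (x₀ + ‖x₀‖ • y) := by
  obtain ⟨K₀, hK₀, h₀⟩ := zpow_le_of_comparable s
  obtain ⟨K₁, hK₁, h₁⟩ := zpow_le_of_comparable (s + 1)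
  obtain ⟨K₂, hK₂, h₂⟩ := zpow_le_of_comparable (s + 1 + 1)
  refine ⟨K₀ + K₁ + K₂, by positivity, fun v hv x₀ y hx hy => ?_⟩
  set R := ‖x₀‖ with hR
  have hR0 : 0 < R := by linarith
  set x := x₀ + R • y with hxdef
  have n1 : ‖R • y‖ ≤ R / 2 := by
    rw [norm_smul, Real.norm_eq_abs, abs_of_pos hR0]
    nlinarith
  have n2 : ‖x‖ ≤ 3 / 2 * R := (norm_add_le _ _).trans (by linarith)
  have n3 : R / 2 ≤ ‖x‖ := by
    have := norm_sub_le_norm_add x₀ (R • y)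
    rw [← hxdef] at this
    linarith
  have hj := jb_pos x
  have n4 : R ≤ 3 * jb x := by linarith [norm_le_jb x]
  have n5 : jb x ≤ 3 * R := by linarith [jb_le_of_one_le (x := x) (by linarith)]
  have hd : ∀ i, pd3 i (fun y => v (x₀ + R • y)) = fun y => R * pd3 i v (x₀ + R • y) := fun i =>
    pd3_comp_affine (smooth_differentiable hv) R x₀ i
  have hdd : ∀ i j, pd3 j (pd3 i fun y => v (x₀ + R • y)) y = R * R * pd3 j (pd3 i v) x :=
    fun i j => by
    have e : Differentiable ℝ fun y => pd3 i v (x₀ + R • y) :=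
      (smooth_differentiable (contDiff_pd3 hv i)).comp (by fun_prop)
    rw [hd, pd3_const_mul R (e y),
      pd3_comp_affine (smooth_differentiable (contDiff_pd3 hv i)) R x₀ j]
    ring
  have hw : ∀ {K : ℝ} {t : ℤ} (z : ℝ), R ^ t ≤ K * jb x ^ t → R ^ t * |z| ≤ K * |jb x ^ t * z| := by
    intro K t z h
    rw [abs_mul, abs_of_pos (zpow_pos hj t), ← mul_assoc]
    exact mul_le_mul_of_nonneg_right h (abs_nonneg _)
  have e0 := hw (v x) (h₀ R (jb x) hR0 hj n4 n5)
  have e1 : ∑ i, R ^ (s + 1) * |pd3 i v x| ≤ ∑ i, K₁ * |jb x ^ (s + 1) * pd3 i v x| :=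
    Finset.sum_le_sum fun i _ => hw _ (h₁ R (jb x) hR0 hj n4 n5)
  have e2 : ∑ i, ∑ j, R ^ (s + 1 + 1) * |pd3 j (pd3 i v) x| ≤
      ∑ i, ∑ j, K₂ * |jb x ^ (s + 1 + 1) * pd3 j (pd3 i v) x| :=
    Finset.sum_le_sum fun i _ => Finset.sum_le_sum fun j _ => hw _ (h₂ R (jb x) hR0 hj n4 n5)
  simp only [← Finset.mul_sum] at e1 e2
  have key : R ^ s * jet (fun y => v (x₀ + R • y)) y = R ^ s * |v x| +
      R ^ (s + 1) * ∑ i, |pd3 i v x| + R ^ (s + 1 + 1) * ∑ i, ∑ j, |pd3 j (pd3 i v) x| := by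
    simp only [jet, hdd]
    simp only [hd, abs_mul, abs_of_pos hR0, ← Finset.mul_sum]
    rw [zpow_add_one₀ hR0.ne' (s + 1), zpow_add_one₀ hR0.ne' s]
    ring
  rw [key, wjet]
  have p0 : 0 ≤ |jb x ^ s * v x| := abs_nonneg _
  have p1 : 0 ≤ ∑ i, |jb x ^ (s + 1) * pd3 i v x| := by positivity
  have p2 : 0 ≤ ∑ i, ∑ j, |jb x ^ (s + 1 + 1) * pd3 j (pd3 i v) x| := by positivity
  have q0 := mul_nonneg (add_nonneg hK₁ hK₂) p0
  have q1 := mul_nonneg (add_nonneg hK₀ hK₂) p1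
  have q2 := mul_nonneg (add_nonneg hK₀ hK₁) p2
  linarith

/-- The mass of the square of a function outside a ball. -/
def tail (M : E3 → ℝ) (r : ℝ) : ℝ := ∫ x, {x : E3 | r ≤ ‖x‖}.indicator (fun x => M x ^ 2) x

lemma measurableSet_norm_ge (r : ℝ) : MeasurableSet {x : E3 | r ≤ ‖x‖} :=
  (isClosed_le continuous_const continuous_norm).measurableSet

lemma tendsto_tail {M : E3 → ℝ} (hM : MemLp M 2 (volume : Measure E3)) :
    Tendsto (tail M) atTop (nhds 0) := by
  have hi := hM.integrable_sq
  have := tendsto_integral_filter_of_dominated_convergence (l := atTop)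
    (F := fun (r : ℝ) x => {x : E3 | r ≤ ‖x‖}.indicator (fun x => M x ^ 2) x) (f := fun _ => 0)
    (fun x => M x ^ 2)
    (Eventually.of_forall fun r => (hi.indicator (measurableSet_norm_ge r)).aestronglyMeasurable)
    (Eventually.of_forall fun r => Eventually.of_forall fun x => ?_) hi
    (Eventually.of_forall fun x => ?_)
  · rwa [integral_zero] at this
  · refine (norm_indicator_le_norm_self _ _).trans_eq ?_
    rw [Real.norm_eq_abs, abs_of_nonneg (sq_nonneg _)]
  · refine tendsto_const_nhds.congr' ?_
    filter_upwards [eventually_gt_atTop ‖x‖] with r hr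
    rw [Set.indicator_of_notMem]
    simpa using hr

lemma exists_sq_le_tail (s : ℤ) : ∃ C, 0 ≤ C ∧ ∀ v, ContDiff ℝ ∞ v → Tower L2w 2 s v →
    ∀ x₀ : E3, 2 ≤ ‖x₀‖ → (‖x₀‖ ^ s * v x₀) ^ 2 * ‖x₀‖ ^ 3 ≤ C * tail (wjet s v) (‖x₀‖ / 2) := by
  obtain ⟨C, hC, hsob⟩ := sq_le_sE
  obtain ⟨B, hB, hbump⟩ := exists_bump_jet
  obtain ⟨K, hK, hjet⟩ := exists_jet_le_wjet s
  refine ⟨C * (12 * (B * K) ^ 2), by positivity, fun v hv hvt x₀ hx => ?_⟩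
  set R := ‖x₀‖ with hR
  have hR0 : 0 < R := by linarith
  set M := wjet s v
  set W : E3 → ℝ := fun y => v (x₀ + R • y) with hWdef
  have hW : ContDiff ℝ ∞ W := hv.comp (contDiff_const.add (contDiff_const_smul R))
  have hsupp : HasCompactSupport fun y => bump y * W y := bump.hasCompactSupport.mul_right
  set g : Sch := hsupp.toSchwartzMap (bump_smooth.mul hW)
  set H : E3 → ℝ := {x : E3 | R / 2 ≤ ‖x‖}.indicator fun x => M x ^ 2 with hH
  have hHi : Integrable H :=
    (memLp_wjet hvt).integrable_sq.indicator (measurableSet_norm_ge _)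
  have hHy : Integrable fun y => H (x₀ + R • y) :=
    (hHi.comp_add_left x₀).comp_smul hR0.ne'
  have hHval : ∫ y, H (x₀ + R • y) = (R ^ 3)⁻¹ * tail M (R / 2) := by
    have e1 := Measure.integral_comp_smul (volume : Measure E3) (fun z => H (x₀ + z)) R
    rw [e1, integral_add_left_eq_self H x₀, tail, smul_eq_mul, finrank_euclideanSpace_fin,
      abs_of_pos (by positivity)]
  have hpt : ∀ (D : Sch), (∀ y, y ∉ tsupport (fun y => bump y * W y) → D y = 0) →
      (∀ y, |D y| ≤ B * jet W y) → (R ^ s) ^ 2 * sN D ^ 2 ≤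
        (B * K) ^ 2 * ((R ^ 3)⁻¹ * tail M (R / 2)) := by
    intro D h0 h1
    rw [sN_sq, ← hHval, ← integral_const_mul, ← integral_const_mul]
    refine integral_mono (((D.memLp 2 volume).integrable_sq).const_mul _) (hHy.const_mul _)
      fun y => ?_
    have hHnn : 0 ≤ H (x₀ + R • y) := Set.indicator_nonneg (fun _ _ => sq_nonneg _) _
    by_cases hy : y ∈ tsupport fun y => bump y * W y
    · have hy2 : ‖y‖ ≤ 1 / 2 := by
        have := tsupport_mul_subset_left hy
        rw [bump.tsupport_eq] at this
        simpa [bump] using this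
      have hmem : R / 2 ≤ ‖x₀ + R • y‖ := by
        have e1 := norm_sub_le_norm_add x₀ (R • y)
        have e2 : ‖R • y‖ ≤ R / 2 := by
          rw [norm_smul, Real.norm_eq_abs, abs_of_pos hR0]
          nlinarith
        linarith
      rw [hH, Set.indicator_of_mem (by exact hmem), ← mul_pow, ← mul_pow, ← sq_abs]
      refine pow_le_pow_left₀ (abs_nonneg _) ?_ 2
      rw [abs_mul, abs_of_pos (zpow_pos hR0 s)]
      have e1 := mul_le_mul_of_nonneg_left (h1 y) (zpow_pos hR0 s).le
      have e2 := mul_le_mul_of_nonneg_left (hjet v hv x₀ y hx hy2) hB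
      calc R ^ s * |D y| ≤ R ^ s * (B * jet W y) := e1
        _ = B * (R ^ s * jet W y) := by ring
        _ ≤ B * (K * wjet s v (x₀ + R • y)) := e2
        _ = _ := by ring
    · simp only [h0 y hy]
      nlinarith [mul_nonneg (sq_nonneg (B * K)) hHnn]
  have hE : (R ^ s) ^ 2 * sE g ≤ 12 * ((B * K) ^ 2 * ((R ^ 3)⁻¹ * tail M (R / 2))) := by
    have e1 : ∀ i, (R ^ s) ^ 2 * sN (sD i g) ^ 2 ≤ (B * K) ^ 2 * ((R ^ 3)⁻¹ * tail M (R / 2)) :=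
      fun i => hpt _ (fun y hy => pd3_eq_zero hy i) fun y => (hbump W hW i i y).1
    have e2 : ∀ i j, (R ^ s) ^ 2 * sN (sD i (sD j g)) ^ 2 ≤
        (B * K) ^ 2 * ((R ^ 3)⁻¹ * tail M (R / 2)) :=
      fun i j => hpt _ (fun y hy => pd3_pd3_eq_zero hy i j) fun y => (hbump W hW i j y).2
    rw [sE, mul_add, Finset.mul_sum]
    simp only [Finset.mul_sum]
    refine (add_le_add (Finset.sum_le_sum fun i _ => e1 i)
      (Finset.sum_le_sum fun i _ => Finset.sum_le_sum fun j _ => e2 i j)).trans_eq ?_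
    simp
    ring
  have hg0 : g 0 = v x₀ := by
    change bump 0 * W 0 = v x₀
    rw [bump.one_of_mem_closedBall (by simp [bump])]
    simp [hWdef]
  have h1 := hsob g 0
  rw [hg0] at h1
  calc (R ^ s * v x₀) ^ 2 * R ^ 3 = (R ^ s) ^ 2 * v x₀ ^ 2 * R ^ 3 := by ring
    _ ≤ (R ^ s) ^ 2 * (C * sE g) * R ^ 3 := by gcongr
    _ = C * ((R ^ s) ^ 2 * sE g) * R ^ 3 := by ring
    _ ≤ C * (12 * ((B * K) ^ 2 * ((R ^ 3)⁻¹ * tail M (R / 2)))) * R ^ 3 := by gcongr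
    _ = _ := by field_simp

lemma isLittleO_of_tower {s : ℤ} {v : E3 → ℝ} (hv : ContDiff ℝ ∞ v) (h : Tower L2w 2 s v) :
    v =o[cocompact E3] fun x => ‖x‖ ^ (-(s : ℝ) - 3 / 2) := by
  obtain ⟨C, hC, hb⟩ := exists_sq_le_tail s
  rw [isLittleO_iff]
  intro c hc
  have h1 : Tendsto (fun x : E3 => C * tail (wjet s v) (‖x‖ / 2)) (cocompact E3) (nhds 0) := by
    have e1 : Tendsto (fun x : E3 => ‖x‖ / 2) (cocompact E3) atTop :=
      tendsto_norm_cocompact_atTop.atTop_div_const (by norm_num)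
    simpa using ((tendsto_tail (memLp_wjet h)).comp e1).const_mul C
  filter_upwards [h1.eventually (gt_mem_nhds (by positivity : 0 < c ^ 2)), eventually_le_norm 2]
    with x hx1 hx2
  have hR0 : 0 < ‖x‖ := by linarith
  have h2 := (hb v hv h x hx2).trans hx1.le
  set P := ‖x‖ ^ (-(s : ℝ) - 3 / 2) with hP
  have hP0 : 0 < P := Real.rpow_pos_of_pos hR0 _
  have hPP : P ^ 2 * ((‖x‖ ^ s) ^ 2 * ‖x‖ ^ 3) = 1 := by
    rw [hP, ← Real.rpow_intCast, ← Real.rpow_natCast, ← Real.rpow_natCast, ← Real.rpow_natCast,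
      ← Real.rpow_mul hR0.le, ← Real.rpow_mul hR0.le, ← Real.rpow_add hR0, ← Real.rpow_add hR0]
    norm_num
    convert Real.rpow_zero ‖x‖ using 2
    ring
  rw [Real.norm_eq_abs, Real.norm_eq_abs, abs_of_pos hP0]
  refine abs_le_of_sq_le_sq ?_ (by positivity)
  calc v x ^ 2 = v x ^ 2 * (P ^ 2 * ((‖x‖ ^ s) ^ 2 * ‖x‖ ^ 3)) := by rw [hPP, mul_one]
    _ = P ^ 2 * ((‖x‖ ^ s * v x) ^ 2 * ‖x‖ ^ 3) := by ring
    _ ≤ P ^ 2 * c ^ 2 := by gcongr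
    _ = _ := by ring

lemma isLittleO_iteratedFDeriv_of_tower {v : E3 → ℝ} (hv : ContDiff ℝ ∞ v) {s : ℤ} (m : ℕ)
    (h : Tower L2w (m + 2) s v) :
    (fun x => ‖iteratedFDeriv ℝ m v x‖) =o[cocompact E3] fun x => ‖x‖ ^ (-(s : ℝ) - 3 / 2 - m) := by
  induction m generalizing v s with
  | zero =>
    simp only [norm_iteratedFDeriv_zero, CharP.cast_eq_zero, sub_zero]
    exact (isLittleO_of_tower hv h).norm_left
  | succ m ih =>
    have h1 : (fun x => ∑ i, ‖iteratedFDeriv ℝ m (pd3 i v) x‖) =o[cocompact E3]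
        fun x => ‖x‖ ^ (-(s : ℝ) - 3 / 2 - (m + 1 : ℕ)) := by
      refine IsLittleO.fun_sum fun i _ => (ih (contDiff_pd3 hv i) (h.2 i)).congr_right fun x => ?_
      congr 1
      push_cast
      ring
    refine (IsBigO.of_norm_le fun x => ?_).trans_isLittleO h1
    rw [norm_norm]
    exact norm_iteratedFDeriv_succ_le hv m x

/-! ### The Laplace–Beltrami equation -/

lemma laplaceBeltrami_eq_iff {γ : E3 → Matrix (Fin 3) (Fin 3) ℝ} (hγ : ∀ x, (γ x).PosDef)
    (f α : E3 → ℝ) (x : E3) : laplaceBeltrami γ α x = f x * α x ↔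
      divA (fun μ ν x => √(γ x).det * (γ x)⁻¹ μ ν) α x = √(γ x).det * f x * α x := by
  have hs : √(γ x).det ≠ 0 := (Real.sqrt_pos.2 (hγ x).det_pos).ne'
  have h : laplaceBeltrami γ α x =
      (√(γ x).det)⁻¹ * divA (fun μ ν x => √(γ x).det * (γ x)⁻¹ μ ν) α x := by
    simp only [laplaceBeltrami, divA, Finset.mul_sum, mul_assoc]
  rw [h, inv_mul_eq_iff_eq_mul₀ hs, mul_assoc]

lemma divA_one_add (a : Fin 3 → Fin 3 → E3 → ℝ) (u : E3 → ℝ) :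
    divA a (fun x => u x + 1) = divA a u := by
  funext x
  simp only [divA, pd3_add_const]

end

theorem stmt0
    (γ : EuclideanSpace ℝ (Fin 3) → Matrix (Fin 3) (Fin 3) ℝ)
    (f : EuclideanSpace ℝ (Fin 3) → ℝ)
    (hγsmooth : ∀ μ ν, ContDiff ℝ (⊤ : ℕ∞) fun x => γ x μ ν)
    (hγsym : ∀ x, (γ x).IsSymm)
    (hγpos : ∀ x, (γ x).PosDef)
    (hγdecay : ∀ μ ν, ∀ m : ℕ,
      (fun x => ‖iteratedFDeriv ℝ m (fun y => γ y μ ν - if μ = ν then 1 else 0) x‖)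
        =o[cocompact (EuclideanSpace ℝ (Fin 3))] fun x => ‖x‖ ^ ((-1/2 : ℝ) - m))
    (hfsmooth : ContDiff ℝ (⊤ : ℕ∞) f)
    (hfnonneg : ∀ x, 0 ≤ f x)
    (hfdecay : ∀ m : ℕ,
      (fun x => ‖iteratedFDeriv ℝ m f x‖)
        =o[cocompact (EuclideanSpace ℝ (Fin 3))] fun x => ‖x‖ ^ ((-3 : ℝ) - m)) :
    ∃ α : EuclideanSpace ℝ (Fin 3) → ℝ,
      (ContDiff ℝ (⊤ : ℕ∞) α ∧
        (∀ x, laplaceBeltrami γ α x = f x * α x) ∧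
        Tendsto α (cocompact (EuclideanSpace ℝ (Fin 3))) (nhds 1)) ∧
      (∀ m : ℕ,
        (fun x => ‖iteratedFDeriv ℝ m (fun y => α y - 1) x‖)
          =o[cocompact (EuclideanSpace ℝ (Fin 3))] fun x => ‖x‖ ^ ((-1/2 : ℝ) - m)) ∧
      (∃ ε > 0, ∀ x, ε ≤ α x) ∧
      (∀ α' : EuclideanSpace ℝ (Fin 3) → ℝ,
        (ContDiff ℝ (⊤ : ℕ∞) α' ∧
          (∀ x, laplaceBeltrami γ α' x = f x * α' x) ∧
          Tendsto α' (cocompact (EuclideanSpace ℝ (Fin 3))) (nhds 1)) → α' = α) := by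
  have h := coeffs_of_metric hγsmooth hγpos hγdecay hfsmooth hfnonneg hfdecay
  obtain ⟨u, hu, hsol⟩ := exists_isSol h
  have hα : ContDiff ℝ (⊤ : ℕ∞) fun x => u x + 1 := hu.add contDiff_const
  have heq : ∀ x, divA _ (fun x => u x + 1) x = _ * (u x + 1) := fun x => by
    rw [divA_one_add, hsol.eq x, mul_add, mul_one]
  have hlim : Tendsto (fun x => u x + 1) (cocompact (EuclideanSpace ℝ (Fin 3))) (nhds 1) := by
    simpa using hsol.tendsto.add_const 1
  refine ⟨fun x => u x + 1, ⟨hα, fun x => (laplaceBeltrami_eq_iff hγpos f _ x).2 (heq x), hlim⟩,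
    fun m => ?_, exists_pos_le h (contDiff_infty.1 hα 2) heq hlim, ?_⟩
  · simp only [add_sub_cancel_right]
    have := isLittleO_iteratedFDeriv_of_tower hu m (hsol.tower_L2w h hu (m + 2))
    norm_num at this ⊢
    exact this
  · rintro α' ⟨hα', heq', hlim'⟩
    exact eq_of_tendsto h (p := fun _ => 0) (contDiff_infty.1 hα' 2) (contDiff_infty.1 hα 2)
      (fun x => by rw [add_zero]; exact (laplaceBeltrami_eq_iff hγpos f α' x).1 (heq' x))
      (fun x => by rw [add_zero]; exact heq x) hlim' hlim

end
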